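/- arXiv:1003.3825 — 3 statements merged into one kernel-verified Lean document; each statement's English description precedes it below -/
import Mathlib

section
/- For every positive integer M and every integer r ≥ 3 there exists a pure O-sequence (h_0, h_1, …, h_e) of codimension r (i.e., with h_1 = r) having exactly M maxima, where a maximum is an index i with 1 ≤ i ≤ e such that h_{i−1} < h_i and either i = e or h_i > h_{i+1}. -/
/-- The degree of a monomial, given by its exponent vector. -/
def monDeg {r : ℕ} (M : Fin r → ℕ) : ℕ := ∑ j, M j

/-- `X` is a (monomial) order ideal: a nonempty finite set of monomials (exponent vectors)
closed under divisibility. -/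
def IsOrderIdeal {r : ℕ} (X : Finset (Fin r → ℕ)) : Prop :=
  X.Nonempty ∧ ∀ M ∈ X, ∀ N : Fin r → ℕ, (∀ j, N j ≤ M j) → N ∈ X

/-- `M` is a maximal monomial of `X` with respect to divisibility. -/
def IsMaxMon {r : ℕ} (X : Finset (Fin r → ℕ)) (M : Fin r → ℕ) : Prop :=
  M ∈ X ∧ ∀ N ∈ X, (∀ j, M j ≤ N j) → N = M

/-- `X` is a pure order ideal with socle degree `e`: it is an order ideal whose maximal
degree is `e` and all of whose maximal monomials have degree `e`. -/
def IsPureWithSocle {r : ℕ} (X : Finset (Fin r → ℕ)) (e : ℕ) : Prop :=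
  IsOrderIdeal X ∧ (∀ M ∈ X, monDeg M ≤ e) ∧ (∃ M ∈ X, monDeg M = e) ∧
    ∀ M, IsMaxMon X M → monDeg M = e

/-- `h` agrees in degrees `≤ e` with the h-vector of `X`. -/
def HasHVector {r : ℕ} (X : Finset (Fin r → ℕ)) (h : ℕ → ℕ) (e : ℕ) : Prop :=
  ∀ i ≤ e, h i = (X.filter fun M => monDeg M = i).card

/-- `h` is (in degrees `≤ e`) a pure O-sequence of socle degree `e`. -/
def IsPureOSeq (h : ℕ → ℕ) (e : ℕ) : Prop :=
  ∃ (r : ℕ) (X : Finset (Fin r → ℕ)), IsPureWithSocle X e ∧ HasHVector X h e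

/-- `h` is a pure O-sequence of socle degree `e` and type `t`. -/
def IsPureOSeqOfType (h : ℕ → ℕ) (e t : ℕ) : Prop :=
  ∃ (r : ℕ) (X : Finset (Fin r → ℕ)), IsPureWithSocle X e ∧ HasHVector X h e ∧
    {M : Fin r → ℕ | IsMaxMon X M}.ncard = t

/-- `((n)_(d))_1^1`, computed from the `d`-binomial (Macaulay) expansion of `n`
obtained greedily; by convention `((0)_(d))_1^1 = 0`. -/
def macaulayBound : ℕ → ℕ → ℕ
  | 0, _ => 0
  | (n+1), d =>
      Nat.choose (Nat.findGreatest (fun k => Nat.choose k d ≤ n + 1) (n + 1 + d) + 1) (d + 1) +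
        macaulayBound
          ((n + 1) - Nat.choose (Nat.findGreatest (fun k => Nat.choose k d ≤ n + 1) (n + 1 + d)) d)
          (d - 1)
  termination_by n d => n
  decreasing_by
    have hd : d ≤ Nat.findGreatest (fun k => Nat.choose k d ≤ n + 1) (n + 1 + d) :=
      Nat.le_findGreatest (by omega) (by simp [Nat.choose_self])
    have hpos := Nat.choose_pos hd
    omega

/-- `g` satisfies Macaulay's bound (in degrees `1 ≤ i ≤ e - 1`). -/
def SatisfiesMacaulay (g : ℕ → ℕ) (e : ℕ) : Prop :=
  ∀ i, 1 ≤ i → i + 1 ≤ e → g (i + 1) ≤ macaulayBound (g i) i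

/-- `h` is an O-sequence of socle degree `e`. -/
def IsOSeq (h : ℕ → ℕ) (e : ℕ) : Prop :=
  h 0 = 1 ∧ (∀ i ≤ e, 0 < h i) ∧ SatisfiesMacaulay h e

/-- `h` is differentiable: its first difference `(1, h 1 - h 0, …, h e - h (e-1))`
consists of nonnegative integers and satisfies Macaulay's bound. -/
def IsDifferentiable (h : ℕ → ℕ) (e : ℕ) : Prop :=
  h 0 = 1 ∧ (∀ i, 1 ≤ i → i ≤ e → h (i - 1) ≤ h i) ∧
    SatisfiesMacaulay (fun i => if i = 0 then 1 else h i - h (i - 1)) e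


def slab (L : Finset (ℕ × ℕ)) (H : ℕ × ℕ → ℕ) (i : ℕ) : Finset (ℕ × ℕ) :=
  L.filter fun p => p.1 + p.2 ≤ i ∧ i ≤ p.1 + p.2 + H p

def mk3 {s : ℕ} (x y z : ℕ) (v : Fin s → ℕ) : Fin (s + 3) → ℕ :=
  Fin.cons x (Fin.cons y (Fin.cons z v))

lemma mk3_surj {s : ℕ} (M : Fin (s + 3) → ℕ) : ∃ x y z v, M = mk3 x y z v := by
  refine ⟨M 0, M 1, M 2, fun j => M j.succ.succ.succ, ?_⟩
  funext j
  refine Fin.cases rfl (fun j => ?_) j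
  refine Fin.cases rfl (fun j => ?_) j
  refine Fin.cases rfl (fun j => ?_) j
  rfl

lemma mk3_inj {s : ℕ} {x y z x' y' z' : ℕ} {v v' : Fin s → ℕ} :
    mk3 x y z v = mk3 x' y' z' v' ↔ x = x' ∧ y = y' ∧ z = z' ∧ v = v' := by
  simp [mk3, Fin.cons_inj]

lemma mk3_le {s : ℕ} {x y z x' y' z' : ℕ} {v v' : Fin s → ℕ} :
    (∀ j, mk3 x y z v j ≤ mk3 x' y' z' v' j) ↔ x ≤ x' ∧ y ≤ y' ∧ z ≤ z' ∧ ∀ j, v j ≤ v' j := by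
  simp [mk3, Fin.forall_fin_succ]

lemma monDeg_mk3 {s : ℕ} (x y z : ℕ) (v : Fin s → ℕ) :
    monDeg (mk3 x y z v) = x + y + z + ∑ j, v j := by
  simp [mk3, monDeg, Fin.sum_univ_succ]; ring

open Classical in
noncomputable def bigX (s : ℕ) (L : Finset (ℕ × ℕ)) (H : ℕ × ℕ → ℕ) (e : ℕ) :
    Finset (Fin (s + 3) → ℕ) :=
  (Finset.range (e + 1)).biUnion fun i =>
    ((slab L H i).image fun p => mk3 p.1 p.2 (i - (p.1 + p.2)) (0 : Fin s → ℕ)) ∪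
    (Finset.univ.image fun j : Fin s => mk3 0 0 0 (Pi.single j i))

lemma mem_bigX {s : ℕ} {L : Finset (ℕ × ℕ)} {H : ℕ × ℕ → ℕ} {e : ℕ}
    (hT : ∀ p ∈ L, p.1 + p.2 + H p ≤ e) (x y z : ℕ) (v : Fin s → ℕ) :
    mk3 x y z v ∈ bigX s L H e ↔
      ((x, y) ∈ L ∧ z ≤ H (x, y) ∧ v = 0) ∨
      (x = 0 ∧ y = 0 ∧ z = 0 ∧ ∃ j a, a ≤ e ∧ v = Pi.single j a) := by
  simp only [bigX, slab, Finset.mem_biUnion, Finset.mem_range, Finset.mem_union, Finset.mem_image,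
    Finset.mem_filter, Finset.mem_univ, true_and, mk3_inj]
  constructor
  · rintro ⟨i, hi, ⟨⟨a, b⟩, ⟨hp, h1, h2⟩, rfl, rfl, rfl, rfl⟩ | ⟨j, rfl, rfl, rfl, rfl⟩⟩
    · left; refine ⟨hp, ?_, rfl⟩
      simp only at *; omega
    · right; exact ⟨rfl, rfl, rfl, j, i, by omega, rfl⟩
  · rintro (⟨hp, hz, rfl⟩ | ⟨rfl, rfl, rfl, j, a, ha, rfl⟩)
    · have := hT _ hp
      simp only at this
      refine ⟨x + y + z, by omega, Or.inl ⟨(x, y), ⟨hp, ?_, ?_⟩, rfl, rfl, ?_, rfl⟩⟩ <;>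
        simp only <;> omega
    · exact ⟨a, by omega, Or.inr ⟨j, rfl, rfl, rfl, rfl⟩⟩

lemma liftA (s : ℕ) (L : Finset (ℕ × ℕ)) (H : ℕ × ℕ → ℕ) (e : ℕ)
    (h0 : (0, 0) ∈ L)
    (hdown : ∀ p ∈ L, ∀ q : ℕ × ℕ, q.1 ≤ p.1 → q.2 ≤ p.2 → q ∈ L)
    (hanti : ∀ p ∈ L, ∀ q : ℕ × ℕ, q.1 ≤ p.1 → q.2 ≤ p.2 → H p ≤ H q)
    (htop : ∀ p ∈ L, ∃ q ∈ L, p.1 ≤ q.1 ∧ p.2 ≤ q.2 ∧ H q = H p ∧ q.1 + q.2 + H q = e) :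
    ∃ h : ℕ → ℕ, IsPureOSeq h e ∧ h 0 = (slab L H 0).card ∧
      ∀ i, 1 ≤ i → i ≤ e → h i = (slab L H i).card + s := by
  classical
  have hT : ∀ p ∈ L, p.1 + p.2 + H p ≤ e := by
    intro p hp
    obtain ⟨q, hq, h1, h2, h3, h4⟩ := htop p hp
    omega
  have hfil : ∀ i, i ≤ e → (bigX s L H e).filter (fun M => monDeg M = i) =
      ((slab L H i).image fun p => mk3 p.1 p.2 (i - (p.1 + p.2)) (0 : Fin s → ℕ)) ∪
      (Finset.univ.image fun j : Fin s => mk3 0 0 0 (Pi.single j i)) := by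
    intro i hi
    ext M
    obtain ⟨x, y, z, v, rfl⟩ := mk3_surj M
    simp only [Finset.mem_filter, mem_bigX hT, Finset.mem_union, Finset.mem_image, slab,
      Finset.mem_univ, true_and, mk3_inj, monDeg_mk3]
    constructor
    · rintro ⟨⟨hp, hz, rfl⟩ | ⟨rfl, rfl, rfl, j, a, ha, rfl⟩, hd⟩
      · simp at hd
        exact Or.inl ⟨(x, y), ⟨hp, by simp only; omega, by simp only; omega⟩, rfl, rfl,
          by simp only; omega, rfl⟩
      · simp at hd
        subst hd
        exact Or.inr ⟨j, rfl, rfl, rfl, rfl⟩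
    · rintro (⟨⟨a, b⟩, ⟨hp, h1, h2⟩, rfl, rfl, rfl, rfl⟩ | ⟨j, rfl, rfl, rfl, rfl⟩)
      · simp only at *
        refine ⟨Or.inl ⟨hp, by omega, trivial⟩, ?_⟩
        simp; omega
      · refine ⟨Or.inr ⟨rfl, rfl, rfl, j, i, hi, rfl⟩, ?_⟩
        simp
  have hinj : ∀ i, ((slab L H i).image
      fun p => mk3 p.1 p.2 (i - (p.1 + p.2)) (0 : Fin s → ℕ)).card = (slab L H i).card := by
    intro i
    apply Finset.card_image_of_injective
    rintro ⟨a, b⟩ ⟨c, d⟩ h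
    simp only [mk3_inj] at h
    simp [h.1, h.2.1]
  have hX0 : mk3 0 0 0 (0 : Fin s → ℕ) ∈ bigX s L H e :=
    (mem_bigX hT _ _ _ _).2 (Or.inl ⟨h0, Nat.zero_le _, rfl⟩)
  refine ⟨fun i => ((bigX s L H e).filter fun M => monDeg M = i).card,
    ⟨s + 3, bigX s L H e, ⟨⟨⟨_, hX0⟩, ?_⟩, ?_, ?_, ?_⟩, ?_⟩, ?_, ?_⟩
  · intro M hM N hN
    obtain ⟨x, y, z, v, rfl⟩ := mk3_surj M
    obtain ⟨x', y', z', v', rfl⟩ := mk3_surj N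
    rw [mk3_le] at hN
    rw [mem_bigX hT] at hM ⊢
    obtain ⟨hx, hy, hz, hv⟩ := hN
    rcases hM with ⟨hp, hz', rfl⟩ | ⟨rfl, rfl, rfl, j, a, ha, rfl⟩
    · left
      refine ⟨hdown _ hp _ hx hy, ?_, ?_⟩
      · have := hanti _ hp (x', y') hx hy
        omega
      · funext j; have := hv j; simpa using this
    · right
      refine ⟨by omega, by omega, by omega, j, v' j, ?_, ?_⟩
      · have := hv j; simp at this; omega
      · funext k
        by_cases hk : k = j
        · subst hk; simp
        · have := hv k; simp [hk] at this; simp [hk, this]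
  · intro M hM
    obtain ⟨x, y, z, v, rfl⟩ := mk3_surj M
    rw [mem_bigX hT] at hM
    rw [monDeg_mk3]
    rcases hM with ⟨hp, hz', rfl⟩ | ⟨rfl, rfl, rfl, j, a, ha, rfl⟩
    · have := hT _ hp
      simp at this ⊢; omega
    · simpa using ha
  · obtain ⟨q, hq, -, -, -, h⟩ := htop _ h0
    refine ⟨mk3 q.1 q.2 (H q) 0, (mem_bigX hT _ _ _ _).2 (Or.inl ⟨hq, le_rfl, rfl⟩), ?_⟩
    rw [monDeg_mk3]; simpa using h
  · rintro M ⟨hM, hmax⟩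
    obtain ⟨x, y, z, v, rfl⟩ := mk3_surj M
    have hM' := hM
    rw [mem_bigX hT] at hM
    rcases hM with ⟨hp, hz', rfl⟩ | ⟨rfl, rfl, rfl, j, a, ha, rfl⟩
    · obtain ⟨q, hq, h1, h2, h3, h⟩ := htop _ hp
      have := hmax (mk3 q.1 q.2 (H q) 0) ((mem_bigX hT _ _ _ _).2 (Or.inl ⟨hq, le_rfl, rfl⟩))
        (mk3_le.2 ⟨h1, h2, by omega, fun _ => le_rfl⟩)
      rw [← this, monDeg_mk3]; simpa using h
    · have := hmax (mk3 0 0 0 (Pi.single j e))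
        ((mem_bigX hT _ _ _ _).2 (Or.inr ⟨rfl, rfl, rfl, j, e, le_rfl, rfl⟩))
        (mk3_le.2 ⟨le_rfl, le_rfl, le_rfl, fun k => by
          by_cases hk : k = j
          · subst hk; simpa using ha
          · simp [hk]⟩)
      rw [← this, monDeg_mk3]; simp
  · intro i _; rfl
  · simp only
    rw [hfil 0 (Nat.zero_le _), ← hinj 0]
    congr 1
    apply Finset.union_eq_left.2
    intro M hM
    simp only [Finset.mem_image, Finset.mem_univ, true_and] at hM
    obtain ⟨j, rfl⟩ := hM
    simp only [Finset.mem_image]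
    refine ⟨(0, 0), ?_, ?_⟩
    · simp [slab, h0]
    · simp
  · intro i h1 hi
    simp only
    rw [hfil i hi, Finset.card_union_of_disjoint, hinj]
    · congr 1
      rw [Finset.card_image_of_injective]
      · simp
      · intro j k hjk
        simp only [mk3_inj, true_and] at hjk
        by_contra hne
        have := congrFun hjk j
        simp [hne] at this
        omega
    · rw [Finset.disjoint_left]
      intro M hM hM2
      simp only [Finset.mem_image, Finset.mem_univ, true_and] at hM hM2
      obtain ⟨j, rfl⟩ := hM2
      obtain ⟨p, -, hp⟩ := hM
      rw [mk3_inj] at hp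
      have := congrFun hp.2.2.2 j
      simp at this
      omega

/-- trapezoid counts -/
def trap (w t d : ℕ) : ℕ := min (d + 1) w - (d + 1 - t)

def cnt (K d : ℕ) : ℕ := ∑ k ∈ Finset.range K, 2 * 7 ^ (K - 1 - k) * trap (6 * 7 ^ k) (7 ^ (k + 1)) d

lemma pow7_mono {j k : ℕ} (h : j ≤ k) : 7 ^ j ≤ 7 ^ k := Nat.pow_le_pow_right (by norm_num) h

lemma trap_up (j d : ℕ) (h : d + 2 ≤ 7 ^ (j + 1) ∨ 13 * 7 ^ j ≤ d + 1) :
    trap (6 * 7 ^ j) (7 ^ (j + 1)) d ≤ trap (6 * 7 ^ j) (7 ^ (j + 1)) (d + 1) := by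
  have : 7 ^ (j + 1) = 7 * 7 ^ j := by ring
  unfold trap; omega

lemma trap_zero (j d : ℕ) (h : 13 * 7 ^ j ≤ d + 1) :
    trap (6 * 7 ^ j) (7 ^ (j + 1)) d = 0 := by
  have : 7 ^ (j + 1) = 7 * 7 ^ j := by ring
  unfold trap; omega

lemma geo (K k : ℕ) (hk : k ≤ K) :
    3 * (∑ j ∈ Finset.Ico k K, 2 * 7 ^ (K - 1 - j)) + 1 = 7 ^ (K - k) := by
  obtain ⟨n, rfl⟩ := Nat.exists_eq_add_of_le hk
  induction n generalizing k with
  | zero => simp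
  | succ n ih =>
    rw [Finset.sum_eq_sum_Ico_succ_bot (by omega)]
    have := ih (k + 1) (by omega)
    rw [show k + 1 + n = k + (n + 1) by ring] at this
    rw [show k + (n + 1) - (k + 1) = n by omega] at this
    rw [show k + (n + 1) - k = n + 1 by omega, show k + (n + 1) - 1 - k = n by omega, pow_succ]
    omega

lemma cnt_up (K k d : ℕ) (h1 : 13 * 7 ^ k ≤ d + 1) (h2 : d + 2 ≤ 7 ^ (k + 2)) :
    cnt K d ≤ cnt K (d + 1) := by
  apply Finset.sum_le_sum
  intro j _
  apply Nat.mul_le_mul_left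
  apply trap_up
  rcases Nat.lt_or_ge k j with h | h
  · left; have := pow7_mono (show k + 2 ≤ j + 1 by omega); omega
  · right; have := pow7_mono h; omega

lemma cnt_up0 (K d : ℕ) (h2 : d + 2 ≤ 7) :
    cnt K d ≤ cnt K (d + 1) := by
  apply Finset.sum_le_sum
  intro j _
  apply Nat.mul_le_mul_left
  apply trap_up
  left; have := pow7_mono (show 1 ≤ j + 1 by omega); omega

lemma cnt_split (K k d : ℕ) (hk : k < K) (h : 7 ^ (k + 1) ≤ d + 1) :
    cnt K d = 2 * 7 ^ (K - 1 - k) * trap (6 * 7 ^ k) (7 ^ (k + 1)) d +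
      ∑ j ∈ Finset.Ico (k + 1) K, 2 * 7 ^ (K - 1 - j) * trap (6 * 7 ^ j) (7 ^ (j + 1)) d := by
  unfold cnt
  rw [← Finset.sum_range_add_sum_Ico _ (show k + 1 ≤ K by omega), Finset.sum_range_succ]
  rw [Finset.sum_eq_zero, zero_add]
  intro j hj
  rw [trap_zero, mul_zero]
  have := pow7_mono (show j + 2 ≤ k + 1 by simp at hj; omega)
  have h3 : 7 ^ (j + 2) = 49 * 7 ^ j := by ring
  omega

lemma cnt_down (K k d : ℕ) (hk : k < K) (h1 : 7 ^ (k + 1) ≤ d + 1) (h2 : d + 2 ≤ 13 * 7 ^ k) :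
    cnt K (d + 1) ≤ cnt K d := by
  rw [cnt_split K k d hk h1, cnt_split K k (d + 1) hk (by omega)]
  have e1 : trap (6 * 7 ^ k) (7 ^ (k + 1)) d = trap (6 * 7 ^ k) (7 ^ (k + 1)) (d + 1) + 1 := by
    have : 7 ^ (k + 1) = 7 * 7 ^ k := by ring
    unfold trap; omega
  have e2 : ∑ j ∈ Finset.Ico (k + 1) K, 2 * 7 ^ (K - 1 - j) * trap (6 * 7 ^ j) (7 ^ (j + 1)) (d + 1)
      ≤ ∑ j ∈ Finset.Ico (k + 1) K, 2 * 7 ^ (K - 1 - j) * trap (6 * 7 ^ j) (7 ^ (j + 1)) d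
        + ∑ j ∈ Finset.Ico (k + 1) K, 2 * 7 ^ (K - 1 - j) := by
    rw [← Finset.sum_add_distrib]
    apply Finset.sum_le_sum
    intro j _
    rw [← Nat.mul_add_one]
    apply Nat.mul_le_mul_left
    unfold trap; omega
  have e3 := geo K (k + 1) (by omega)
  rw [show K - (k + 1) = K - 1 - k by omega] at e3
  rw [e1, mul_add]
  omega

lemma cnt_peak (K k d : ℕ) (hk : k < K) (h : d + 1 = 7 ^ (k + 1)) : 7 ^ K + 2 < cnt K d := by
  rw [cnt_split K k d hk (by omega)]
  have e1 : trap (6 * 7 ^ k) (7 ^ (k + 1)) d = 6 * 7 ^ k := by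
    have : 7 ^ (k + 1) = 7 * 7 ^ k := by ring
    unfold trap; omega
  rw [e1]
  have e2 : 2 * 7 ^ (K - 1 - k) * (6 * 7 ^ k) = 12 * 7 ^ (K - 1) := by
    rw [show K - 1 = (K - 1 - k) + k by omega, pow_add]
    simp; ring
  have e3 : 7 ^ K = 7 * 7 ^ (K - 1) := by
    rw [← pow_succ']; congr 1; omega
  have : 0 < 7 ^ (K - 1) := by positivity
  omega

lemma cnt_valley (K k d : ℕ) (hk : k < K) (h : d + 1 = 13 * 7 ^ k) : cnt K d < 7 ^ K + 2 := by
  rw [cnt_split K k d hk (by have : 7 ^ (k + 1) = 7 * 7 ^ k := by ring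
                             omega), trap_zero _ _ (by omega), mul_zero, zero_add]
  have e2 : ∑ j ∈ Finset.Ico (k + 1) K, 2 * 7 ^ (K - 1 - j) * trap (6 * 7 ^ j) (7 ^ (j + 1)) d
      ≤ (∑ j ∈ Finset.Ico (k + 1) K, 2 * 7 ^ (K - 1 - j)) * (13 * 7 ^ k) := by
    rw [Finset.sum_mul]
    apply Finset.sum_le_sum
    intro j _
    apply Nat.mul_le_mul_left
    unfold trap; omega
  have e3 := geo K (k + 1) (by omega)
  have e4 : 7 ^ K = 7 * (7 ^ (K - (k + 1)) * 7 ^ k) := by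
    rw [← pow_add, ← pow_succ']; congr 1; omega
  generalize (∑ j ∈ Finset.Ico (k + 1) K, 2 * 7 ^ (K - 1 - j)) = S at *
  rw [← e3] at e4
  have : 0 < 7 ^ k := by positivity
  nlinarith

lemma cnt_one (K : ℕ) : cnt K 1 < 7 ^ K + 2 := by
  have e2 : cnt K 1 ≤ (∑ j ∈ Finset.Ico 0 K, 2 * 7 ^ (K - 1 - j)) * 2 := by
    rw [Finset.sum_mul, Nat.Ico_zero_eq_range]
    apply Finset.sum_le_sum
    intro j _
    apply Nat.mul_le_mul_left
    unfold trap; omega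
  have e3 := geo K 0 (by omega)
  simp only [Nat.sub_zero] at e3
  omega

lemma cnt_ne (K d : ℕ) : cnt K d ≠ 7 ^ K + 2 := by
  have h1 : 2 ∣ cnt K d := Finset.dvd_sum fun j _ => by rw [mul_assoc]; exact dvd_mul_right _ _
  have h2 : 7 ^ K % 2 = 1 := by rw [Nat.pow_mod]; simp
  omega

lemma cnt_zero (K d : ℕ) (h : 2 * 7 ^ K ≤ d + 1) : cnt K d = 0 := by
  apply Finset.sum_eq_zero
  intro j hj
  rw [trap_zero, mul_zero]
  have := pow7_mono (show j + 1 ≤ K by simp at hj; omega)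
  have h3 : 7 ^ (j + 1) = 7 * 7 ^ j := by ring
  omega

/-- down-crossings of `f` through `c` on `(a, b]`. -/
def crs (f : ℕ → ℕ) (c a b : ℕ) : Finset ℕ :=
  (Finset.Ioc a b).filter fun d => f d < c ∧ c < f (d - 1)

lemma crs_add (f : ℕ → ℕ) (c : ℕ) {a b b' : ℕ} (h : a ≤ b) (h' : b ≤ b') :
    (crs f c a b').card = (crs f c a b).card + (crs f c b b').card := by
  unfold crs
  rw [← Finset.card_union_of_disjoint, ← Finset.filter_union, Finset.Ioc_union_Ioc_eq_Ioc h h']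
  apply Finset.disjoint_filter_filter
  rw [Finset.disjoint_left]
  intro x; simp; omega

lemma crs_up (f : ℕ → ℕ) (c : ℕ) {a b : ℕ} (h : ∀ d, a ≤ d → d < b → f d ≤ f (d + 1)) :
    (crs f c a b).card = 0 := by
  rw [Finset.card_eq_zero]
  apply Finset.filter_eq_empty_iff.2
  intro d hd
  rw [Finset.mem_Ioc] at hd
  have := h (d - 1) (by omega) (by omega)
  rw [show d - 1 + 1 = d by omega] at this
  omega

lemma crs_down (f : ℕ → ℕ) (c : ℕ) {a b : ℕ} (hab : a ≤ b) (hne : ∀ d, f d ≠ c)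
    (h : ∀ d, a ≤ d → d < b → f (d + 1) ≤ f d)
    (ha : c < f a) (hb : f b < c) : (crs f c a b).card = 1 := by
  obtain ⟨n, rfl⟩ := Nat.exists_eq_add_of_le hab
  induction n with
  | zero => simp at hb; omega
  | succ n ih =>
    rw [crs_add f c (show a ≤ a + n by omega) (show a + n ≤ a + (n + 1) by omega)]
    have hs : (crs f c (a + n) (a + (n + 1))) =
        if f (a + (n + 1)) < c ∧ c < f (a + n) then {a + (n + 1)} else ∅ := by
      unfold crs
      have : Finset.Ioc (a + n) (a + (n + 1)) = {a + (n + 1)} := by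
        ext x; simp; omega
      rw [this, Finset.filter_singleton]
      rfl
    rw [hs]
    rcases Nat.lt_or_ge (f (a + n)) c with h1 | h1
    · rw [ih (by omega) (fun d hd hd' => h d hd (by omega)) h1]
      rw [if_neg (by omega)]; simp
    · have h1 : c < f (a + n) := lt_of_le_of_ne h1 (hne _).symm
      rw [if_pos ⟨hb, h1⟩]
      have : (crs f c a (a + n)).card = 0 := by
        rw [Finset.card_eq_zero]
        apply Finset.filter_eq_empty_iff.2
        intro d hd
        rw [Finset.mem_Ioc] at hd
        have : ∀ m, d + m ≤ a + n → f (d + m) ≤ f d := by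
          intro m
          induction m with
          | zero => simp
          | succ m ihm =>
            intro hm
            exact (h (d + m) (by omega) (by omega)).trans (ihm (by omega))
        have := this (a + n - d) (by omega)
        rw [show d + (a + n - d) = a + n by omega] at this
        omega
      rw [this]; simp

lemma crs_cnt (K b : ℕ) (hb : 2 * 7 ^ K ≤ b) : (crs (cnt K) (7 ^ K + 2) 0 b).card = K := by
  have main : ∀ k, k < K → (crs (cnt K) (7 ^ K + 2) 0 (13 * 7 ^ k - 1)).card = k + 1 := by
    intro k
    induction k with
    | zero =>
      intro hK
      rw [crs_add _ _ (show 0 ≤ 6 by omega) (by omega), crs_up _ _ (fun d _ hd => cnt_up0 K d (by omega)),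
        crs_down _ _ (by omega) (cnt_ne K)]
      · intro d h1 h2; exact cnt_down K 0 d hK (by simp; omega) (by omega)
      · exact cnt_peak K 0 _ hK (by simp)
      · exact cnt_valley K 0 _ hK (by simp)
    | succ k ih =>
      intro hK
      have e1 : 7 ^ (k + 1) = 7 * 7 ^ k := by ring
      have e2 : 7 ^ (k + 1 + 1) = 49 * 7 ^ k := by ring
      have e3 : 7 ^ (k + 2) = 49 * 7 ^ k := by ring
      have e0 : 0 < 7 ^ k := by positivity
      rw [crs_add _ _ (show 0 ≤ 13 * 7 ^ k - 1 by omega) (by omega), ih (by omega),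
        crs_add _ _ (show 13 * 7 ^ k - 1 ≤ 7 ^ (k + 2) - 1 by omega) (by omega),
        crs_up _ _ (fun d h1 h2 => cnt_up K k d (by omega) (by omega)),
        crs_down _ _ (by omega) (cnt_ne K)]
      · intro d h1 h2; exact cnt_down K (k + 1) d hK (by omega) (by omega)
      · exact cnt_peak K (k + 1) _ hK (by omega)
      · exact cnt_valley K (k + 1) _ hK (by omega)
  rcases K with _ | K
  · exact crs_up _ _ (fun d _ _ => by simp [cnt])
  · have e1 : 7 ^ (K + 1) = 7 * 7 ^ K := by ring
    have e0 : 0 < 7 ^ K := by positivity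
    rw [crs_add _ _ (show 0 ≤ 13 * 7 ^ K - 1 by omega) (by omega), main K (by omega),
      crs_up]
    intro d h1 h2
    apply Finset.sum_le_sum
    intro j hj
    apply Nat.mul_le_mul_left
    apply trap_up
    right
    have := pow7_mono (show j ≤ K by simp at hj; omega)
    omega

def lg (x : ℕ) : ℕ := Nat.log 7 (x + 1)

def xe (x : ℕ) : ℕ := 7 ^ (lg x + 1) - 2

def ye (x y : ℕ) : ℕ := 7 ^ (lg x + 1) * (y / 7 ^ (lg x + 1) + 1) - 1

lemma lg_eq {x k : ℕ} (h1 : 7 ^ k ≤ x + 1) (h2 : x + 1 < 7 ^ (k + 1)) : lg x = k :=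
  Nat.log_eq_of_pow_le_of_lt_pow h1 h2

lemma lg_spec (x : ℕ) : 7 ^ lg x ≤ x + 1 ∧ x + 1 < 7 ^ (lg x + 1) :=
  ⟨Nat.pow_log_le_self 7 (by omega), Nat.lt_pow_succ_log_self (by norm_num) _⟩

lemma lg_mono {x x' : ℕ} (h : x ≤ x') : lg x ≤ lg x' := Nat.log_mono_right (by omega)

lemma lg_lt {x K : ℕ} (h : x + 1 < 7 ^ K) : lg x < K := Nat.log_lt_of_lt_pow (by omega) h

lemma le_xe (x : ℕ) : x ≤ xe x := by have := lg_spec x; unfold xe; omega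

lemma lg_xe (x : ℕ) : lg (xe x) = lg x := by
  have := lg_spec x
  have h7 : 7 ^ (lg x + 1) = 7 * 7 ^ lg x := by ring
  have h0 : 0 < 7 ^ lg x := by positivity
  apply lg_eq <;> unfold xe <;> omega

lemma xe_mono {x x' : ℕ} (h : x ≤ x') : xe x ≤ xe x' := by
  have := pow7_mono (show lg x + 1 ≤ lg x' + 1 by have := lg_mono h; omega)
  unfold xe; omega

lemma xe_xe (x : ℕ) : xe (xe x) = xe x := by
  conv_lhs => rw [xe, lg_xe]
  rfl

lemma xe_lt {x K : ℕ} (h : x + 1 < 7 ^ K) : xe x + 1 < 7 ^ K := by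
  have := pow7_mono (show lg x + 1 ≤ K from lg_lt h)
  have h7 : 7 ^ (lg x + 1) = 7 * 7 ^ lg x := by ring
  have h0 : 0 < 7 ^ lg x := by positivity
  unfold xe; omega

lemma cell_lt (t y : ℕ) (ht : 0 < t) : y < t * (y / t + 1) := by
  have := Nat.lt_div_mul_add ht (a := y)
  nlinarith

lemma cell_le (t y z : ℕ) (hz : t ∣ z) (h : y < z) : t * (y / t + 1) ≤ z := by
  obtain ⟨m, rfl⟩ := hz
  apply Nat.mul_le_mul_left
  exact Nat.div_lt_of_lt_mul h

lemma cell_eq (t y : ℕ) (ht : 0 < t) : t * (y / t + 1) - 1 - y = t - 1 - y % t := by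
  have h1 := Nat.div_add_mod y t
  have h2 := Nat.mod_lt y ht
  rw [mul_add]
  omega

lemma le_ye (x y : ℕ) : y ≤ ye x y := by
  have := cell_lt (7 ^ (lg x + 1)) y (by positivity)
  unfold ye; omega

lemma ye_mono {x x' y y' : ℕ} (h : x ≤ x') (h' : y ≤ y') : ye x y ≤ ye x' y' := by
  unfold ye
  have h1 := cell_le (7 ^ (lg x + 1)) y (7 ^ (lg x' + 1) * (y' / 7 ^ (lg x' + 1) + 1))
    (Dvd.dvd.mul_right (pow_dvd_pow 7 (by have := lg_mono h; omega)) _)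
    (lt_of_le_of_lt h' (cell_lt _ _ (by positivity)))
  omega

lemma ye_ye (x y : ℕ) : ye (xe x) (ye x y) = ye x y := by
  apply le_antisymm
  · unfold ye
    rw [lg_xe]
    have h1 := cell_lt (7 ^ (lg x + 1)) y (by positivity)
    have h2 := cell_le (7 ^ (lg x + 1)) (7 ^ (lg x + 1) * (y / 7 ^ (lg x + 1) + 1) - 1)
      (7 ^ (lg x + 1) * (y / 7 ^ (lg x + 1) + 1)) (dvd_mul_right _ _) (by omega)
    omega
  · exact le_ye _ _

lemma ye_lt {x y K : ℕ} (h : x + 1 < 7 ^ K) (hy : y < 2 * 7 ^ K) : ye x y < 2 * 7 ^ K := by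
  have h2 := cell_le (7 ^ (lg x + 1)) y (2 * 7 ^ K)
      (Dvd.dvd.mul_left (pow_dvd_pow 7 (lg_lt h)) _) hy
  have : 0 < 7 ^ K := by positivity
  unfold ye; omega

/-- the distance function -/
def dst (x y : ℕ) : ℕ := (xe x - x) + (ye x y - y)

lemma card_mod (t m v : ℕ) (hv : v < t) :
    ((Finset.range (t * m)).filter fun y => y % t = v).card = m := by
  induction m with
  | zero => simp
  | succ m ih =>
    have : (Finset.range (t * (m + 1))).filter (fun y => y % t = v) =
        insert (t * m + v) ((Finset.range (t * m)).filter fun y => y % t = v) := by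
      ext y
      simp only [Finset.mem_filter, Finset.mem_range, Finset.mem_insert]
      constructor
      · rintro ⟨h1, h2⟩
        by_cases h : y < t * m
        · exact Or.inr ⟨h, h2⟩
        · left
          obtain ⟨n, rfl⟩ := Nat.exists_eq_add_of_le (not_lt.1 h)
          rw [mul_add] at h1
          rw [Nat.mul_add_mod, Nat.mod_eq_of_lt (by omega)] at h2
          omega
      · rintro (rfl | ⟨h1, h2⟩)
        · rw [mul_add]
          exact ⟨by omega, by rw [Nat.mul_add_mod, Nat.mod_eq_of_lt hv]⟩
        · rw [mul_add]
          exact ⟨by omega, h2⟩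
    rw [this, Finset.card_insert_of_notMem, ih]
    simp

lemma sum_cells (f : ℕ → ℕ) (K : ℕ) :
    ∑ x ∈ Finset.range (7 ^ K - 1), f x =
      ∑ k ∈ Finset.range K, ∑ a ∈ Finset.range (6 * 7 ^ k), f (7 ^ (k + 1) - 2 - a) := by
  induction K with
  | zero => simp
  | succ K ih =>
    have h7 : 7 ^ (K + 1) = 7 * 7 ^ K := by ring
    have h0 : 0 < 7 ^ K := by positivity
    rw [Finset.sum_range_succ, ← ih,
      ← Finset.sum_range_add_sum_Ico _ (show 7 ^ K - 1 ≤ 7 ^ (K + 1) - 1 by omega)]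
    congr 1
    rw [Finset.sum_Ico_eq_sum_range, show 7 ^ (K + 1) - 1 - (7 ^ K - 1) = 6 * 7 ^ K by omega,
      ← Finset.sum_range_reflect]
    apply Finset.sum_congr rfl
    intro a ha
    rw [Finset.mem_range] at ha
    congr 1
    omega

lemma card_col (K k a d : ℕ) (hk : k < K) (ha : a < 6 * 7 ^ k) :
    ((Finset.range (2 * 7 ^ K)).filter fun y => dst (7 ^ (k + 1) - 2 - a) y = d).card =
      if a ≤ d ∧ d < a + 7 ^ (k + 1) then 2 * 7 ^ (K - 1 - k) else 0 := by
  have h7 : 7 ^ (k + 1) = 7 * 7 ^ k := by ring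
  have h0 : 0 < 7 ^ k := by positivity
  have hl : lg (7 ^ (k + 1) - 2 - a) = k := lg_eq (by omega) (by omega)
  have hd : ∀ y, dst (7 ^ (k + 1) - 2 - a) y = a + (7 ^ (k + 1) - 1 - y % 7 ^ (k + 1)) := by
    intro y
    unfold dst xe ye
    rw [hl, cell_eq _ _ (by positivity)]
    omega
  have hm : ∀ y, y % 7 ^ (k + 1) < 7 ^ (k + 1) := fun y => Nat.mod_lt y (by positivity)
  split_ifs with h
  · have hY : 2 * 7 ^ K = 7 ^ (k + 1) * (2 * 7 ^ (K - 1 - k)) := by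
      rw [mul_left_comm, ← pow_add]; congr 2; omega
    rw [hY]
    refine Eq.trans ?_ (card_mod (7 ^ (k + 1)) (2 * 7 ^ (K - 1 - k)) (a + 7 ^ (k + 1) - 1 - d)
      (by omega))
    congr 1
    apply Finset.filter_congr
    intro y _
    rw [hd]
    have := hm y
    omega
  · rw [Finset.card_eq_zero, Finset.filter_eq_empty_iff]
    intro y _
    rw [hd]
    have := hm y
    omega

lemma card_box (K d : ℕ) :
    ((Finset.range (7 ^ K - 1) ×ˢ Finset.range (2 * 7 ^ K)).filter
      fun p => dst p.1 p.2 = d).card = cnt K d := by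
  rw [Finset.card_filter, Finset.sum_product]
  simp only [← Finset.card_filter]
  rw [sum_cells]
  apply Finset.sum_congr rfl
  intro k hk
  rw [Finset.mem_range] at hk
  rw [Finset.sum_congr rfl (fun a ha => card_col K k a d hk (Finset.mem_range.1 ha)),
    ← Finset.sum_filter, Finset.sum_const, smul_eq_mul, mul_comm]
  congr 1
  have : (Finset.range (6 * 7 ^ k)).filter (fun a => a ≤ d ∧ d < a + 7 ^ (k + 1)) =
      Finset.Ico (d + 1 - 7 ^ (k + 1)) (min (d + 1) (6 * 7 ^ k)) := by
    ext a; simp only [Finset.mem_filter, Finset.mem_range, Finset.mem_Ico]; omega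
  rw [this, Nat.card_Ico, trap]

lemma slab_step (L : Finset (ℕ × ℕ)) (H : ℕ × ℕ → ℕ) (i : ℕ) (hi : 1 ≤ i) :
    (slab L H i).card + (L.filter fun p => p.1 + p.2 + H p = i - 1).card =
      (slab L H (i - 1)).card + (L.filter fun p => p.1 + p.2 = i).card := by
  unfold slab
  rw [← Finset.card_union_of_disjoint, ← Finset.card_union_of_disjoint]
  · congr 1
    ext p
    simp only [Finset.mem_union, Finset.mem_filter, ← and_or_left]
    apply and_congr_right
    intro _; omega
  · rw [Finset.disjoint_left]; intro p; simp only [Finset.mem_filter]; omega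
  · rw [Finset.disjoint_left]; intro p; simp only [Finset.mem_filter]; omega

def ee (K : ℕ) : ℕ := 10 * 7 ^ K + 10

def cc (K : ℕ) : ℕ := 7 ^ K + 2

def LL (K : ℕ) : Finset (ℕ × ℕ) :=
  (Finset.range (ee K + 1) ×ˢ Finset.range (ee K + 1)).filter fun p =>
    (p.2 < cc K ∧ p.1 + p.2 ≤ ee K) ∨ (cc K ≤ p.2 ∧ p.2 < cc K + 2 * 7 ^ K ∧ p.1 + 1 < 7 ^ K)

def HH (K : ℕ) (p : ℕ × ℕ) : ℕ :=
  if p.2 < cc K then ee K - (p.1 + p.2) else ee K - (xe p.1 + cc K + ye p.1 (p.2 - cc K))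

lemma mem_LL (K x y : ℕ) : (x, y) ∈ LL K ↔
    (y < cc K ∧ x + y ≤ ee K) ∨ (cc K ≤ y ∧ y < cc K + 2 * 7 ^ K ∧ x + 1 < 7 ^ K) := by
  have hE : ee K = 10 * 7 ^ K + 10 := rfl
  have hC : cc K = 7 ^ K + 2 := rfl
  unfold LL
  rw [Finset.mem_filter, Finset.mem_product, Finset.mem_range, Finset.mem_range]
  simp only
  omega

lemma HH_lo {K x y : ℕ} (h : y < cc K) : HH K (x, y) = ee K - (x + y) := by simp [HH, h]

lemma HH_hi {K x y : ℕ} (h : cc K ≤ y) :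
    HH K (x, y) = ee K - (xe x + cc K + ye x (y - cc K)) := by simp [HH, not_lt.2 h]

lemma top_hi {K x y : ℕ} (h : cc K ≤ y) (hy : y < cc K + 2 * 7 ^ K) (hx : x + 1 < 7 ^ K) :
    x + y + HH K (x, y) + dst x (y - cc K) = ee K := by
  rw [HH_hi h]
  have h1 := xe_lt hx
  have h2 := ye_lt hx (show y - cc K < 2 * 7 ^ K by omega)
  have h3 := le_xe x
  have h4 := le_ye x (y - cc K)
  unfold dst
  have : ee K = 10 * 7 ^ K + 10 := rfl
  have : cc K = 7 ^ K + 2 := rfl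
  omega

lemma LL_lift (s K : ℕ) :
    ∃ h : ℕ → ℕ, IsPureOSeq h (ee K) ∧ h 0 = (slab (LL K) (HH K) 0).card ∧
      ∀ i, 1 ≤ i → i ≤ ee K → h i = (slab (LL K) (HH K) i).card + s := by
  have hE : ee K = 10 * 7 ^ K + 10 := rfl
  have hC : cc K = 7 ^ K + 2 := rfl
  apply liftA
  · rw [mem_LL]; omega
  · rintro ⟨x, y⟩ hp ⟨x', y'⟩ hx hy
    rw [mem_LL] at hp ⊢
    simp only at hx hy
    omega
  · rintro ⟨x, y⟩ hp ⟨x', y'⟩ hx hy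
    rw [mem_LL] at hp
    simp only at hx hy
    rcases Nat.lt_or_ge y (cc K) with h | h
    · rw [HH_lo h, HH_lo (by omega)]; omega
    · have h1 := xe_mono hx
      have h2 := le_xe x
      rw [HH_hi h]
      rcases Nat.lt_or_ge y' (cc K) with h' | h'
      · rw [HH_lo h']; omega
      · have h3 := ye_mono hx (show y' - cc K ≤ y - cc K by omega)
        rw [HH_hi h']; omega
  · rintro ⟨x, y⟩ hp
    have hp' := hp
    rw [mem_LL] at hp
    rcases Nat.lt_or_ge y (cc K) with h | h
    · skip
      refine ⟨(x, y), hp', le_rfl, le_rfl, rfl, ?_⟩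
      rw [HH_lo h]; simp only; omega
    · have hx : x + 1 < 7 ^ K := by omega
      have h1 := xe_lt hx
      have h2 := ye_lt hx (show y - cc K < 2 * 7 ^ K by omega)
      have h3 := le_xe x
      have h4 := le_ye x (y - cc K)
      have hH : HH K (xe x, cc K + ye x (y - cc K)) = HH K (x, y) := by
        rw [HH_hi h, HH_hi (by omega), Nat.add_sub_cancel_left, ye_ye, xe_xe]
      refine ⟨(xe x, cc K + ye x (y - cc K)), ?_, h3, by simp only; omega, hH, ?_⟩
      · rw [mem_LL]; omega
      · rw [hH, HH_hi h]; simp only; omega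

lemma ends (K i : ℕ) (h1 : 1 ≤ i) (h2 : i ≤ ee K) :
    ((LL K).filter fun p => p.1 + p.2 + HH K p = i - 1).card = cnt K (ee K + 1 - i) := by
  rw [← card_box]
  symm
  apply Finset.card_bij (fun p _ => (p.1, p.2 + cc K))
  · rintro ⟨x, y⟩ h
    simp only [Finset.mem_filter, Finset.mem_product, Finset.mem_range, mem_LL] at h ⊢
    have := top_hi (K := K) (x := x) (y := y + cc K) (by omega) (by omega) (by omega)
    rw [Nat.add_sub_cancel] at this
    omega
  · rintro ⟨x, y⟩ _ ⟨x', y'⟩ _ h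
    simp only [Prod.mk.injEq] at h ⊢
    omega
  · rintro ⟨x, y⟩ h
    simp only [Finset.mem_filter, mem_LL] at h
    rcases Nat.lt_or_ge y (cc K) with h' | h'
    · rw [HH_lo h'] at h; omega
    · have := top_hi (K := K) (x := x) (y := y) (by omega) (by omega) (by omega)
      refine ⟨(x, y - cc K), ?_, ?_⟩
      · simp only [Finset.mem_filter, Finset.mem_product, Finset.mem_range]; omega
      · simp only [Prod.mk.injEq, true_and]; omega

lemma starts_pos (K i : ℕ) (h2 : i ≤ ee K) :
    0 < ((LL K).filter fun p => p.1 + p.2 = i).card := by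
  apply Finset.card_pos.2
  refine ⟨(i, 0), ?_⟩
  have hC : cc K = 7 ^ K + 2 := rfl
  rw [Finset.mem_filter, mem_LL]
  have h7 : 0 < 7 ^ K := by positivity
  simp only
  omega

lemma starts (K i : ℕ) (h1 : 4 * 7 ^ K + 2 ≤ i) (h2 : i ≤ ee K) :
    ((LL K).filter fun p => p.1 + p.2 = i).card = cc K := by
  have hC : cc K = 7 ^ K + 2 := rfl
  have : (LL K).filter (fun p => p.1 + p.2 = i) =
      (Finset.range (cc K)).image fun y => (i - y, y) := by
    ext ⟨x, y⟩
    simp only [Finset.mem_filter, mem_LL, Finset.mem_image, Finset.mem_range, Prod.mk.injEq]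
    constructor
    · intro h; exact ⟨y, by omega, by omega, rfl⟩
    · rintro ⟨a, h, h', rfl⟩; omega
  rw [this, Finset.card_image_of_injective, Finset.card_range]
  intro a b h
  simp only [Prod.mk.injEq] at h
  exact h.2

lemma sign (K i : ℕ) (h1 : 1 ≤ i) (h2 : i ≤ ee K) :
    ((slab (LL K) (HH K) (i - 1)).card < (slab (LL K) (HH K) i).card ↔
      cnt K (ee K + 1 - i) < 7 ^ K + 2) ∧
    ((slab (LL K) (HH K) i).card < (slab (LL K) (HH K) (i - 1)).card ↔
      7 ^ K + 2 < cnt K (ee K + 1 - i)) := by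
  have hE : ee K = 10 * 7 ^ K + 10 := rfl
  have hC : cc K = 7 ^ K + 2 := rfl
  have hs := slab_step (LL K) (HH K) i h1
  rw [ends K i h1 h2] at hs
  rcases Nat.lt_or_ge i (4 * 7 ^ K + 2) with h | h
  · have := starts_pos K i h2
    rw [cnt_zero K _ (by omega)] at hs ⊢
    omega
  · rw [starts K i h h2] at hs
    omega

lemma slab_zero (K : ℕ) : (slab (LL K) (HH K) 0).card = 1 := by
  rw [Finset.card_eq_one]
  refine ⟨(0, 0), ?_⟩
  have hC : cc K = 7 ^ K + 2 := rfl
  ext ⟨x, y⟩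
  simp only [slab, Finset.mem_filter, mem_LL, Finset.mem_singleton, Prod.mk.injEq]
  have h7 : 0 < 7 ^ K := by positivity
  omega

lemma slab_one (K : ℕ) : (slab (LL K) (HH K) 1).card = 3 := by
  have hs := slab_step (LL K) (HH K) 1 le_rfl
  have hE : ee K = 10 * 7 ^ K + 10 := rfl
  have hC : cc K = 7 ^ K + 2 := rfl
  have : 0 < 7 ^ K := by positivity
  rw [ends K 1 le_rfl (by omega), cnt_zero K _ (by omega), Nat.sub_self, slab_zero] at hs
  have : (LL K).filter (fun p => p.1 + p.2 = 1) = {(0, 1), (1, 0)} := by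
    ext ⟨x, y⟩
    simp only [Finset.mem_filter, mem_LL, Finset.mem_insert, Finset.mem_singleton, Prod.mk.injEq]
    omega
  rw [this, Finset.card_pair (by simp)] at hs
  omega

/-- For every positive integer `M` and every `r ≥ 3`, there is a pure
O-sequence of codimension `r` having exactly `M` maxima, a maximum being an index
`1 ≤ i ≤ e` with `h (i−1) < h i` and either `i = e` or `h i > h (i+1)`. -/
theorem exists_pure_with_exactly_M_maxima (M r : ℕ) (hM : 1 ≤ M) (hr : 3 ≤ r) :
    ∃ (e : ℕ) (h : ℕ → ℕ), IsPureOSeq h e ∧ h 1 = r ∧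
      ((Finset.Icc 1 e).filter fun i =>
          h (i - 1) < h i ∧ (i = e ∨ h (i + 1) < h i)).card = M := by
  obtain ⟨K, rfl⟩ : ∃ K, M = K + 1 := ⟨M - 1, by omega⟩
  obtain ⟨s, rfl⟩ : ∃ s, r = s + 3 := ⟨r - 3, by omega⟩
  obtain ⟨h, hpure, hh0, hh⟩ := LL_lift s K
  have hE : ee K = 10 * 7 ^ K + 10 := rfl
  have h7 : 0 < 7 ^ K := by positivity
  have hh1 : h 1 = s + 3 := by rw [hh 1 le_rfl (by omega), slab_one]; omega
  refine ⟨ee K, h, hpure, hh1, ?_⟩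
  have hup : ∀ i, 1 ≤ i → i ≤ ee K → (h (i - 1) < h i ↔ cnt K (ee K + 1 - i) < 7 ^ K + 2) := by
    intro i h1 h2
    rw [← (sign K i h1 h2).1, hh i h1 h2]
    rcases Nat.lt_or_ge 1 i with h3 | h3
    · rw [hh (i - 1) (by omega) (by omega)]; omega
    · obtain rfl : i = 1 := by omega
      rw [Nat.sub_self, hh0, slab_zero, slab_one]; omega
  have hdn : ∀ i, 1 ≤ i → i + 1 ≤ ee K → (h (i + 1) < h i ↔ 7 ^ K + 2 < cnt K (ee K - i)) := by
    intro i h1 h2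
    have := (sign K (i + 1) (by omega) h2).2
    rw [Nat.add_sub_cancel, show ee K + 1 - (i + 1) = ee K - i by omega] at this
    rw [← this, hh i h1 (by omega), hh (i + 1) (by omega) h2]
    omega
  have hc0 : 1 ∉ crs (cnt K) (7 ^ K + 2) 0 (ee K) := by
    unfold crs
    rw [Finset.mem_filter]
    rintro ⟨-, -, h⟩
    have h1 := cnt_up0 K 0 (by omega)
    have h2 := cnt_one K
    simp only [Nat.sub_self, zero_add] at h h1
    omega
  refine Eq.trans ?_ (show (insert 1 (crs (cnt K) (7 ^ K + 2) 0 (ee K))).card = K + 1 by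
    rw [Finset.card_insert_of_notMem hc0, crs_cnt K (ee K) (by omega)])
  apply Finset.card_bij (fun i _ => ee K + 1 - i)
  · intro i hi
    simp only [crs, Finset.mem_filter, Finset.mem_Icc, Finset.mem_insert, Finset.mem_Ioc] at hi ⊢
    obtain ⟨⟨h1, h2⟩, h3, h4⟩ := hi
    rcases h4 with rfl | h4
    · left; omega
    · rcases Nat.lt_or_ge i (ee K) with h5 | h5
      · right
        rw [hup i h1 h2] at h3
        rw [hdn i h1 h5] at h4
        rw [show ee K + 1 - i - 1 = ee K - i by omega]
        exact ⟨by omega, h3, h4⟩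
      · left; omega
  · intro i hi j hj hij
    simp only [Finset.mem_filter, Finset.mem_Icc] at hi hj hij
    omega
  · intro d hd
    simp only [crs, Finset.mem_filter, Finset.mem_Icc, Finset.mem_insert, Finset.mem_Ioc] at hd ⊢
    rcases hd with rfl | ⟨h1, h2, h3⟩
    · refine ⟨ee K, ⟨by omega, ?_, Or.inl rfl⟩, by omega⟩
      rw [hup _ (by omega) le_rfl, Nat.add_sub_cancel_left]
      exact cnt_one K
    · have hd1 : d ≠ 1 := by
        rintro rfl
        exact hc0 (by simp only [crs, Finset.mem_filter, Finset.mem_Ioc]; exact ⟨h1, h2, h3⟩)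
      refine ⟨ee K + 1 - d, ⟨by omega, ?_, Or.inr ?_⟩, by omega⟩
      · rw [hup _ (by omega) (by omega), show ee K + 1 - (ee K + 1 - d) = d by omega]
        exact h2
      · rw [hdn _ (by omega) (by omega), show ee K - (ee K + 1 - d) = d - 1 by omega]
        exact h3
end

section
/- The set S of pure O-sequences of socle degree 3 (sequences (1, h_1, h_2, h_3) of positive integers that are pure O-sequences) satisfies the interval property in each coordinate: (i) if (1, h_1', h_2, h_3) ∈ S and (1, h_1'', h_2, h_3) ∈ S with h_1' ≤ h_1 ≤ h_1'', then (1, h_1, h_2, h_3) ∈ S; (ii) if (1, h_1, h_2', h_3) ∈ S and (1, h_1, h_2'', h_3) ∈ S with h_2' ≤ h_2 ≤ h_2'', then (1, h_1, h_2, h_3) ∈ S; (iii) if (1, h_1, h_2, h_3') ∈ S and (1, h_1, h_2, h_3'') ∈ S with h_3' ≤ h_3 ≤ h_3'', then (1, h_1, h_2, h_3) ∈ S. -/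
/-- The sequence `(1, a, b, c)` (padded by zeros). -/
def seq4 (a b c : ℕ) : ℕ → ℕ := fun i => [1, a, b, c].getD i 0

/-! ### Families of monomials of degree three as finite sets of multisets -/

/-- shadow -/
def shd (T : Finset (Multiset ℕ)) : Finset (Multiset ℕ) :=
  T.biUnion fun m => m.toFinset.image fun a => m.erase a

/-- variables -/
def vr (T : Finset (Multiset ℕ)) : Finset ℕ := T.biUnion fun m => m.toFinset

/-- all members have degree three -/
def Tri (T : Finset (Multiset ℕ)) : Prop := ∀ m ∈ T, m.card = 3

lemma mem_shd {T : Finset (Multiset ℕ)} {p : Multiset ℕ} : p ∈ shd T ↔ ∃ a, a ::ₘ p ∈ T := by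
  simp only [shd, Finset.mem_biUnion, Finset.mem_image, Multiset.mem_toFinset]
  constructor
  · rintro ⟨m, hm, a, ha, rfl⟩
    exact ⟨a, by rwa [Multiset.cons_erase ha]⟩
  · rintro ⟨a, ha⟩
    exact ⟨_, ha, a, by simp, by simp⟩

lemma mem_vr {T : Finset (Multiset ℕ)} {a : ℕ} : a ∈ vr T ↔ ∃ m ∈ T, a ∈ m := by
  simp [vr]

lemma pair_eq {a b c d : ℕ} :
    ({a, b} : Multiset ℕ) = {c, d} ↔ (a = c ∧ b = d) ∨ (a = d ∧ b = c) := by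
  constructor
  · intro h
    have h1 : a ∈ ({c, d} : Multiset ℕ) := by rw [← h]; simp
    simp only [Multiset.insert_eq_cons, Multiset.mem_cons, Multiset.mem_singleton] at h1
    rcases h1 with rfl | rfl
    · left; simpa using h
    · right
      rw [Multiset.pair_comm c a] at h
      simpa using h
  · rintro (⟨rfl, rfl⟩ | ⟨rfl, rfl⟩)
    · rfl
    · exact Multiset.pair_comm _ _

lemma shd_mono {S T : Finset (Multiset ℕ)} (h : S ⊆ T) : shd S ⊆ shd T := by
  intro p hp
  rw [mem_shd] at *
  exact hp.imp fun a ha => h ha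

lemma vr_mono {S T : Finset (Multiset ℕ)} (h : S ⊆ T) : vr S ⊆ vr T := by
  intro p hp
  rw [mem_vr] at *
  obtain ⟨m, hm, h'⟩ := hp
  exact ⟨m, h hm, h'⟩

lemma shd_card {T : Finset (Multiset ℕ)} (hT : Tri T) {p : Multiset ℕ} (hp : p ∈ shd T) :
    p.card = 2 := by
  rw [mem_shd] at hp
  obtain ⟨a, ha⟩ := hp
  have := hT _ ha
  simpa using this

lemma shd_sub {T : Finset (Multiset ℕ)} {p : Multiset ℕ} (hp : p ∈ shd T) {a : ℕ} (ha : a ∈ p) :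
    a ∈ vr T := by
  rw [mem_shd] at hp
  obtain ⟨b, hb⟩ := hp
  exact mem_vr.2 ⟨_, hb, by simp [ha]⟩

lemma vr_iff {T : Finset (Multiset ℕ)} (hT : Tri T) {a : ℕ} :
    a ∈ vr T ↔ ∃ b, ({a, b} : Multiset ℕ) ∈ shd T := by
  constructor
  · intro h
    obtain ⟨m, hm, ha⟩ := mem_vr.1 h
    obtain ⟨q, rfl⟩ := Multiset.exists_cons_of_mem ha
    have := hT _ hm
    simp only [Multiset.card_cons, Nat.reduceEqDiff] at this
    obtain ⟨x, y, rfl⟩ := Multiset.card_eq_two.1 this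
    refine ⟨y, mem_shd.2 ⟨x, ?_⟩⟩
    rw [Multiset.insert_eq_cons, Multiset.cons_swap]
    exact hm
  · rintro ⟨b, hb⟩
    exact shd_sub hb (by simp)

lemma vr_eq_of_shd_eq {S T : Finset (Multiset ℕ)} (hS : Tri S) (hT : Tri T)
    (h : shd S = shd T) : vr S = vr T := by
  ext a
  rw [vr_iff hS, vr_iff hT, h]

lemma mem_shd_trip {x y z : ℕ} {p : Multiset ℕ} :
    (∃ a, a ::ₘ p = {x, y, z}) ↔ p = {x, y} ∨ p = {x, z} ∨ p = {y, z} := by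
  constructor
  · rintro ⟨a, ha⟩
    have h1 : a ∈ ({x, y, z} : Multiset ℕ) := by rw [← ha]; simp
    simp only [Multiset.insert_eq_cons, Multiset.mem_cons, Multiset.mem_singleton] at h1
    rcases h1 with rfl | rfl | rfl
    · right; right; simpa using ha
    · right; left
      rw [Multiset.insert_eq_cons, Multiset.insert_eq_cons, Multiset.cons_swap] at ha
      simpa using ha
    · left
      rw [Multiset.pair_comm y a, Multiset.insert_eq_cons, Multiset.insert_eq_cons,
        Multiset.cons_swap] at ha
      simpa using ha
  · rintro (rfl | rfl | rfl)
    · refine ⟨z, ?_⟩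
      simp only [Multiset.insert_eq_cons]
      rw [Multiset.cons_swap]
      congr 1
      exact Multiset.pair_comm _ _
    · exact ⟨y, by simp only [Multiset.insert_eq_cons]; rw [Multiset.cons_swap]⟩
    · exact ⟨x, rfl⟩

lemma shd_insert (x y z : ℕ) (T : Finset (Multiset ℕ)) :
    shd (insert {x, y, z} T) = insert {x, y} (insert {x, z} (insert {y, z} (shd T))) := by
  ext p
  rw [mem_shd]
  simp only [Finset.mem_insert, exists_or, mem_shd_trip, mem_shd]
  tauto

lemma vr_insert (x y z : ℕ) (T : Finset (Multiset ℕ)) :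
    vr (insert {x, y, z} T) = insert x (insert y (insert z (vr T))) := by
  ext p
  simp only [mem_vr, Finset.mem_insert, exists_eq_or_imp, Multiset.insert_eq_cons,
    Multiset.mem_cons, Multiset.mem_singleton]
  tauto

lemma tri_insert {T : Finset (Multiset ℕ)} (hT : Tri T) (x y z : ℕ) :
    Tri (insert {x, y, z} T) := by
  intro m hm
  rcases Finset.mem_insert.1 hm with rfl | h
  · simp
  · exact hT m h

lemma tri_sub {S T : Finset (Multiset ℕ)} (hT : Tri T) (h : S ⊆ T) : Tri S :=
  fun m hm => hT m (h hm)

lemma exists_fresh (T : Finset (Multiset ℕ)) : ∃ N, ∀ a ∈ vr T, a < N :=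
  ⟨(vr T).sup id + 1, fun a ha => Nat.lt_succ_of_le (Finset.le_sup (f := id) ha)⟩

/-- exact numbers -/
def PP (v s t : ℕ) : Prop :=
  ∃ T, Tri T ∧ (vr T).card = v ∧ (shd T).card = s ∧ T.card = t

/-- at most `t` triples -/
def QQ (v s t : ℕ) : Prop :=
  ∃ T, Tri T ∧ (vr T).card = v ∧ (shd T).card = s ∧ T.card ≤ t

lemma shd_le_sym {T : Finset (Multiset ℕ)} (hT : Tri T) :
    shd T ⊆ ((vr T).sym 2).image (fun q : Sym ℕ 2 => (q : Multiset ℕ)) := by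
  intro p hp
  rw [Finset.mem_image]
  refine ⟨Sym.mk p (shd_card hT hp), ?_, rfl⟩
  rw [Finset.mem_sym_iff]
  intro a ha
  exact shd_sub hp ha

lemma sym_image_card (V : Finset ℕ) :
    ((V.sym 2).image (fun q : Sym ℕ 2 => (q : Multiset ℕ))).card = (V.card + 1).choose 2 := by
  rw [← Finset.card_sym2]
  symm
  refine Finset.card_bij (fun z _ => Sym2.toMultiset z) ?_ ?_ ?_
  · intro z hz
    rw [Finset.mem_image]
    refine ⟨Sym.mk z.toMultiset (Sym2.card_toMultiset z), ?_, rfl⟩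
    rw [Finset.mem_sym_iff]
    rw [Finset.mem_sym2_iff] at hz
    intro a ha
    exact hz a (Sym2.mem_toMultiset.1 ha)
  · intro z _ z' _ h
    induction z using Sym2.ind with
    | _ x y =>
    induction z' using Sym2.ind with
    | _ x' y' =>
    have h' : ({x, y} : Multiset ℕ) = {x', y'} := h
    rw [pair_eq] at h'
    rw [Sym2.eq_iff]
    exact h'
  · intro p hp
    obtain ⟨q, hq, rfl⟩ := Finset.mem_image.1 hp
    obtain ⟨x, y, hxy⟩ := Multiset.card_eq_two.1 (Sym.card_coe (s := q))
    rw [Finset.mem_sym_iff] at hq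
    have hx : x ∈ V := hq x (by change x ∈ (q : Multiset ℕ); rw [hxy]; simp)
    have hy : y ∈ V := hq y (by change y ∈ (q : Multiset ℕ); rw [hxy]; simp)
    exact ⟨s(x, y), by simp [hx, hy], hxy.symm⟩

lemma shd_card_le {T : Finset (Multiset ℕ)} (hT : Tri T) :
    (shd T).card ≤ ((vr T).card + 1).choose 2 := by
  rw [← sym_image_card]
  exact Finset.card_le_card (shd_le_sym hT)

/-- Lemma A: a missing pair can be added. -/
lemma lemA {v s t : ℕ} (h : PP v s t) (hs : s < (v + 1).choose 2) : PP v (s + 1) (t + 1) := by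
  obtain ⟨T, hT, rfl, rfl, rfl⟩ := h
  rw [← sym_image_card] at hs
  obtain ⟨p, hp1, hp2⟩ := Finset.exists_mem_notMem_of_card_lt_card hs
  have key : ∃ x y, x ∈ vr T ∧ y ∈ vr T ∧ ({x, y} : Multiset ℕ) ∉ shd T ∧
      (x ≠ y → {x, x} ∈ shd T) := by
    by_cases h : ∃ x ∈ vr T, ({x, x} : Multiset ℕ) ∉ shd T
    · obtain ⟨x, hx, hx'⟩ := h
      exact ⟨x, x, hx, hx, hx', by simp⟩
    · push Not at h
      obtain ⟨q, hq, rfl⟩ := Finset.mem_image.1 hp1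
      obtain ⟨x, y, hxy⟩ := Multiset.card_eq_two.1 (Sym.card_coe (s := q))
      rw [Finset.mem_sym_iff] at hq
      have hx : x ∈ vr T := hq x (by change x ∈ (q : Multiset ℕ); rw [hxy]; simp)
      have hy : y ∈ vr T := hq y (by change y ∈ (q : Multiset ℕ); rw [hxy]; simp)
      exact ⟨x, y, hx, hy, by rwa [← hxy], fun _ => h x hx⟩
  obtain ⟨x, y, hx, hy, hxy, hxx⟩ := key
  have hnot : ({x, x, y} : Multiset ℕ) ∉ T := fun h => hxy (mem_shd.2 ⟨x, h⟩)
  refine ⟨insert {x, x, y} T, tri_insert hT _ _ _, ?_, ?_, ?_⟩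
  · rw [vr_insert]
    simp [-Multiset.insert_eq_cons, hx, hy]
  · rw [shd_insert]
    by_cases h : x = y
    · subst h
      simp [-Multiset.insert_eq_cons, hxy]
    · have := hxx h
      rw [Finset.insert_eq_of_mem (a := ({x, y} : Multiset ℕ)) (by simp),
        Finset.insert_eq_of_mem (a := ({x, x} : Multiset ℕ)) (by simp [-Multiset.insert_eq_cons, this]),
        Finset.card_insert_of_notMem hxy]
  · rw [Finset.card_insert_of_notMem hnot]

lemma lemA_iter {v s t : ℕ} (h : PP v s t) (n : ℕ) (hs : s + n ≤ (v + 1).choose 2) :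
    PP v (s + n) (t + n) := by
  induction n with
  | zero => exact h
  | succ n ih =>
    have h1 : s + n < (v + 1).choose 2 := by omega
    exact lemA (ih h1.le) h1

lemma PP_iso {v s t : ℕ} (h : PP v s t) : PP (v + 1) (s + 1) (t + 1) := by
  obtain ⟨T, hT, rfl, rfl, rfl⟩ := h
  obtain ⟨N, hN⟩ := exists_fresh T
  have h1 : N ∉ vr T := fun h => lt_irrefl _ (hN N h)
  have h2 : ({N, N} : Multiset ℕ) ∉ shd T := fun h => h1 (shd_sub h (by simp))
  have h3 : ({N, N, N} : Multiset ℕ) ∉ T := fun h => h2 (mem_shd.2 ⟨N, h⟩)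
  refine ⟨insert {N, N, N} T, tri_insert hT _ _ _, ?_, ?_, ?_⟩
  · rw [vr_insert]; simp [-Multiset.insert_eq_cons, h1]
  · rw [shd_insert]; simp [-Multiset.insert_eq_cons, h2]
  · rw [Finset.card_insert_of_notMem h3]

lemma PP_diag (v : ℕ) : PP v v v := by
  induction v with
  | zero => exact ⟨∅, by simp [-Multiset.insert_eq_cons, Tri], by simp [-Multiset.insert_eq_cons, vr], by simp [-Multiset.insert_eq_cons, shd], rfl⟩
  | succ n ih => exact PP_iso ih

/-- Lemma B -/
lemma lemB {v s : ℕ} (h1 : v ≤ s) (h2 : s ≤ (v + 1).choose 2) : PP v s s := by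
  have := lemA_iter (PP_diag v) (s - v) (by omega)
  rwa [Nat.add_sub_cancel' h1] at this

/-- removal of a redundant triple -/
lemma lemDown {v s t : ℕ} (h : PP v s (t + 1)) (hst : s ≤ t) : PP v s t := by
  obtain ⟨T, hT, rfl, rfl, hc⟩ := h
  have key : ∃ m ∈ T, shd (T.erase m) = shd T := by
    by_contra hcon
    push Not at hcon
    have : ∀ m ∈ T, ∃ p ∈ shd T, p ∉ shd (T.erase m) := by
      intro m hm
      by_contra h'
      push Not at h'
      exact hcon m hm (Finset.Subset.antisymm (shd_mono (Finset.erase_subset _ _)) h')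
    choose! f hf1 hf2 using this
    have := Finset.card_le_card_of_injOn f hf1 (by
      intro m hm m' hm' he
      by_contra hne
      obtain ⟨a, ha⟩ := mem_shd.1 (hf1 m hm)
      obtain ⟨a', ha'⟩ := mem_shd.1 (hf1 m' hm')
      have e1 : a ::ₘ f m = m := by
        by_contra h
        exact hf2 m hm (mem_shd.2 ⟨a, Finset.mem_erase.2 ⟨h, ha⟩⟩)
      have e2 : a ::ₘ f m = m' := by
        by_contra h
        exact hf2 m' hm' (mem_shd.2 ⟨a, Finset.mem_erase.2 ⟨by rwa [← he], by rwa [← he]⟩⟩)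
      exact hne (e1.symm.trans e2))
    omega
  obtain ⟨m, hm, he⟩ := key
  have hT' : Tri (T.erase m) := tri_sub hT (Finset.erase_subset _ _)
  exact ⟨T.erase m, hT', by rw [vr_eq_of_shd_eq hT' hT he], by rw [he],
    by rw [Finset.card_erase_of_mem hm]; omega⟩

lemma lemDown_iter {v s t : ℕ} (n : ℕ) (h : PP v s (t + n)) (hst : s ≤ t) : PP v s t := by
  induction n with
  | zero => exact h
  | succ n ih => exact ih (lemDown h (by omega))

/-! ### adding blocks -/

lemma QQ_mono {v s t t' : ℕ} (h : QQ v s t) (ht : t ≤ t') : QQ v s t' := by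
  obtain ⟨T, h1, h2, h3, h4⟩ := h
  exact ⟨T, h1, h2, h3, h4.trans ht⟩

lemma QQ_A {v s t : ℕ} (h : QQ v s t) (hs : s < (v + 1).choose 2) : QQ v (s + 1) (t + 1) := by
  obtain ⟨T, h1, h2, h3, h4⟩ := h
  obtain ⟨T', a, b, c, d⟩ := lemA ⟨T, h1, h2, h3, rfl⟩ hs
  exact ⟨T', a, b, c, by omega⟩

lemma QQ_block {v s t : ℕ} (h : QQ v s t) (j : ℕ) (hj : j ≤ 3) : QQ (v + j) (s + j) (t + 1) := by
  obtain ⟨T, hT, rfl, rfl, ht⟩ := h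
  obtain ⟨N, hN⟩ := exists_fresh T
  have h1 : ∀ i, N + i ∉ vr T := fun i h => by have := hN _ h; omega
  have h2 : ∀ i b, ({N + i, b} : Multiset ℕ) ∉ shd T := fun i b h => h1 i (shd_sub h (by simp))
  have h0 := h1 0
  have h20 := h2 0
  simp only [add_zero] at h0 h20
  have hj' : j = 0 ∨ j = 1 ∨ j = 2 ∨ j = 3 := by omega
  rcases hj' with rfl | rfl | rfl | rfl
  · exact ⟨T, hT, rfl, rfl, by omega⟩
  · refine ⟨insert {N, N, N} T, tri_insert hT _ _ _, ?_, ?_, (Finset.card_insert_le _ _).trans (by omega)⟩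
    · rw [vr_insert]; simp [-Multiset.insert_eq_cons, h0]
    · rw [shd_insert]; simp [-Multiset.insert_eq_cons, h20]
  · refine ⟨insert {N, N, N+1} T, tri_insert hT _ _ _, ?_, ?_, (Finset.card_insert_le _ _).trans (by omega)⟩
    · rw [vr_insert]; simp [-Multiset.insert_eq_cons, h1, h0]
    · rw [shd_insert]; simp [-Multiset.insert_eq_cons, h20, pair_eq]
  · refine ⟨insert {N, N+1, N+2} T, tri_insert hT _ _ _, ?_, ?_, (Finset.card_insert_le _ _).trans (by omega)⟩
    · rw [vr_insert]; simp [-Multiset.insert_eq_cons, h1, h0]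
    · rw [shd_insert]; simp [-Multiset.insert_eq_cons, h20, h2, pair_eq]

/-- one new variable, two new pairs -/
lemma QQ_12 {v s t : ℕ} (h : QQ v s t) (hv : 1 ≤ v) : QQ (v + 1) (s + 2) (t + 1) := by
  obtain ⟨T, hT, rfl, rfl, ht⟩ := h
  obtain ⟨N, hN⟩ := exists_fresh T
  have h0 : N ∉ vr T := fun h => lt_irrefl _ (hN _ h)
  have h20 : ∀ b, ({N, b} : Multiset ℕ) ∉ shd T := fun b h => h0 (shd_sub h (by simp))
  obtain ⟨x, hx⟩ := Finset.card_pos.1 hv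
  have hxN : x ≠ N := fun h => h0 (h ▸ hx)
  refine ⟨insert {N, N, x} T, tri_insert hT _ _ _, ?_, ?_, (Finset.card_insert_le _ _).trans (by omega)⟩
  · rw [vr_insert]; simp [-Multiset.insert_eq_cons, h0, hx]
  · rw [shd_insert]; simp [-Multiset.insert_eq_cons, h20, pair_eq, hxN, hxN.symm]

/-- two new variables, three new pairs -/
lemma QQ_23 {v s t : ℕ} (h : QQ v s t) (hv : 1 ≤ v) : QQ (v + 2) (s + 3) (t + 1) := by
  obtain ⟨T, hT, rfl, rfl, ht⟩ := h
  obtain ⟨N, hN⟩ := exists_fresh T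
  have h0 : N ∉ vr T := fun h => lt_irrefl _ (hN _ h)
  have h1 : N + 1 ∉ vr T := fun h => by have := hN _ h; omega
  have h20 : ∀ b, ({N, b} : Multiset ℕ) ∉ shd T := fun b h => h0 (shd_sub h (by simp))
  have h21 : ∀ b, ({N + 1, b} : Multiset ℕ) ∉ shd T := fun b h => h1 (shd_sub h (by simp))
  obtain ⟨x, hx⟩ := Finset.card_pos.1 hv
  have hxN : x ≠ N := fun h => h0 (h ▸ hx)
  have hxN1 : x ≠ N + 1 := fun h => h1 (h ▸ hx)
  refine ⟨insert {N, N + 1, x} T, tri_insert hT _ _ _, ?_, ?_, (Finset.card_insert_le _ _).trans (by omega)⟩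
  · rw [vr_insert]; simp [-Multiset.insert_eq_cons, h0, h1, hx]
  · rw [shd_insert]; simp [-Multiset.insert_eq_cons, h20, h21, pair_eq, hxN.symm, hxN1.symm, hxN1]

/-- the effect of deleting a triple -/
lemma removal {T : Finset (Multiset ℕ)} (hT : Tri T) {M : Multiset ℕ} (hM : M ∈ T) :
    ∃ j k, (vr T).card = (vr (T.erase M)).card + j ∧ (shd T).card = (shd (T.erase M)).card + k ∧
      j ≤ k ∧ k ≤ 3 ∧ (j + 2 ≤ k → 1 ≤ (vr (T.erase M)).card) ∧
      (k = 3 → ∃ x y z, x ≠ y ∧ x ≠ z ∧ y ≠ z ∧ M = {x, y, z} ∧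
        ({x, y} : Multiset ℕ) ∉ shd (T.erase M)) := by
  obtain ⟨x, y, z, rfl⟩ := Multiset.card_eq_three.1 (hT M hM)
  set T0 := T.erase {x, y, z} with hT0
  have hTe : T = insert {x, y, z} T0 := (Finset.insert_erase hM).symm
  rw [hTe, vr_insert, shd_insert]
  have e : ∀ a b, ({a, b} : Multiset ℕ) ∈ shd T0 → a ∈ vr T0 ∧ b ∈ vr T0 := fun a b h =>
    ⟨shd_sub h (by simp), shd_sub h (by simp)⟩
  have exy := e x y
  have exz := e x z
  have eyz := e y z
  have hpos : ∀ a, a ∈ vr T0 → 1 ≤ (vr T0).card := fun a h => Finset.card_pos.2 ⟨a, h⟩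
  have hx := hpos x
  have hy := hpos y
  have hz := hpos z
  refine ⟨_, _, (Nat.add_sub_cancel' (Finset.card_le_card (by
    intro a ha; simp [-Multiset.insert_eq_cons, ha]))).symm, (Nat.add_sub_cancel' (Finset.card_le_card (by
    intro a ha; simp [-Multiset.insert_eq_cons, ha]))).symm, ?_⟩
  have hk3 : ∀ P : Prop, (x ≠ y → x ≠ z → y ≠ z → ({x, y} : Multiset ℕ) ∉ shd T0 → P) →
     (x ≠ y → x ≠ z → y ≠ z → ({x, y} : Multiset ℕ) ∉ shd T0 → P) := fun _ h => h
  have hfin : (x ≠ y ∧ x ≠ z ∧ y ≠ z ∧ ({x, y} : Multiset ℕ) ∉ shd T0) →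
     ∃ x' y' z', x' ≠ y' ∧ x' ≠ z' ∧ y' ≠ z' ∧ ({x, y, z} : Multiset ℕ) = {x', y', z'} ∧
        ({x', y'} : Multiset ℕ) ∉ shd T0 := fun h => ⟨x, y, z, h.1, h.2.1, h.2.2.1, rfl, h.2.2.2⟩
  suffices hmain : ((insert x (insert y (insert z (vr T0)))).card - (vr T0).card ≤
      (insert {x, y} (insert {x, z} (insert {y, z} (shd T0)))).card - (shd T0).card ∧
      (insert {x, y} (insert {x, z} (insert {y, z} (shd T0)))).card - (shd T0).card ≤ 3 ∧
      ((insert x (insert y (insert z (vr T0)))).card - (vr T0).card + 2 ≤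
      (insert {x, y} (insert {x, z} (insert {y, z} (shd T0)))).card - (shd T0).card →
        1 ≤ (vr T0).card) ∧
      ((insert {x, y} (insert {x, z} (insert {y, z} (shd T0)))).card - (shd T0).card = 3 →
        (x ≠ y ∧ x ≠ z ∧ y ≠ z ∧ ({x, y} : Multiset ℕ) ∉ shd T0))) by
    exact ⟨hmain.1, hmain.2.1, hmain.2.2.1, fun h => hfin (hmain.2.2.2 h)⟩
  clear hfin hk3 hTe hM hpos e
  clear_value T0
  clear hT0
  simp only [Finset.card_insert_eq_ite, Finset.mem_insert, pair_eq]
  generalize (vr T0).card = n at *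
  generalize (shd T0).card = q at *
  by_cases h1 : x = y
  · subst h1
    by_cases h2 : x = z
    · subst h2
      generalize hpxx : ({x, x} : Multiset ℕ) = A at *
      by_cases A ∈ shd T0 <;>
          by_cases x ∈ vr T0 <;>
          simp_all <;> omega
    · generalize hpxx : ({x, x} : Multiset ℕ) = A at *
      generalize hpxz : ({x, z} : Multiset ℕ) = A' at *
      have h2' : ¬ z = x := fun h => h2 h.symm
      by_cases A ∈ shd T0 <;>
          by_cases A' ∈ shd T0 <;>
          by_cases x ∈ vr T0 <;>
          by_cases z ∈ vr T0 <;>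
          simp_all <;> omega
  · by_cases h2 : x = z
    · subst h2
      rw [Multiset.pair_comm y x] at *
      generalize hpxx : ({x, x} : Multiset ℕ) = A at *
      generalize hpxy : ({x, y} : Multiset ℕ) = A' at *
      have h2' : ¬ y = x := fun h => h1 h.symm
      by_cases A ∈ shd T0 <;>
          by_cases A' ∈ shd T0 <;>
          by_cases x ∈ vr T0 <;>
          by_cases y ∈ vr T0 <;>
          simp_all <;> omega
    · by_cases h3 : y = z
      · subst h3
        generalize hpxy : ({x, y} : Multiset ℕ) = A at *
        generalize hpyy : ({y, y} : Multiset ℕ) = A' at *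
        have h2' : ¬ y = x := fun h => h1 h.symm
        by_cases A ∈ shd T0 <;>
          by_cases A' ∈ shd T0 <;>
          by_cases x ∈ vr T0 <;>
          by_cases y ∈ vr T0 <;>
          simp_all <;> omega
      · have h1' : ¬ y = x := fun h => h1 h.symm
        have h2' : ¬ z = x := fun h => h2 h.symm
        have h3' : ¬ z = y := fun h => h3 h.symm
        generalize hpxy : ({x, y} : Multiset ℕ) = A at *
        generalize hpxz : ({x, z} : Multiset ℕ) = A' at *
        generalize hpyz : ({y, z} : Multiset ℕ) = A'' at *
        simp only [h1, h2, h3, h1', h2', h3', false_and, and_false, false_or, or_false]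
        by_cases A ∈ shd T0 <;>
          by_cases A' ∈ shd T0 <;>
          by_cases A'' ∈ shd T0 <;>
          by_cases x ∈ vr T0 <;>
          by_cases y ∈ vr T0 <;>
          by_cases z ∈ vr T0 <;>
          simp_all <;> omega


lemma vr_le_shd {T : Finset (Multiset ℕ)} (hT : Tri T) : (vr T).card ≤ (shd T).card := by
  induction hn : T.card generalizing T with
  | zero =>
    rw [Finset.card_eq_zero] at hn
    subst hn; simp [vr]
  | succ n ih =>
    obtain ⟨M, hM⟩ := Finset.card_pos.1 (by omega : 0 < T.card)
    obtain ⟨j, k, h1, h2, h3, -⟩ := removal hT hM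
    have := ih (tri_sub hT (Finset.erase_subset M T)) (by rw [Finset.card_erase_of_mem hM]; omega)
    omega

/-- Lemma U: raising the number of variables -/
lemma lemU {T : Finset (Multiset ℕ)} (hT : Tri T) {v : ℕ} (h1 : (vr T).card ≤ v)
    (h2 : v ≤ (shd T).card) : QQ v (shd T).card T.card := by
  induction hn : T.card generalizing T v with
  | zero =>
    rw [Finset.card_eq_zero] at hn
    subst hn
    have : v = 0 := by simpa [shd] using h2
    subst this
    exact ⟨∅, hT, by simp [vr], rfl, by simp⟩
  | succ n ih =>
    rcases h1.eq_or_lt with h1 | h1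
    · exact ⟨T, hT, h1, rfl, hn.le⟩
    obtain ⟨M, hM⟩ := Finset.card_pos.1 (by omega : 0 < T.card)
    obtain ⟨j, k, hv, hs, hjk, hk3, hpos, hdist⟩ := removal hT hM
    have hT0 := tri_sub hT (Finset.erase_subset M T)
    have hc : (T.erase M).card = n := by rw [Finset.card_erase_of_mem hM]; omega
    have base : QQ (vr (T.erase M)).card (shd (T.erase M)).card n := ⟨_, hT0, rfl, rfl, hc.le⟩
    by_cases hcase : (vr (T.erase M)).card + k ≤ v
    · have := QQ_block (ih hT0 (v := v - k) (by omega) (by omega) hc) k hk3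
      rw [Nat.sub_add_cancel (by omega), ← hs] at this
      exact this
    · have hp := hpos (by omega)
      rw [hs]
      have : (k = 2 ∧ v = (vr (T.erase M)).card + 1) ∨ (k = 3 ∧ v = (vr (T.erase M)).card + 2) ∨
          (k = 3 ∧ j = 0 ∧ v = (vr (T.erase M)).card + 1) := by omega
      rcases this with ⟨rfl, rfl⟩ | ⟨rfl, rfl⟩ | ⟨rfl, rfl, rfl⟩
      · exact QQ_12 base hp
      · exact QQ_23 base hp
      · obtain ⟨x, y, z, hxy, hxz, hyz, hMe, hn'⟩ := hdist rfl
        have hvv : vr (T.erase M) = vr T :=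
          Finset.eq_of_subset_of_card_le (vr_mono (Finset.erase_subset _ _)) (by omega)
        have hx : x ∈ vr (T.erase M) := by rw [hvv]; exact mem_vr.2 ⟨M, hM, by simp [hMe]⟩
        have hy : y ∈ vr (T.erase M) := by rw [hvv]; exact mem_vr.2 ⟨M, hM, by simp [hMe]⟩
        obtain ⟨N, hN⟩ := exists_fresh (T.erase M)
        have h0 : N ∉ vr (T.erase M) := fun h => lt_irrefl _ (hN _ h)
        have h20 : ∀ b, ({N, b} : Multiset ℕ) ∉ shd (T.erase M) := fun b h => h0 (shd_sub h (by simp))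
        have hNx : N ≠ x := fun h => h0 (h ▸ hx)
        have hNy : N ≠ y := fun h => h0 (h ▸ hy)
        refine ⟨insert {N, x, y} (T.erase M), tri_insert hT0 _ _ _, ?_, ?_,
          (Finset.card_insert_le _ _).trans (by omega)⟩
        · rw [vr_insert]; simp [-Multiset.insert_eq_cons, h0, hx, hy]
        · rw [shd_insert]
          simp [-Multiset.insert_eq_cons, h20, hn', pair_eq, hxy, hNx, hNy]

/-- Lemma L: lowering the number of pairs -/
lemma lemL {T : Finset (Multiset ℕ)} (hT : Tri T) {s : ℕ} (h1 : (vr T).card ≤ s)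
    (h2 : s ≤ (shd T).card) : QQ (vr T).card s T.card := by
  induction hn : T.card generalizing T s with
  | zero =>
    rw [Finset.card_eq_zero] at hn
    subst hn
    have : s = 0 := by simpa [shd] using h2
    subst this
    exact ⟨∅, hT, by simp [vr], by simp [shd], by simp⟩
  | succ n ih =>
    rcases h2.eq_or_lt with h2 | h2
    · exact ⟨T, hT, rfl, h2.symm, hn.le⟩
    have hchoose : ∃ M ∈ T, (∃ x y, M = {x, x, y}) ∨ ∀ M ∈ T, ∀ x y, M ≠ {x, x, y} := by
      by_cases h : ∃ M ∈ T, ∃ x y, M = {x, x, y}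
      · obtain ⟨M, hM, h⟩ := h
        exact ⟨M, hM, Or.inl h⟩
      · push Not at h
        obtain ⟨M, hM⟩ := Finset.card_pos.1 (by omega : 0 < T.card)
        exact ⟨M, hM, Or.inr h⟩
    obtain ⟨M, hM, hsq⟩ := hchoose
    obtain ⟨j, k, hv, hs, hjk, hk3, hpos, hdist⟩ := removal hT hM
    have hT0 := tri_sub hT (Finset.erase_subset M T)
    have hc : (T.erase M).card = n := by rw [Finset.card_erase_of_mem hM]; omega
    have base : QQ (vr (T.erase M)).card (shd (T.erase M)).card n := ⟨_, hT0, rfl, rfl, hc.le⟩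
    have hle := shd_card_le hT
    by_cases hcase : s ≤ (shd (T.erase M)).card + j
    · have := QQ_block (ih hT0 (s := s - j) (by omega) (by omega) hc) j (by omega)
      rw [Nat.sub_add_cancel (by omega), ← hv] at this
      exact this
    · have hp := hpos (by omega)
      have : (k = 2 + j ∧ j = 1 ∧ s = (shd (T.erase M)).card + 2) ∨
          (j = 0 ∧ s = (shd (T.erase M)).card + 1) ∨
          (k = 3 ∧ j = 0 ∧ s = (shd (T.erase M)).card + 2) := by omega
      rcases this with ⟨-, rfl, rfl⟩ | ⟨rfl, rfl⟩ | ⟨rfl, rfl, rfl⟩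
      · rw [hv]; exact QQ_12 base hp
      · rw [hv]
        refine QQ_A base ?_
        rw [add_zero] at hv
        rw [add_zero, ← hv]
        omega
      · obtain ⟨x, y, z, hxy, hxz, hyz, hMe, hn'⟩ := hdist rfl
        have hvv : vr (T.erase M) = vr T :=
          Finset.eq_of_subset_of_card_le (vr_mono (Finset.erase_subset _ _)) (by omega)
        have hx : x ∈ vr (T.erase M) := by rw [hvv]; exact mem_vr.2 ⟨M, hM, by simp [hMe]⟩
        have hy : y ∈ vr (T.erase M) := by rw [hvv]; exact mem_vr.2 ⟨M, hM, by simp [hMe]⟩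
        have hnosq : ∀ M ∈ T, ∀ x y, M ≠ {x, x, y} := by
          rcases hsq with ⟨a, b, hab⟩ | h
          · exfalso
            have h3 := shd_insert a a b (T.erase M)
            rw [← hab, Finset.insert_erase hM] at h3
            rw [h3, Finset.insert_eq_of_mem (a := ({a, b} : Multiset ℕ)) (by simp)] at hs
            have i1 := Finset.card_insert_le ({a, a} : Multiset ℕ)
              (insert {a, b} (shd (T.erase M)))
            have i2 := Finset.card_insert_le ({a, b} : Multiset ℕ) (shd (T.erase M))
            omega
          · exact h
        have hxx : ({x, x} : Multiset ℕ) ∉ shd (T.erase M) := by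
          intro h
          obtain ⟨a, ha⟩ := mem_shd.1 h
          refine hnosq _ (Finset.mem_of_mem_erase ha) x a ?_
          rw [Multiset.insert_eq_cons, Multiset.insert_eq_cons, Multiset.cons_swap,
            ← Multiset.insert_eq_cons a, Multiset.pair_comm]
        refine ⟨insert {x, x, y} (T.erase M), tri_insert hT0 _ _ _, ?_, ?_,
          (Finset.card_insert_le _ _).trans (by omega)⟩
        · rw [vr_insert, ← hvv]; simp [-Multiset.insert_eq_cons, hx, hy]
        · rw [shd_insert]
          simp [-Multiset.insert_eq_cons, hxx, hn', pair_eq, hxy]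


lemma shd_trip_mem {T : Finset (Multiset ℕ)} {x y z : ℕ} (h : ({x, y, z} : Multiset ℕ) ∈ T) :
    {x, y} ∈ shd T ∧ {x, z} ∈ shd T ∧ {y, z} ∈ shd T := by
  have key : ∀ p : Multiset ℕ, (p = {x, y} ∨ p = {x, z} ∨ p = {y, z}) → p ∈ shd T := by
    intro p hp
    obtain ⟨a, ha⟩ := mem_shd_trip.2 hp
    exact mem_shd.2 ⟨a, ha ▸ h⟩
  exact ⟨key _ (by simp), key _ (by simp), key _ (by simp)⟩

/-- the combinatorial situation left over in Lemma C -/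
lemma exists_bad {T : Finset (Multiset ℕ)} (hT : Tri T) (hlt : T.card < (shd T).card)
    (hsat : ∀ x y z, ({x, y} : Multiset ℕ) ∈ shd T → ({x, z} : Multiset ℕ) ∈ shd T →
      ({y, z} : Multiset ℕ) ∈ shd T → ({x, y, z} : Multiset ℕ) ∈ T) :
    ∃ z w, ({z, w} : Multiset ℕ) ∈ shd T ∧ ({z, z} : Multiset ℕ) ∉ shd T ∧
      ({w, w} : Multiset ℕ) ∉ shd T := by
  by_contra hcon
  have h1 : ∀ p ∈ shd T, ∃ x, x ∈ p ∧ ({x, x} : Multiset ℕ) ∈ shd T := by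
    intro p hp
    obtain ⟨z, w, rfl⟩ := Multiset.card_eq_two.1 (shd_card hT hp)
    by_contra h
    push Not at h
    exact hcon ⟨z, w, hp, h z (by simp), h w (by simp)⟩
  choose! f hf1 hf2 using h1
  have := Finset.card_le_card_of_injOn (s := shd T) (t := T) (fun p => f p ::ₘ p) (by
    intro p hp
    obtain ⟨b, hb⟩ := Multiset.exists_cons_of_mem (hf1 p hp)
    have hc := shd_card hT hp
    rw [hb, Multiset.card_cons] at hc
    obtain ⟨y, rfl⟩ := Multiset.card_eq_one.1 (by omega : b.card = 1)
    have h2 := hsat (f p) (f p) y (hf2 p hp) (by rw [Multiset.insert_eq_cons, ← hb]; exact hp)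
      (by rw [Multiset.insert_eq_cons, ← hb]; exact hp)
    have : f p ::ₘ p = {f p, f p, y} := by
      exact congrArg (fun q => f p ::ₘ q) hb
    simp only [this]
    exact h2) (by
    intro p hp q hq he
    simp only at he
    have hpq : f p = f q := by
      by_contra hne
      have c1 := shd_card hT hp
      have e1 := Multiset.one_le_count_iff_mem.2 (hf1 p hp)
      have e2 := Multiset.one_le_count_iff_mem.2 (hf1 q hq)
      have e3 := congrArg (Multiset.count (f q)) he
      rw [Multiset.count_cons_self, Multiset.count_cons_of_ne (Ne.symm hne)] at e3
      obtain ⟨b, hb⟩ := Multiset.exists_cons_of_mem (hf1 p hp)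
      have c2 : (Multiset.count (f q) b) ≤ b.card := Multiset.count_le_card _ _
      have e4 := congrArg (Multiset.count (f q)) hb
      rw [Multiset.count_cons_of_ne (Ne.symm hne)] at e4
      have e5 := congrArg Multiset.card hb
      rw [Multiset.card_cons] at e5
      omega
    rw [hpq] at he
    simpa using he)
  omega

lemma mem_trip_zw {z w : ℕ} (hzw : z ≠ w) {m : Multiset ℕ} (hm : m.card = 3) (hz : z ∈ m)
    (hw : w ∈ m) : ∃ u, m = {z, w, u} := by
  obtain ⟨q, rfl⟩ := Multiset.exists_cons_of_mem hz
  rw [Multiset.mem_cons] at hw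
  rcases hw with hw | hw
  · exact absurd hw.symm hzw
  obtain ⟨r, rfl⟩ := Multiset.exists_cons_of_mem hw
  simp only [Multiset.card_cons] at hm
  obtain ⟨y, rfl⟩ := Multiset.card_eq_one.1 (by omega : r.card = 1)
  exact ⟨y, rfl⟩

set_option maxHeartbeats 2000000 in
lemma lemC {v s t : ℕ} (h : PP v s t) (hts : t < s) : PP v s (t + 1) := by
  classical
  obtain ⟨T, hT, rfl, rfl, rfl⟩ := h
  by_cases hsat : ∀ x y z, ({x, y} : Multiset ℕ) ∈ shd T → ({x, z} : Multiset ℕ) ∈ shd T →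
      ({y, z} : Multiset ℕ) ∈ shd T → ({x, y, z} : Multiset ℕ) ∈ T
  swap
  · push Not at hsat
    obtain ⟨x, y, z, h1, h2, h3, h4⟩ := hsat
    have he : shd (insert {x, y, z} T) = shd T := by
      rw [shd_insert]; simp [-Multiset.insert_eq_cons, h1, h2, h3]
    exact ⟨insert {x, y, z} T, tri_insert hT _ _ _,
      by rw [vr_eq_of_shd_eq (tri_insert hT _ _ _) hT he], by rw [he],
      Finset.card_insert_of_notMem h4⟩
  obtain ⟨z, w, hzwG, hzz, hww⟩ := exists_bad hT hts hsat
  have hzw : z ≠ w := by rintro rfl; exact hzz hzwG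
  set U := (vr T).filter (fun u => ({z, w, u} : Multiset ℕ) ∈ T) with hU
  have memU : ∀ u, u ∈ U ↔ ({z, w, u} : Multiset ℕ) ∈ T := by
    intro u
    rw [hU, Finset.mem_filter]
    exact ⟨fun h => h.2, fun h => ⟨mem_vr.2 ⟨_, h, by simp⟩, h⟩⟩
  have hUz : ∀ u ∈ U, u ≠ z := by
    rintro u hu rfl
    exact hzz (shd_trip_mem ((memU u).1 hu)).2.1
  have hUw : ∀ u ∈ U, u ≠ w := by
    rintro u hu rfl
    exact hww (shd_trip_mem ((memU u).1 hu)).2.2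
  obtain ⟨u0, hu0⟩ : ∃ u, u ∈ U := by
    obtain ⟨a, ha⟩ := mem_shd.1 hzwG
    refine ⟨a, (memU a).2 ?_⟩
    have : ({z, w, a} : Multiset ℕ) = a ::ₘ {z, w} := by
      rw [Multiset.pair_comm w a, Multiset.insert_eq_cons, Multiset.insert_eq_cons,
        Multiset.cons_swap]
      rfl
    rwa [this]
  set T0 := T.filter (fun m => ¬ (z ∈ m ∧ w ∈ m)) with hT0
  have hT0T : T0 ⊆ T := Finset.filter_subset _ _
  have hsplit : ∀ m, m ∈ T ↔ m ∈ T0 ∨ ∃ u ∈ U, m = {z, w, u} := by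
    intro m
    constructor
    · intro hm
      by_cases h : z ∈ m ∧ w ∈ m
      · obtain ⟨u, rfl⟩ := mem_trip_zw hzw (hT m hm) h.1 h.2
        exact Or.inr ⟨u, (memU u).2 hm, rfl⟩
      · exact Or.inl (Finset.mem_filter.2 ⟨hm, h⟩)
    · rintro (h | ⟨u, hu, rfl⟩)
      · exact hT0T h
      · exact (memU u).1 hu
  have hcardT : T.card = T0.card + U.card := by
    have : T = T0 ∪ U.image (fun u => ({z, w, u} : Multiset ℕ)) := by
      ext m
      rw [hsplit, Finset.mem_union, Finset.mem_image]
      simp only [eq_comm]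
    rw [this, Finset.card_union_of_disjoint, Finset.card_image_of_injective]
    · intro a b hab
      simpa using hab
    · rw [Finset.disjoint_left]
      intro m hm hm'
      obtain ⟨u, -, rfl⟩ := Finset.mem_image.1 hm'
      exact (Finset.mem_filter.1 hm).2 (by simp)
  set Lst := U.filter (fun u => ({w, u} : Multiset ℕ) ∉ shd T0) with hL
  have hLU : Lst ⊆ U := Finset.filter_subset _ _
  have hLG : ∀ u ∈ Lst, ({u, u} : Multiset ℕ) ∉ shd T := by
    intro u hu huu
    obtain ⟨huU, hn⟩ := Finset.mem_filter.1 hu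
    have h1 := (shd_trip_mem ((memU u).1 huU)).2.2
    rw [Multiset.pair_comm] at h1
    have h2 := hsat u u w huu h1 h1
    have h3 : ({u, u, w} : Multiset ℕ) ∈ T0 := by
      refine Finset.mem_filter.2 ⟨h2, ?_⟩
      rintro ⟨h, -⟩
      simp [hzw, (hUz u huU).symm] at h
    have := (shd_trip_mem h3).2.1
    rw [Multiset.pair_comm] at this
    exact hn this
  obtain ⟨e, he, heL, hew⟩ : ∃ e, (e = z ∨ e = w) ∧ (∀ u ∈ U, u ∉ Lst → e = z) ∧
      (e = w ∨ w ∈ vr T0) := by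
    by_cases hw : w ∈ vr T0
    · exact ⟨z, Or.inl rfl, fun _ _ _ => rfl, Or.inr hw⟩
    · refine ⟨w, Or.inr rfl, fun u hu hn => ?_, Or.inl rfl⟩
      exfalso
      apply hw
      have : ({w, u} : Multiset ℕ) ∈ shd T0 := by
        by_contra h
        exact hn (Finset.mem_filter.2 ⟨hu, h⟩)
      exact shd_sub this (by simp)
  have heG : ({e, e} : Multiset ℕ) ∉ shd T := by rcases he with rfl | rfl <;> assumption
  have heU : ∀ u ∈ U, u ≠ e := by
    rcases he with rfl | rfl <;> assumption
  set g : ℕ → Multiset ℕ := fun u => if u ∈ Lst then {z, u, u} else {z, u, z} with hg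
  have hgL : ∀ u ∈ Lst, g u = {z, u, u} := fun u hu => if_pos hu
  have hgN : ∀ u, u ∉ Lst → g u = {z, u, z} := fun u hu => if_neg hu
  have hgz : ∀ u, z ∈ g u := by
    intro u; by_cases h : u ∈ Lst
    · simp [hgL u h]
    · simp [hgN u h]
  have hgu : ∀ u, u ∈ g u := by
    intro u; by_cases h : u ∈ Lst
    · simp [hgL u h]
    · simp [hgN u h]
  have hgsub : ∀ u a, a ∈ g u → a = z ∨ a = u := by
    intro u a ha; by_cases h : u ∈ Lst
    · simpa [hgL u h] using ha
    · rw [hgN u h] at ha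
      simp at ha
      tauto
  have hg3 : ∀ u, (g u).card = 3 := by
    intro u; by_cases h : u ∈ Lst
    · simp [hgL u h]
    · simp [hgN u h]
  have hgT : ∀ u ∈ U, g u ∉ T := by
    intro u hu; by_cases h : u ∈ Lst
    · rw [hgL u h]; intro h'
      exact hLG u h (shd_trip_mem h').2.2
    · rw [hgN u h]; intro h'
      exact hzz (shd_trip_mem h').2.1
  have hgshd : ∀ u p, (∃ a, a ::ₘ p = g u) ↔
      (p = {z, u} ∨ (u ∈ Lst ∧ p = {u, u}) ∨ (u ∉ Lst ∧ p = {z, z})) := by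
    intro u p
    by_cases h : u ∈ Lst
    · rw [hgL u h, mem_shd_trip]; tauto
    · rw [hgN u h, mem_shd_trip, Multiset.pair_comm u z]; tauto
  have heg : ∀ u ∈ U, ({e, e, e} : Multiset ℕ) ≠ g u := by
    intro u hu h
    have := hgu u
    rw [← h] at this
    exact heU u hu (by simpa using this)
  have heT : ({e, e, e} : Multiset ℕ) ∉ T := fun h => heG (shd_trip_mem h).1
  have memT1 : ∀ m, m ∈ T0 ∪ insert {e, e, e} (U.image g) ↔
      m ∈ T0 ∨ m = {e, e, e} ∨ ∃ u ∈ U, g u = m := by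
    intro m
    rw [Finset.mem_union, Finset.mem_insert, Finset.mem_image]
  have hT1 : Tri (T0 ∪ insert {e, e, e} (U.image g)) := by
    intro m hm
    rcases (memT1 m).1 hm with h | rfl | ⟨u, hu, rfl⟩
    · exact hT m (hT0T h)
    · simp
    · exact hg3 u
  have hzV : z ∈ vr T := shd_sub hzwG (by simp)
  have hwV : w ∈ vr T := shd_sub hzwG (by simp)
  have hUV : ∀ u ∈ U, u ∈ vr T := fun u hu => (Finset.mem_filter.1 hu).1
  refine ⟨T0 ∪ insert {e, e, e} (U.image g), hT1, ?_, ?_, ?_⟩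
  · congr 1
    ext a
    rw [mem_vr]
    constructor
    · rintro ⟨m, hm, ha⟩
      rcases (memT1 m).1 hm with h | rfl | ⟨u, hu, rfl⟩
      · exact mem_vr.2 ⟨m, hT0T h, ha⟩
      · have : a = e := by simpa using ha
        subst this
        rcases he with rfl | rfl <;> assumption
      · rcases hgsub u a ha with rfl | rfl
        · exact hzV
        · exact hUV _ hu
    · intro ha
      obtain ⟨m, hm, ha⟩ := mem_vr.1 ha
      rcases (hsplit m).1 hm with h | ⟨u, hu, rfl⟩
      · exact ⟨m, (memT1 m).2 (Or.inl h), ha⟩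
      · have hga := (memT1 (g u)).2 (Or.inr (Or.inr ⟨u, hu, rfl⟩))
        simp only [Multiset.insert_eq_cons, Multiset.mem_cons, Multiset.mem_singleton] at ha
        rcases ha with rfl | rfl | rfl
        · exact ⟨g u, hga, hgz u⟩
        · rcases hew with rfl | hw
          · exact ⟨_, (memT1 _).2 (Or.inr (Or.inl rfl)), by simp⟩
          · obtain ⟨m, hm, h⟩ := mem_vr.1 hw
            exact ⟨m, (memT1 m).2 (Or.inl hm), h⟩
        · exact ⟨g a, hga, hgu a⟩
  · set A : Finset (Multiset ℕ) := insert {w, z} (Lst.image (fun u => {w, u})) with hA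
    set B : Finset (Multiset ℕ) := insert {e, e} (Lst.image (fun u => {u, u})) with hB
    have memA : ∀ p, p ∈ A ↔ p = {w, z} ∨ ∃ u ∈ Lst, p = {w, u} := by
      intro p; rw [hA, Finset.mem_insert, Finset.mem_image]; simp only [eq_comm]
    have memB : ∀ p, p ∈ B ↔ p = {e, e} ∨ ∃ u ∈ Lst, p = {u, u} := by
      intro p; rw [hB, Finset.mem_insert, Finset.mem_image]; simp only [eq_comm]
    have hAG : A ⊆ shd T := by
      intro p hp
      rcases (memA p).1 hp with rfl | ⟨u, hu, rfl⟩
      · rw [Multiset.pair_comm]; exact hzwG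
      · exact (shd_trip_mem ((memU u).1 (hLU hu))).2.2
    have hBG : Disjoint (shd T) B := by
      rw [Finset.disjoint_left]
      intro p hp hp'
      rcases (memB p).1 hp' with rfl | ⟨u, hu, rfl⟩
      · exact heG hp
      · exact hLG u hu hp
    have hAc : A.card = Lst.card + 1 := by
      rw [hA, Finset.card_insert_of_notMem, Finset.card_image_of_injective]
      · intro a b hab
        simpa using hab
      · intro h
        obtain ⟨u, hu, h⟩ := Finset.mem_image.1 h
        exact hUz u (hLU hu) (by simpa using h)
    have hBc : B.card = Lst.card + 1 := by
      rw [hB, Finset.card_insert_of_notMem, Finset.card_image_of_injective]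
      · intro a b hab
        rw [pair_eq] at hab
        tauto
      · intro h
        obtain ⟨u, hu, h⟩ := Finset.mem_image.1 h
        rw [pair_eq] at h
        exact heU u (hLU hu) (by tauto)
    have hzu : ∀ u ∈ U, ({z, u} : Multiset ℕ) ∈ shd T ∧ ({z, u} : Multiset ℕ) ∉ A := by
      intro u hu
      refine ⟨(shd_trip_mem ((memU u).1 hu)).2.1, fun h => ?_⟩
      have i1 := hUw u hu
      rcases (memA _).1 h with h | ⟨u', hu', h⟩
      · rw [pair_eq] at h; tauto
      · have i2 := hUz u' (hLU hu')
        rw [pair_eq] at h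
        rcases h with ⟨h, -⟩ | ⟨h, -⟩
        · exact hzw h
        · exact i2 h.symm
    have hshd : shd (T0 ∪ insert {e, e, e} (U.image g)) = (shd T \ A) ∪ B := by
      ext p
      rw [Finset.mem_union, Finset.mem_sdiff]
      constructor
      · intro hp
        obtain ⟨a, ha⟩ := mem_shd.1 hp
        rcases (memT1 _).1 ha with h | h | ⟨u, hu, h⟩
        · left
          refine ⟨mem_shd.2 ⟨a, hT0T h⟩, fun hp => ?_⟩
          rcases (memA p).1 hp with rfl | ⟨u, hu, rfl⟩
          · exact (Finset.mem_filter.1 h).2 (by simp)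
          · exact (Finset.mem_filter.1 hu).2 (mem_shd.2 ⟨a, h⟩)
        · right
          have := mem_shd_trip.1 ⟨a, h⟩
          rw [memB]; tauto
        · rcases (hgshd u p).1 ⟨a, h.symm⟩ with rfl | ⟨hu', rfl⟩ | ⟨hu', rfl⟩
          · exact Or.inl (hzu u hu)
          · exact Or.inr ((memB _).2 (Or.inr ⟨u, hu', rfl⟩))
          · have := heL u hu hu'
            exact Or.inr ((memB _).2 (Or.inl (by rw [this])))
      · rintro (⟨hp, hpA⟩ | hp)
        · obtain ⟨a, ha⟩ := mem_shd.1 hp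
          rcases (hsplit _).1 ha with h | ⟨u, hu, h⟩
          · exact mem_shd.2 ⟨a, (memT1 _).2 (Or.inl h)⟩
          · rcases mem_shd_trip.1 ⟨a, h⟩ with rfl | rfl | rfl
            · exact absurd ((memA _).2 (Or.inl (Multiset.pair_comm _ _))) hpA
            · obtain ⟨b, hb⟩ := (hgshd u _).2 (Or.inl rfl)
              exact mem_shd.2 ⟨b, (memT1 _).2 (Or.inr (Or.inr ⟨u, hu, hb.symm⟩))⟩
            · have hnL : u ∉ Lst := fun h => hpA ((memA _).2 (Or.inr ⟨u, h, rfl⟩))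
              have : ({w, u} : Multiset ℕ) ∈ shd T0 := by
                by_contra h
                exact hnL (Finset.mem_filter.2 ⟨hu, h⟩)
              exact shd_mono Finset.subset_union_left this
        · rcases (memB p).1 hp with rfl | ⟨u, hu, rfl⟩
          · exact mem_shd.2 ⟨e, (memT1 _).2 (Or.inr (Or.inl rfl))⟩
          · obtain ⟨b, hb⟩ := (hgshd u _).2 (Or.inr (Or.inl ⟨hu, rfl⟩))
            exact mem_shd.2 ⟨b, (memT1 _).2 (Or.inr (Or.inr ⟨u, hLU hu, hb.symm⟩))⟩
    rw [hshd, Finset.card_union_of_disjoint (hBG.mono_left Finset.sdiff_subset),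
      Finset.card_sdiff_of_subset hAG]
    have := Finset.card_le_card hAG
    omega
  · rw [Finset.card_union_of_disjoint, Finset.card_insert_of_notMem, Finset.card_image_of_injOn]
    · omega
    · intro a ha b hb hab
      have := hgu a
      rw [hab] at this
      rcases hgsub b a this with h | h
      · exact absurd h (hUz a ha)
      · exact h
    · intro h
      obtain ⟨u, hu, h⟩ := Finset.mem_image.1 h
      exact heg u hu h.symm
    · rw [Finset.disjoint_left]
      intro m hm hm'
      rcases Finset.mem_insert.1 hm' with rfl | h
      · exact heT (hT0T hm)
      · obtain ⟨u, hu, rfl⟩ := Finset.mem_image.1 h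
        exact hgT u hu (hT0T hm)

lemma lemC_iter {v s t : ℕ} (n : ℕ) (h : PP v s t) (hts : t + n ≤ s) : PP v s (t + n) := by
  induction n with
  | zero => exact h
  | succ n ih =>
    have h1 : t + n < s := by omega
    exact lemC (ih h1.le) h1


/-! ### Compression -/

/-- replace every `y` by `x` -/
def phi (x y : ℕ) (m : Multiset ℕ) : Multiset ℕ :=
  m.filter (fun a => a ≠ y) + Multiset.replicate (m.count y) x

lemma count_phi {x y : ℕ} (hxy : x ≠ y) (m : Multiset ℕ) (a : ℕ) :
    (phi x y m).count a = if a = y then 0 else if a = x then m.count x + m.count y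
      else m.count a := by
  unfold phi
  rw [Multiset.count_add, Multiset.count_replicate, Multiset.count_filter]
  by_cases h1 : a = y
  · subst h1; simp [hxy]
  · by_cases h2 : a = x
    · subst h2; simp [h1]
    · simp [h1, h2, Ne.symm h2]

lemma count_phi_x {x y : ℕ} (hxy : x ≠ y) (m : Multiset ℕ) :
    (phi x y m).count x = m.count x + m.count y := by
  rw [count_phi hxy]; simp [hxy]

lemma phi_ext {x y : ℕ} (hxy : x ≠ y) {m m' : Multiset ℕ} (h : phi x y m = phi x y m')
    (hc : m.count y = m'.count y) : m = m' := by
  ext a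
  have h1 := congrArg (Multiset.count a) h
  rw [count_phi hxy, count_phi hxy] at h1
  by_cases h2 : a = y
  · subst h2; exact hc
  · by_cases h3 : a = x
    · subst h3; simp only [hxy, if_false, if_true] at h1; omega
    · simpa [h2, h3] using h1

lemma phi_exists {x y : ℕ} (hxy : x ≠ y) (m : Multiset ℕ) {i : ℕ}
    (hi : i ≤ m.count x + m.count y) : ∃ m', phi x y m' = phi x y m ∧ m'.count y = i := by
  refine ⟨phi x y m - Multiset.replicate i x + Multiset.replicate i y, ?_, ?_⟩
  · ext a
    rw [count_phi hxy]
    simp only [Multiset.count_add, Multiset.count_sub, Multiset.count_replicate, count_phi hxy]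
    by_cases h1 : a = y
    · subst h1; simp
    · by_cases h2 : a = x
      · subst h2; simp [h1, Ne.symm h1]; omega
      · simp [h1, h2, Ne.symm h1, Ne.symm h2]
  · simp [Multiset.count_add, Multiset.count_sub, Multiset.count_replicate, count_phi hxy, hxy]

lemma phi_cons {x y : ℕ} (hxy : x ≠ y) (m : Multiset ℕ) (a : ℕ) :
    phi x y (a ::ₘ m) = (if a = y then x else a) ::ₘ phi x y m := by
  ext b
  simp only [count_phi hxy, Multiset.count_cons]
  by_cases h1 : a = y
  · subst h1
    by_cases h2 : b = a
    · subst h2; simp [hxy.symm]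
    · by_cases h3 : b = x
      · subst h3; simp [h2, Ne.symm h2]; omega
      · simp [h2, h3]
  · by_cases h2 : b = y
    · subst h2; simp [h1, Ne.symm h1]
    · by_cases h3 : b = x
      · subst h3; simp [h1, h2, Ne.symm h1]; omega
      · simp [h1, h2, h3]

/-- the set of heights of the fibre over `K` -/
def hts (x y : ℕ) (S : Finset (Multiset ℕ)) (K : Multiset ℕ) : Finset ℕ :=
  (S.filter fun m => phi x y m = K).image (Multiset.count y)

lemma mem_hts {x y : ℕ} {S : Finset (Multiset ℕ)} {K : Multiset ℕ} {i : ℕ} :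
    i ∈ hts x y S K ↔ ∃ m ∈ S, phi x y m = K ∧ m.count y = i := by
  simp [hts, and_assoc]

lemma hts_le {x y : ℕ} (hxy : x ≠ y) {S : Finset (Multiset ℕ)} {K : Multiset ℕ} {i : ℕ}
    (hi : i ∈ hts x y S K) : i < K.count x + 1 := by
  obtain ⟨m, -, rfl, rfl⟩ := mem_hts.1 hi
  rw [count_phi_x hxy]; omega

lemma hts_card_le {x y : ℕ} (hxy : x ≠ y) (S : Finset (Multiset ℕ)) (K : Multiset ℕ) :
    (hts x y S K).card ≤ K.count x + 1 := by
  have : hts x y S K ⊆ Finset.range (K.count x + 1) := fun i hi =>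
    Finset.mem_range.2 (hts_le hxy hi)
  simpa using Finset.card_le_card this

lemma injOn_fiber {x y : ℕ} (hxy : x ≠ y) (S : Finset (Multiset ℕ)) (K : Multiset ℕ) :
    Set.InjOn (Multiset.count y) (S.filter fun m => phi x y m = K : Finset (Multiset ℕ)) := by
  intro m hm m' hm' h
  exact phi_ext hxy ((Finset.mem_filter.1 hm).2.trans (Finset.mem_filter.1 hm').2.symm) h

lemma hts_card {x y : ℕ} (hxy : x ≠ y) (S : Finset (Multiset ℕ)) (K : Multiset ℕ) :
    (hts x y S K).card = (S.filter fun m => phi x y m = K).card :=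
  Finset.card_image_of_injOn (injOn_fiber hxy S K)

lemma sum_fiber {x y : ℕ} (hxy : x ≠ y) (S : Finset (Multiset ℕ)) (K : Multiset ℕ) :
    ∑ m ∈ S.filter (fun m => phi x y m = K), m.count y = ∑ i ∈ hts x y S K, i := by
  unfold hts
  rw [Finset.sum_image (injOn_fiber hxy S K)]

lemma exists_compr {x y : ℕ} (hxy : x ≠ y) (S : Finset (Multiset ℕ)) :
    ∃ C : Finset (Multiset ℕ), ∀ m, m ∈ C ↔ m.count y < (hts x y S (phi x y m)).card := by
  have hfin : {m : Multiset ℕ | m.count y < (hts x y S (phi x y m)).card}.Finite := by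
    have : ((S.image (phi x y) ×ˢ Finset.range (S.card + 1) : Finset _) : Set (Multiset ℕ × ℕ)).Finite :=
      Finset.finite_toSet _
    refine Set.Finite.of_injOn (f := fun m => (phi x y m, m.count y)) ?_ ?_ this
    · intro m hm
      have hm' : m.count y < (hts x y S (phi x y m)).card := hm
      have h1 : 0 < (hts x y S (phi x y m)).card := by omega
      obtain ⟨i, hi⟩ := Finset.card_pos.1 h1
      obtain ⟨m', h2, h3, -⟩ := mem_hts.1 hi
      have h4 : (hts x y S (phi x y m)).card ≤ S.card := by
        rw [hts_card hxy]; exact Finset.card_filter_le _ _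
      simp only [Finset.coe_product, Set.mem_prod, Finset.mem_coe, Finset.mem_image,
        Finset.mem_range]
      exact ⟨⟨m', h2, h3⟩, by omega⟩
    · intro m _ m' _ h
      simp only [Prod.mk.injEq] at h
      exact phi_ext hxy h.1 h.2
  exact ⟨hfin.toFinset, fun m => by simp⟩

lemma compr_hts {x y : ℕ} (hxy : x ≠ y) {S C : Finset (Multiset ℕ)}
    (hC : ∀ m, m ∈ C ↔ m.count y < (hts x y S (phi x y m)).card) (K : Multiset ℕ) :
    hts x y C K = Finset.range (hts x y S K).card := by
  ext i
  rw [mem_hts, Finset.mem_range]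
  constructor
  · rintro ⟨m, hm, rfl, rfl⟩
    exact (hC m).1 hm
  · intro hi
    obtain ⟨j, hj⟩ := Finset.card_pos.1 (by omega : 0 < (hts x y S K).card)
    obtain ⟨m, -, rfl, -⟩ := mem_hts.1 hj
    have h1 := hts_card_le hxy S (phi x y m)
    rw [count_phi_x hxy] at h1
    obtain ⟨m', h2, h3⟩ := phi_exists hxy m (i := i) (by omega)
    exact ⟨m', (hC m').2 (by rw [h2, h3]; exact hi), h2, h3⟩

lemma compr_maps {x y : ℕ} {S C : Finset (Multiset ℕ)}
    (hC : ∀ m, m ∈ C ↔ m.count y < (hts x y S (phi x y m)).card) :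
    ∀ m ∈ C, phi x y m ∈ S.image (phi x y) := by
  intro m hm
  have h := (hC m).1 hm
  obtain ⟨j, hj⟩ := Finset.card_pos.1 (by omega : 0 < (hts x y S (phi x y m)).card)
  obtain ⟨m', h1, h2, -⟩ := mem_hts.1 hj
  exact Finset.mem_image.2 ⟨m', h1, h2⟩

lemma compr_fiber_card {x y : ℕ} (hxy : x ≠ y) {S C : Finset (Multiset ℕ)}
    (hC : ∀ m, m ∈ C ↔ m.count y < (hts x y S (phi x y m)).card) (K : Multiset ℕ) :
    (C.filter fun m => phi x y m = K).card = (S.filter fun m => phi x y m = K).card := by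
  rw [← hts_card hxy, ← hts_card hxy, compr_hts hxy hC, Finset.card_range]

lemma compr_card {x y : ℕ} (hxy : x ≠ y) {S C : Finset (Multiset ℕ)}
    (hC : ∀ m, m ∈ C ↔ m.count y < (hts x y S (phi x y m)).card) : C.card = S.card := by
  rw [Finset.card_eq_sum_card_fiberwise (compr_maps hC),
    Finset.card_eq_sum_card_fiberwise (s := S) (t := S.image (phi x y)) (f := phi x y)
      (fun m hm => Finset.mem_coe.2 (Finset.mem_image_of_mem _ hm))]
  exact Finset.sum_congr rfl fun K _ => compr_fiber_card hxy hC K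

lemma sum_range_le_sum (F : Finset ℕ) : ∑ i ∈ Finset.range F.card, i ≤ ∑ i ∈ F, i ∧
    (F ≠ Finset.range F.card → ∑ i ∈ Finset.range F.card, i < ∑ i ∈ F, i) := by
  set R := Finset.range F.card with hR
  have hRc : R.card = F.card := by simp [hR]
  have e1 := Finset.sum_inter_add_sum_sdiff F R (fun i => i)
  have e2 := Finset.sum_inter_add_sum_sdiff R F (fun i => i)
  rw [Finset.inter_comm] at e2
  have c1 := Finset.card_inter_add_card_sdiff F R
  have c2 := Finset.card_inter_add_card_sdiff R F
  rw [Finset.inter_comm] at c2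
  have hc : (F \ R).card = (R \ F).card := by omega
  have b1 : (F \ R).card • F.card ≤ ∑ i ∈ F \ R, i := by
    apply Finset.card_nsmul_le_sum
    intro i hi
    have := (Finset.mem_sdiff.1 hi).2
    simpa [hR] using this
  have b2 : ∑ i ∈ R \ F, i ≤ (R \ F).card • (F.card - 1) := by
    apply Finset.sum_le_card_nsmul
    intro i hi
    have := (Finset.mem_sdiff.1 hi).1
    have : i < F.card := by simpa [hR] using this
    omega
  simp only [smul_eq_mul] at b1 b2
  rw [hc] at b1
  have b3 : (R \ F).card * (F.card - 1) ≤ (R \ F).card * F.card :=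
    Nat.mul_le_mul_left _ (by omega)
  refine ⟨by omega, fun hne => ?_⟩
  have hpos : 0 < (R \ F).card := by
    rw [Finset.card_pos]
    by_contra h
    rw [Finset.not_nonempty_iff_eq_empty, Finset.sdiff_eq_empty_iff_subset] at h
    exact hne (Finset.eq_of_subset_of_card_le h hRc.ge).symm
  have hFpos : 0 < F.card := by
    have := Finset.card_le_card (Finset.sdiff_subset : R \ F ⊆ R)
    omega
  have b4 : (R \ F).card * (F.card - 1) < (R \ F).card * F.card :=
    Nat.mul_lt_mul_of_pos_left (by omega) hpos
  omega

lemma compr_sum {x y : ℕ} (hxy : x ≠ y) {S C : Finset (Multiset ℕ)}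
    (hC : ∀ m, m ∈ C ↔ m.count y < (hts x y S (phi x y m)).card) (hne : C ≠ S) :
    ∑ m ∈ S, m.count x < ∑ m ∈ C, m.count x := by
  have hS : ∀ m ∈ S, phi x y m ∈ S.image (phi x y) := fun m hm => Finset.mem_image_of_mem _ hm
  have e : ∀ h : Multiset ℕ → ℕ, ∑ m ∈ C, h (phi x y m) = ∑ m ∈ S, h (phi x y m) := by
    intro h
    rw [← Finset.sum_fiberwise_of_maps_to (compr_maps hC), ← Finset.sum_fiberwise_of_maps_to hS]
    refine Finset.sum_congr rfl fun K _ => ?_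
    have : ∀ A : Finset (Multiset ℕ), ∑ m ∈ A.filter (fun m => phi x y m = K), h (phi x y m) =
        (A.filter (fun m => phi x y m = K)).card * h K := by
      intro A
      rw [Finset.sum_congr rfl (g := fun _ => h K)]
      · simp
      · intro m hm
        rw [(Finset.mem_filter.1 hm).2]
    rw [this, this, compr_fiber_card hxy hC]
  have e1 := e (Multiset.count x)
  simp only [count_phi_x hxy, Finset.sum_add_distrib] at e1
  have hlt : ∑ m ∈ C, m.count y < ∑ m ∈ S, m.count y := by
    rw [← Finset.sum_fiberwise_of_maps_to (compr_maps hC), ← Finset.sum_fiberwise_of_maps_to hS]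
    simp only [sum_fiber hxy, compr_hts hxy hC]
    apply Finset.sum_lt_sum
    · intro K _
      exact (sum_range_le_sum _).1
    · by_contra hcon
      push Not at hcon
      apply hne
      have hall : ∀ K ∈ S.image (phi x y), hts x y S K = Finset.range (hts x y S K).card := by
        intro K hK
        by_contra h
        exact absurd ((sum_range_le_sum _).2 h) (not_lt.2 (hcon K hK))
      symm
      apply Finset.eq_of_subset_of_card_le
      · intro m hm
        rw [hC, ← Finset.mem_range, ← hall _ (hS m hm)]
        exact mem_hts.2 ⟨m, hm, rfl, rfl⟩
      · exact (compr_card hxy hC).le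
  omega

lemma lt_card_aux {F F' : Finset ℕ} {k c : ℕ} (h1 : ∀ i ∈ F, i < k + 1)
    (h2 : ∀ i ∈ F, i < k → i ∈ F') (h3 : ∀ i, i + 1 ∈ F → i ∈ F') (hc : c < F.card) (hk : c < k) :
    c < F'.card := by
  by_contra hcon
  have hs1 : F.erase k ⊆ F' := by
    intro i hi
    have := Finset.mem_erase.1 hi
    have := h1 i this.2
    exact h2 i (by tauto) (by omega)
  have hkF : k ∈ F := by
    by_contra h
    rw [Finset.erase_eq_of_notMem h] at hs1
    have := Finset.card_le_card hs1
    omega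
  have he : F.erase k = F' := by
    apply Finset.eq_of_subset_of_card_le hs1
    rw [Finset.card_erase_of_mem hkF]
    omega
  have hdown : ∀ j, j ≤ k → k - j ∈ F := by
    intro j
    induction j with
    | zero => intro _; simpa using hkF
    | succ j ih =>
      intro hj
      have := ih (by omega)
      have h4 : k - (j + 1) + 1 ∈ F := by
        rwa [show k - (j + 1) + 1 = k - j by omega]
      have := h3 _ h4
      rw [← he] at this
      exact Finset.mem_of_mem_erase this
  have hsub : Finset.range k ⊆ F' := by
    intro i hi
    have hi := Finset.mem_range.1 hi
    have := hdown (k - i) (by omega)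
    rw [show k - (k - i) = i by omega] at this
    exact h2 i this hi
  have := Finset.card_le_card hsub
  rw [Finset.card_range] at this
  omega

lemma compr_shd {x y : ℕ} (hxy : x ≠ y) {T C G : Finset (Multiset ℕ)}
    (hC : ∀ m, m ∈ C ↔ m.count y < (hts x y T (phi x y m)).card)
    (hG : ∀ m, m ∈ G ↔ m.count y < (hts x y (shd T) (phi x y m)).card) :
    shd C ⊆ G := by
  intro p hp
  obtain ⟨a, ha⟩ := mem_shd.1 hp
  rw [hC] at ha
  rw [hG]
  rw [phi_cons hxy] at ha
  by_cases hax : a = x ∨ a = y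
  · have hax' : (if a = y then x else a) = x := by
      rcases hax with rfl | rfl <;> simp
    rw [hax'] at ha
    have hk := count_phi_x hxy p
    have H3 : ∀ i, i + 1 ∈ hts x y T (x ::ₘ phi x y p) → i ∈ hts x y (shd T) (phi x y p) := by
      intro i hi
      obtain ⟨m, hm, h1, h2⟩ := mem_hts.1 hi
      have hy : y ∈ m := Multiset.count_pos.1 (by omega)
      obtain ⟨q, rfl⟩ := Multiset.exists_cons_of_mem hy
      rw [phi_cons hxy, if_pos rfl, Multiset.cons_inj_right] at h1
      rw [Multiset.count_cons_self] at h2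
      exact mem_hts.2 ⟨q, mem_shd.2 ⟨y, hm⟩, h1, by omega⟩
    have H2 : ∀ i ∈ hts x y T (x ::ₘ phi x y p), i < (phi x y p).count x + 1 →
        i ∈ hts x y (shd T) (phi x y p) := by
      intro i hi hik
      obtain ⟨m, hm, h1, h2⟩ := mem_hts.1 hi
      have h3 := count_phi_x hxy m
      rw [h1, Multiset.count_cons_self] at h3
      have hx : x ∈ m := Multiset.count_pos.1 (by omega)
      obtain ⟨q, rfl⟩ := Multiset.exists_cons_of_mem hx
      rw [phi_cons hxy, if_neg hxy, Multiset.cons_inj_right] at h1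
      rw [Multiset.count_cons_of_ne hxy.symm] at h2
      exact mem_hts.2 ⟨q, mem_shd.2 ⟨x, hm⟩, h1, h2⟩
    have H1 : ∀ i ∈ hts x y T (x ::ₘ phi x y p), i < (phi x y p).count x + 1 + 1 := by
      intro i hi
      have := hts_le hxy hi
      rwa [Multiset.count_cons_self] at this
    refine lt_card_aux H1 H2 H3 ?_ (by omega)
    have : p.count y ≤ (a ::ₘ p).count y := Multiset.count_le_count_cons _ _ _
    omega
  · push Not at hax
    rw [if_neg hax.2, Multiset.count_cons_of_ne hax.2.symm] at ha
    refine lt_of_lt_of_le ha (Finset.card_le_card ?_)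
    intro i hi
    obtain ⟨m, hm, h1, h2⟩ := mem_hts.1 hi
    have h3 := congrArg (Multiset.count a) h1
    rw [count_phi hxy, if_neg hax.2, if_neg hax.1, Multiset.count_cons_self] at h3
    have hx : a ∈ m := Multiset.count_pos.1 (by omega)
    obtain ⟨q, rfl⟩ := Multiset.exists_cons_of_mem hx
    rw [phi_cons hxy, if_neg hax.2, Multiset.cons_inj_right] at h1
    rw [Multiset.count_cons_of_ne hax.2.symm] at h2
    exact mem_hts.2 ⟨q, mem_shd.2 ⟨a, hm⟩, h1, h2⟩

lemma card_phi {x y : ℕ} (m : Multiset ℕ) : (phi x y m).card = m.card := by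
  unfold phi
  rw [Multiset.card_add, Multiset.card_replicate]
  have h := congrArg Multiset.card (Multiset.filter_add_not (fun a => a ≠ y) m)
  rw [Multiset.card_add] at h
  have h2 : (m.filter (fun a => ¬ a ≠ y)).card = m.count y := by
    rw [Multiset.count_eq_card_filter_eq]
    congr 2
    ext a
    rw [not_not, eq_comm]
  omega

/-- `T` is stable towards `x` -/
def Stb (x : ℕ) (T : Finset (Multiset ℕ)) : Prop := ∀ y p, y ::ₘ p ∈ T → x ::ₘ p ∈ T

lemma compr_step {x : ℕ} {T : Finset (Multiset ℕ)} (hT : Tri T) (hx : x ∈ vr T)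
    (hns : ¬ Stb x T) : ∃ C, Tri C ∧ x ∈ vr C ∧ C.card = T.card ∧ (shd C).card ≤ (shd T).card ∧
      (vr T).card ≤ (vr C).card + 1 ∧ ∑ m ∈ T, m.count x < ∑ m ∈ C, m.count x := by
  unfold Stb at hns
  push Not at hns
  obtain ⟨y, p, h1, h2⟩ := hns
  have hxy : x ≠ y := by rintro rfl; exact h2 h1
  obtain ⟨C, hC⟩ := exists_compr hxy T
  obtain ⟨G, hG⟩ := exists_compr hxy (shd T)
  have hne : C ≠ T := by
    rintro rfl
    apply h2
    rw [hC] at h1 ⊢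
    rw [phi_cons hxy, if_pos rfl, Multiset.count_cons_self] at h1
    rw [phi_cons hxy, if_neg hxy, Multiset.count_cons_of_ne hxy.symm]
    omega
  have hsub : (vr T).erase y ⊆ vr C := by
    intro a ha
    obtain ⟨hay, ha⟩ := Finset.mem_erase.1 ha
    obtain ⟨m, hm, ham⟩ := mem_vr.1 ha
    have h0 : 0 < (hts x y T (phi x y m)).card :=
      Finset.card_pos.2 ⟨_, mem_hts.2 ⟨m, hm, rfl, rfl⟩⟩
    obtain ⟨m', hm', hc⟩ := phi_exists hxy m (i := 0) (by omega)
    refine mem_vr.2 ⟨m', (hC m').2 (by rw [hm', hc]; exact h0), ?_⟩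
    have h3 := congrArg (Multiset.count a) hm'
    rw [count_phi hxy, count_phi hxy, if_neg hay, if_neg hay] at h3
    have h4 := Multiset.count_pos.2 ham
    apply Multiset.count_pos.1
    by_cases hax : a = x
    · subst hax
      simp only [if_true] at h3
      omega
    · simp only [hax, if_false] at h3
      omega
  refine ⟨C, ?_, hsub (Finset.mem_erase.2 ⟨hxy, hx⟩), compr_card hxy hC, ?_, ?_,
    compr_sum hxy hC hne⟩
  · intro m hm
    obtain ⟨m', hm', he⟩ := Finset.mem_image.1 (compr_maps hC m hm)
    rw [← card_phi (x := x) (y := y) m, ← he, card_phi]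
    exact hT m' hm'
  · rw [← compr_card hxy hG]
    exact Finset.card_le_card (compr_shd hxy hC hG)
  · have h5 := Finset.card_le_card hsub
    have h6 := Finset.pred_card_le_card_erase (s := vr T) (a := y)
    omega

lemma stab {T : Finset (Multiset ℕ)} (hT : Tri T) {n : ℕ} (hn : n + 1 ≤ (vr T).card) :
    ∃ C, Tri C ∧ C.card = T.card ∧ (shd C).card ≤ (shd T).card ∧
      ((vr C).card = n ∨ (n + 1 ≤ (vr C).card ∧ ∃ x, Stb x C)) := by
  obtain ⟨x, hx⟩ := Finset.card_pos.1 (by omega : 0 < (vr T).card)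
  induction hd : 3 * T.card - ∑ m ∈ T, m.count x using Nat.strong_induction_on generalizing T with
  | _ d ih =>
  by_cases hs : Stb x T
  · exact ⟨T, hT, rfl, le_rfl, Or.inr ⟨hn, x, hs⟩⟩
  · obtain ⟨C, h1, h2, h3, h4, h5, h6⟩ := compr_step hT hx hs
    by_cases hv : (vr C).card = n
    · exact ⟨C, h1, h3, h4, Or.inl hv⟩
    · have hb : ∑ m ∈ C, m.count x ≤ C.card • 3 := by
        apply Finset.sum_le_card_nsmul
        intro m hm
        rw [← h1 m hm]
        exact Multiset.count_le_card _ _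
      rw [smul_eq_mul] at hb
      obtain ⟨D, i1, i2, i3, i4⟩ := ih (3 * C.card - ∑ m ∈ C, m.count x) (by omega) h1
        (by omega) h2 rfl
      exact ⟨D, i1, i2.trans h3, i3.trans h4, i4⟩


/-- a family of triples whose shadow lies in a set of `q` pairs over `n` variables -/
def RR (n q t : ℕ) : Prop :=
  ∃ (W : Finset ℕ) (H T : Finset (Multiset ℕ)), W.card = n ∧ H.card = q ∧
    (∀ p ∈ H, p.card = 2 ∧ ∀ a ∈ p, a ∈ W) ∧ Tri T ∧ shd T ⊆ H ∧ t ≤ T.card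

lemma RR_of_small {T : Finset (Multiset ℕ)} (hT : Tri T) {n q : ℕ} (hn : (vr T).card ≤ n)
    (hq : (shd T).card ≤ q) (hqn : q ≤ (n + 1).choose 2) : RR n q T.card := by
  obtain ⟨W, hW, hWc⟩ := Infinite.exists_superset_card_eq (vr T) n hn
  obtain ⟨H, h1, h2, h3⟩ := Finset.exists_subsuperset_card_eq
    (s := shd T) (t := (W.sym 2).image (fun q : Sym ℕ 2 => (q : Multiset ℕ))) (n := q)
    ((shd_le_sym hT).trans (Finset.image_subset_image (Finset.sym_mono hW 2))) hq
    (by rw [sym_image_card, hWc]; exact hqn)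
  refine ⟨W, H, T, hWc, h3, ?_, hT, h1, le_rfl⟩
  intro p hp
  obtain ⟨s, hs, rfl⟩ := Finset.mem_image.1 (h2 hp)
  rw [Finset.mem_sym_iff] at hs
  exact ⟨Sym.card_coe, fun a ha => hs a ha⟩

/-- the cone construction -/
lemma cone {n q t : ℕ} (h : RR n q t) : ∃ t1, t + (q + (n + 1)) ≤ t1 ∧
    PP (n + 1) (q + (n + 1)) t1 := by
  classical
  obtain ⟨W, H, T, rfl, rfl, hH, hT, hTH, ht⟩ := h
  obtain ⟨N, hN⟩ := Infinite.exists_notMem_finset W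
  set A : Finset (Multiset ℕ) := (insert N W).image (fun a => {N, a}) with hA
  have memA : ∀ p, p ∈ A ↔ ∃ a, (a = N ∨ a ∈ W) ∧ p = {N, a} := by
    intro p
    simp only [hA, Finset.mem_image, Finset.mem_insert, eq_comm]
  have hNH : ∀ p ∈ H, N ∉ p := fun p hp h => hN ((hH p hp).2 N h)
  have hdisj : Disjoint H A := by
    rw [Finset.disjoint_left]
    intro p hp hp'
    obtain ⟨a, -, rfl⟩ := (memA p).1 hp'
    exact hNH _ hp (by simp)
  have hAc : A.card = W.card + 1 := by
    rw [hA, Finset.card_image_of_injective, Finset.card_insert_of_notMem hN]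
    intro a b hab
    simpa using hab
  have hc : (H ∪ A).card = H.card + (W.card + 1) := by
    rw [Finset.card_union_of_disjoint hdisj, hAc]
  have hNT : ∀ m ∈ T, N ∉ m := by
    intro m hm hNm
    obtain ⟨q, rfl⟩ := Multiset.exists_cons_of_mem hNm
    have h3 := hT _ hm
    rw [Multiset.card_cons] at h3
    obtain ⟨a, b, rfl⟩ := Multiset.card_eq_two.1 (by omega : q.card = 2)
    have := hTH (shd_trip_mem hm).1
    exact hNH _ this (by simp)
  have hcard2 : ∀ p ∈ H ∪ A, p.card = 2 := by
    intro p hp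
    rcases Finset.mem_union.1 hp with h | h
    · exact (hH p h).1
    · obtain ⟨a, -, rfl⟩ := (memA p).1 h
      simp
  have hmemW : ∀ p ∈ H ∪ A, ∀ a ∈ p, a = N ∨ a ∈ W := by
    intro p hp a ha
    rcases Finset.mem_union.1 hp with h | h
    · exact Or.inr ((hH p h).2 a ha)
    · obtain ⟨b, hb, rfl⟩ := (memA p).1 h
      simp at ha
      rcases ha with rfl | rfl
      · exact Or.inl rfl
      · exact hb
  set C : Finset (Multiset ℕ) := T ∪ (H ∪ A).image (fun p => N ::ₘ p) with hCd
  have memC : ∀ m, m ∈ C ↔ m ∈ T ∨ ∃ p ∈ H ∪ A, m = N ::ₘ p := by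
    intro m
    simp only [hCd, Finset.mem_union (s := T), Finset.mem_image, eq_comm]
  have hC : Tri C := by
    intro m hm
    rcases (memC m).1 hm with h | ⟨p, hp, rfl⟩
    · exact hT m h
    · rw [Multiset.card_cons, hcard2 p hp]
  have hCc : C.card = T.card + (H.card + (W.card + 1)) := by
    rw [hCd, Finset.card_union_of_disjoint, Finset.card_image_of_injective, hc]
    · intro a b hab
      simpa using hab
    · rw [Finset.disjoint_left]
      intro m hm hm'
      obtain ⟨p, -, rfl⟩ := Finset.mem_image.1 hm'
      exact hNT _ hm (by simp)
  have hshd : shd C = H ∪ A := by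
    ext p
    constructor
    · intro hp
      obtain ⟨a, ha⟩ := mem_shd.1 hp
      rcases (memC _).1 ha with h | ⟨q, hq, h⟩
      · exact Finset.mem_union_left _ (hTH (mem_shd.2 ⟨a, h⟩))
      · obtain ⟨b, c, rfl⟩ := Multiset.card_eq_two.1 (hcard2 q hq)
        have hb := hmemW _ hq b (by simp)
        have hc := hmemW _ hq c (by simp)
        rcases mem_shd_trip.1 ⟨a, h⟩ with rfl | rfl | rfl
        · exact Finset.mem_union_right _ ((memA _).2 ⟨b, hb, rfl⟩)
        · exact Finset.mem_union_right _ ((memA _).2 ⟨c, hc, rfl⟩)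
        · exact hq
    · intro hp
      exact mem_shd.2 ⟨N, (memC _).2 (Or.inr ⟨p, hp, rfl⟩)⟩
  have hvr : vr C = insert N W := by
    ext a
    rw [vr_iff hC, hshd, Finset.mem_insert]
    constructor
    · rintro ⟨b, hb⟩
      exact hmemW _ hb a (by simp)
    · intro h
      refine ⟨N, Finset.mem_union_right _ ((memA _).2 ⟨a, h, Multiset.pair_comm _ _⟩)⟩
  refine ⟨C.card, by omega, C, hC, ?_, ?_, rfl⟩
  · rw [hvr, Finset.card_insert_of_notMem hN]
  · rw [hshd, hc]

lemma stb_finish {T : Finset (Multiset ℕ)} (hT : Tri T) {x : ℕ} (hs : Stb x T) :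
    ∃ T', Tri T' ∧ (shd T').card + (vr T).card ≤ (shd T).card ∧
      T.card ≤ (shd T).card + T'.card := by
  set T' := T.filter (fun m => x ∉ m) with hT'
  have hsub : T' ⊆ T := Finset.filter_subset _ _
  refine ⟨T', tri_sub hT hsub, ?_, ?_⟩
  · have h1 : Disjoint (shd T') ((vr T).image (fun a => ({x, a} : Multiset ℕ))) := by
      rw [Finset.disjoint_left]
      intro p hp hp'
      obtain ⟨a, -, rfl⟩ := Finset.mem_image.1 hp'
      obtain ⟨b, hb⟩ := mem_shd.1 hp
      exact (Finset.mem_filter.1 hb).2 (by simp)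
    have h2 : shd T' ∪ (vr T).image (fun a => ({x, a} : Multiset ℕ)) ⊆ shd T := by
      apply Finset.union_subset (shd_mono hsub)
      intro p hp
      obtain ⟨a, ha, rfl⟩ := Finset.mem_image.1 hp
      obtain ⟨m, hm, ham⟩ := mem_vr.1 ha
      obtain ⟨q, rfl⟩ := Multiset.exists_cons_of_mem ham
      have h3 := hT _ hm
      rw [Multiset.card_cons] at h3
      obtain ⟨b, c, rfl⟩ := Multiset.card_eq_two.1 (by omega : q.card = 2)
      have h4 : b ::ₘ {a, c} ∈ T := by
        rw [Multiset.insert_eq_cons, Multiset.cons_swap]; exact hm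
      exact (shd_trip_mem (hs b _ h4)).1
    have h3 := Finset.card_le_card h2
    rw [Finset.card_union_of_disjoint h1, Finset.card_image_of_injective] at h3
    · exact h3
    · intro a b hab
      simpa using hab
  · have h1 : (T.filter (fun m => x ∈ m)).card + T'.card = T.card := by
      rw [hT']
      convert Finset.card_filter_add_card_filter_not (s := T) (fun m => x ∈ m)
    have h2 : (T.filter (fun m => x ∈ m)).card ≤ (shd T).card := by
      refine Finset.card_le_card_of_injOn (fun m => m.erase x) ?_ ?_
      · intro m hm
        obtain ⟨hm, hx⟩ := Finset.mem_filter.1 hm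
        exact mem_shd.2 ⟨x, by rwa [Multiset.cons_erase hx]⟩
      · intro m hm m' hm' h
        rw [← Multiset.cons_erase (Finset.mem_filter.1 hm).2,
          ← Multiset.cons_erase (Finset.mem_filter.1 hm').2]
        simp only at h
        rw [h]
    omega

lemma choose_two_succ (n : ℕ) : (n + 1 + 1).choose 2 = (n + 1).choose 2 + (n + 1) := by
  rw [Nat.choose_succ_succ' (n + 1) 1, Nat.choose_one_right, add_comm]

/-- Kruskal–Katona type statement -/
lemma kk (n : ℕ) : ∀ {T : Finset (Multiset ℕ)}, Tri T → ∀ {q : ℕ}, (shd T).card ≤ q →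
    q ≤ (n + 1).choose 2 → RR n q T.card := by
  induction n with
  | zero =>
    intro T hT q h1 h2
    have := vr_le_shd hT
    exact RR_of_small hT (by simp at h2; omega) h1 h2
  | succ n ih =>
    intro T hT q h1 h2
    by_cases hv : (vr T).card ≤ n + 1
    · exact RR_of_small hT hv h1 h2
    obtain ⟨C, hC, hc, hs, h⟩ := stab hT (n := n + 1) (by omega)
    rw [← hc]
    rcases h with h | ⟨h, x, hx⟩
    · exact RR_of_small hC h.le (hs.trans h1) h2
    · obtain ⟨T', a, b, c⟩ := stb_finish hC hx
      rw [choose_two_succ] at h2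
      obtain ⟨t1, ht1, D, hD, e1, e2, e3⟩ := cone (ih a (q := q - (n + 1)) (by omega) (by omega))
      exact ⟨vr D, shd D, D, e1, by omega, fun p hp => ⟨shd_card hD hp, fun a ha => shd_sub hp ha⟩,
        hD, subset_rfl, by omega⟩

lemma lemD {v s t : ℕ} (h : PP (v + 1) s t) (hs : s ≤ (v + 1).choose 2) :
    ∃ t1, t ≤ t1 ∧ PP v s t1 := by
  obtain ⟨T, hT, hv, rfl, rfl⟩ := h
  have hle := vr_le_shd hT
  obtain ⟨C, hC, hc, hsc, h⟩ := stab hT (n := v) (by omega)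
  rcases h with h | ⟨h, x, hx⟩
  · have := lemA_iter ⟨C, hC, h, rfl, rfl⟩ ((shd T).card - (shd C).card) (by omega)
    rw [Nat.add_sub_cancel' hsc] at this
    exact ⟨_, by omega, this⟩
  · cases v with
    | zero =>
      have h0 : (0 + 1).choose 2 = 0 := rfl
      omega
    | succ n =>
      obtain ⟨T', a, b, c⟩ := stb_finish hC hx
      rw [choose_two_succ] at hs
      obtain ⟨t1, ht1, h⟩ := cone (kk n a (q := (shd T).card - (n + 1)) (by omega) (by omega))
      rw [Nat.sub_add_cancel (by omega)] at ht1 h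
      exact ⟨t1, by omega, h⟩

lemma lemD_iter {v s t : ℕ} (n : ℕ) (h : PP (v + n) s t) (hs : s ≤ (v + 1).choose 2) :
    ∃ t1, t ≤ t1 ∧ PP v s t1 := by
  induction n generalizing t with
  | zero => exact ⟨t, le_rfl, h⟩
  | succ n ih =>
    have h1 : s ≤ (v + n + 1).choose 2 := hs.trans (Nat.choose_le_choose 2 (by omega))
    obtain ⟨t1, a, b⟩ := lemD h h1
    obtain ⟨t2, c, d⟩ := ih b
    exact ⟨t2, a.trans c, d⟩

lemma PP_le {v s t : ℕ} (h : PP v s t) : v ≤ s ∧ s ≤ (v + 1).choose 2 := by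
  obtain ⟨T, hT, rfl, rfl, rfl⟩ := h
  exact ⟨vr_le_shd hT, shd_card_le hT⟩

lemma QQ_up {v s t : ℕ} (h : QQ v s t) (hts : t ≤ s) : PP v s t := by
  obtain ⟨T, hT, h1, h2, h3⟩ := h
  have := lemC_iter (t - T.card) ⟨T, hT, h1, h2, rfl⟩ (by omega)
  rwa [Nat.add_sub_cancel' h3] at this

lemma PP_i {v' v v'' s t : ℕ} (h1 : v' ≤ v) (h2 : v ≤ v'') (a : PP v' s t) (b : PP v'' s t) :
    PP v s t := by
  have ha := PP_le a
  have hb := PP_le b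
  by_cases hts : t ≤ s
  · obtain ⟨T, hT, rfl, rfl, rfl⟩ := a
    exact QQ_up (lemU hT h1 (h2.trans hb.1)) hts
  · have hs : s ≤ (v + 1).choose 2 := ha.2.trans (Nat.choose_le_choose 2 (by omega))
    obtain ⟨t1, c, d⟩ := lemD_iter (v := v) (v'' - v) (by rwa [Nat.add_sub_cancel' h2]) hs
    exact lemDown_iter (t1 - t) (by rwa [Nat.add_sub_cancel' c]) (by omega)

lemma PP_ii {v s' s s'' t : ℕ} (h1 : s' ≤ s) (h2 : s ≤ s'') (a : PP v s' t) (b : PP v s'' t) :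
    PP v s t := by
  have ha := PP_le a
  have hb := PP_le b
  by_cases hts : t ≤ s
  · obtain ⟨T, hT, rfl, rfl, rfl⟩ := b
    exact QQ_up (lemL hT (ha.1.trans h1) h2) hts
  · have := lemA_iter a (s - s') (by omega)
    rw [Nat.add_sub_cancel' h1] at this
    exact lemDown_iter (s - s') this (by omega)

lemma PP_iii {v s t' t t'' : ℕ} (h1 : t' ≤ t) (h2 : t ≤ t'') (a : PP v s t') (b : PP v s t'') :
    PP v s t := by
  by_cases hts : t ≤ s
  · have := lemC_iter (t - t') a (by omega)
    rwa [Nat.add_sub_cancel' h1] at this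
  · exact lemDown_iter (t'' - t) (by rwa [Nat.add_sub_cancel' h2]) (by omega)


/-! ### Translation between exponent vectors and multisets -/

/-- the multiset of an exponent vector -/
def toM {r : ℕ} (M : Fin r → ℕ) : Multiset ℕ := ∑ j, Multiset.replicate (M j) (j : ℕ)

/-- the exponent vector of a multiset -/
def fromM (r : ℕ) (m : Multiset ℕ) : Fin r → ℕ := fun j => m.count (j : ℕ)

lemma count_toM {r : ℕ} (M : Fin r → ℕ) (j : Fin r) : (toM M).count (j : ℕ) = M j := by
  unfold toM
  rw [Multiset.count_sum']
  simp [Multiset.count_replicate, Fin.val_inj]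

lemma mem_toM {r : ℕ} {M : Fin r → ℕ} {a : ℕ} (h : a ∈ toM M) : a < r := by
  unfold toM at h
  rw [Multiset.mem_sum] at h
  obtain ⟨j, -, hj⟩ := h
  rw [Multiset.eq_of_mem_replicate hj]
  exact j.2

lemma card_toM {r : ℕ} (M : Fin r → ℕ) : (toM M).card = monDeg M := by
  unfold toM monDeg
  rw [Multiset.card_sum]
  simp

lemma fromM_toM {r : ℕ} (M : Fin r → ℕ) : fromM r (toM M) = M := by
  ext j
  exact count_toM M j

lemma toM_fromM {r : ℕ} {m : Multiset ℕ} (h : ∀ a ∈ m, a < r) : toM (fromM r m) = m := by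
  ext a
  by_cases ha : a < r
  · exact count_toM (fromM r m) ⟨a, ha⟩
  · rw [Multiset.count_eq_zero_of_notMem fun h => ha (mem_toM h),
      Multiset.count_eq_zero_of_notMem fun h' => ha (h a h')]

lemma toM_inj {r : ℕ} : Function.Injective (toM (r := r)) := fun M N h => by
  rw [← fromM_toM M, h, fromM_toM]

lemma toM_le {r : ℕ} {M N : Fin r → ℕ} : toM M ≤ toM N ↔ ∀ j, M j ≤ N j := by
  constructor
  · intro h j
    rw [← count_toM M, ← count_toM N]
    exact Multiset.count_le_of_le _ h
  · intro h
    rw [Multiset.le_iff_count]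
    intro a
    by_cases ha : a < r
    · have := h ⟨a, ha⟩
      rw [← count_toM M, ← count_toM N] at this
      exact this
    · rw [Multiset.count_eq_zero_of_notMem fun h => ha (mem_toM h)]
      exact Nat.zero_le _

lemma counts_aux {r : ℕ} {X : Finset (Fin r → ℕ)} {T : Finset (Multiset ℕ)}
    (hr : ∀ n ∈ T, ∀ a ∈ n, a < r) (hX : ∀ M, M ∈ X ↔ ∃ n ∈ T, toM M ≤ n) {i : ℕ}
    {D : Finset (Multiset ℕ)} (hD : ∀ m, m ∈ D ↔ m.card = i ∧ ∃ n ∈ T, m ≤ n) :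
    (X.filter fun M => monDeg M = i).card = D.card := by
  refine Finset.card_bij (fun M _ => toM M) ?_ ?_ ?_
  · intro M hM
    obtain ⟨h1, h2⟩ := Finset.mem_filter.1 hM
    exact (hD _).2 ⟨by rw [card_toM, h2], (hX M).1 h1⟩
  · intro M _ N _ h
    exact toM_inj h
  · intro m hm
    obtain ⟨h1, n, hn, h2⟩ := (hD m).1 hm
    have h3 : toM (fromM r m) = m := toM_fromM fun a ha => hr n hn a (Multiset.mem_of_le h2 ha)
    refine ⟨fromM r m, ?_, h3⟩
    rw [Finset.mem_filter, hX, ← card_toM, h3]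
    exact ⟨⟨n, hn, h2⟩, h1⟩

lemma counts {r : ℕ} {X : Finset (Fin r → ℕ)} {T : Finset (Multiset ℕ)} (hT : Tri T)
    (hne : T.Nonempty)
    (hr : ∀ n ∈ T, ∀ a ∈ n, a < r) (hX : ∀ M, M ∈ X ↔ ∃ n ∈ T, toM M ≤ n) :
    (X.filter fun M => monDeg M = 0).card = 1 ∧
    (X.filter fun M => monDeg M = 1).card = (vr T).card ∧
    (X.filter fun M => monDeg M = 2).card = (shd T).card ∧
    (X.filter fun M => monDeg M = 3).card = T.card := by
  refine ⟨?_, ?_, ?_, ?_⟩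
  · rw [counts_aux hr hX (D := {0})]
    · rfl
    · intro m
      obtain ⟨n, hn⟩ := hne
      simp only [Finset.mem_singleton, Multiset.card_eq_zero]
      constructor
      · rintro rfl
        exact ⟨rfl, n, hn, Multiset.zero_le n⟩
      · exact fun h => h.1
  · rw [counts_aux hr hX (D := (vr T).image (fun a => ({a} : Multiset ℕ)))]
    · rw [Finset.card_image_of_injective]
      intro a b hab
      simpa using hab
    · intro m
      rw [Finset.mem_image]
      constructor
      · rintro ⟨a, ha, rfl⟩
        obtain ⟨n, hn, h⟩ := mem_vr.1 ha
        exact ⟨by simp, n, hn, Multiset.singleton_le.2 h⟩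
      · rintro ⟨h1, n, hn, h2⟩
        obtain ⟨a, rfl⟩ := Multiset.card_eq_one.1 h1
        exact ⟨a, mem_vr.2 ⟨n, hn, Multiset.singleton_le.1 h2⟩, rfl⟩
  · apply counts_aux hr hX
    intro m
    constructor
    · intro h
      refine ⟨shd_card hT h, ?_⟩
      obtain ⟨a, ha⟩ := mem_shd.1 h
      exact ⟨_, ha, Multiset.le_cons_self _ _⟩
    · rintro ⟨h1, n, hn, h2⟩
      obtain ⟨u, rfl⟩ := Multiset.le_iff_exists_add.1 h2
      have h3 := hT _ hn
      rw [Multiset.card_add] at h3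
      obtain ⟨a, rfl⟩ := Multiset.card_eq_one.1 (by omega : u.card = 1)
      refine mem_shd.2 ⟨a, ?_⟩
      rwa [add_comm, Multiset.singleton_add] at hn
  · apply counts_aux hr hX
    intro m
    constructor
    · intro h
      exact ⟨hT m h, m, h, le_rfl⟩
    · rintro ⟨h1, n, hn, h2⟩
      rwa [Multiset.eq_of_le_of_card_le h2 (by rw [hT n hn, h1])]

lemma bridge (a b c : ℕ) : IsPureOSeq (seq4 a b c) 3 ↔ PP a b c ∧ 0 < c := by
  classical
  constructor
  · rintro ⟨r, X, ⟨⟨hne, hcl⟩, hle, ⟨M0, hM0, hM0d⟩, hmax⟩, hh⟩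
    set T := (X.filter fun M => monDeg M = 3).image toM with hTd
    have memT : ∀ n, n ∈ T ↔ ∃ M ∈ X, monDeg M = 3 ∧ toM M = n := by
      intro n
      simp [hTd, and_assoc]
    have hT : Tri T := by
      intro n hn
      obtain ⟨M, h1, h2, rfl⟩ := (memT n).1 hn
      rw [card_toM, h2]
    have hTne : T.Nonempty := ⟨toM M0, (memT _).2 ⟨M0, hM0, hM0d, rfl⟩⟩
    have hr : ∀ n ∈ T, ∀ a ∈ n, a < r := by
      intro n hn a ha
      obtain ⟨M, h1, h2, rfl⟩ := (memT n).1 hn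
      exact mem_toM ha
    have hX : ∀ M, M ∈ X ↔ ∃ n ∈ T, toM M ≤ n := by
      intro M
      constructor
      · intro hM
        obtain ⟨N, hMN, hN⟩ := X.exists_le_maximal hM
        have hNd : monDeg N = 3 := by
          apply hmax
          refine ⟨hN.1, fun N' hN' h => ?_⟩
          exact le_antisymm (hN.2 hN' h) h
        exact ⟨toM N, (memT _).2 ⟨N, hN.1, hNd, rfl⟩, toM_le.2 hMN⟩
      · rintro ⟨n, hn, h⟩
        obtain ⟨N, h1, h2, rfl⟩ := (memT n).1 hn
        exact hcl N h1 M (toM_le.1 h)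
    obtain ⟨-, c1, c2, c3⟩ := counts hT hTne hr hX
    have e1 : a = _ := hh 1 (by norm_num)
    have e2 : b = _ := hh 2 (by norm_num)
    have e3 : c = _ := hh 3 (by norm_num)
    refine ⟨⟨T, hT, ?_, ?_, ?_⟩, ?_⟩
    · rw [← c1]; convert e1.symm
    · rw [← c2]; convert e2.symm
    · rw [← c3]; convert e3.symm
    · have : c = T.card := by rw [← c3]; convert e3
      rw [this]
      exact Finset.card_pos.2 hTne
  · rintro ⟨⟨T, hT, rfl, rfl, rfl⟩, hpos⟩
    obtain ⟨r, hr0⟩ := exists_fresh T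
    have hr : ∀ n ∈ T, ∀ a ∈ n, a < r := fun n hn a ha => hr0 a (mem_vr.2 ⟨n, hn, ha⟩)
    set X := (T.biUnion fun n => n.powerset.toFinset).image (fromM r) with hXd
    have hX : ∀ M, M ∈ X ↔ ∃ n ∈ T, toM M ≤ n := by
      intro M
      simp only [hXd, Finset.mem_image, Finset.mem_biUnion, Multiset.mem_toFinset,
        Multiset.mem_powerset]
      constructor
      · rintro ⟨m, ⟨n, hn, hmn⟩, rfl⟩
        refine ⟨n, hn, ?_⟩
        rwa [toM_fromM fun a ha => hr n hn a (Multiset.mem_of_le hmn ha)]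
      · rintro ⟨n, hn, h⟩
        exact ⟨toM M, ⟨n, hn, h⟩, fromM_toM M⟩
    have hTne : T.Nonempty := Finset.card_pos.1 hpos
    have hin : ∀ n ∈ T, fromM r n ∈ X := fun n hn => (hX _).2 ⟨n, hn, by rw [toM_fromM (hr n hn)]⟩
    have hdeg : ∀ n ∈ T, monDeg (fromM r n) = 3 := fun n hn => by
      rw [← card_toM, toM_fromM (hr n hn), hT n hn]
    obtain ⟨n0, hn0⟩ := id hTne
    obtain ⟨c0, c1, c2, c3⟩ := counts hT hTne hr hX
    refine ⟨r, X, ⟨⟨⟨_, hin n0 hn0⟩, ?_⟩, ?_, ⟨_, hin n0 hn0, hdeg n0 hn0⟩, ?_⟩, ?_⟩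
    · intro M hM N hN
      obtain ⟨n, hn, h⟩ := (hX M).1 hM
      exact (hX N).2 ⟨n, hn, (toM_le.2 hN).trans h⟩
    · intro M hM
      obtain ⟨n, hn, h⟩ := (hX M).1 hM
      rw [← card_toM, ← hT n hn]
      exact Multiset.card_le_card h
    · rintro M ⟨hM, hmax⟩
      obtain ⟨n, hn, h⟩ := (hX M).1 hM
      have := hmax _ (hin n hn) (by
        rw [← toM_le, toM_fromM (hr n hn)]; exact h)
      rw [← this]
      exact hdeg n hn
    · intro i hi
      have hi' : i = 0 ∨ i = 1 ∨ i = 2 ∨ i = 3 := by omega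
      rcases hi' with rfl | rfl | rfl | rfl
      · change 1 = _
        rw [← c0]
      · change (vr T).card = _
        rw [← c1]
      · change (shd T).card = _
        rw [← c2]
      · change T.card = _
        rw [← c3]



/-- The set of pure O-sequences of socle degree 3 satisfies the
interval property in each coordinate. -/
theorem interval_property_socle_degree_three :
    (∀ h₁' h₁ h₁'' h₂ h₃ : ℕ, h₁' ≤ h₁ → h₁ ≤ h₁'' →
      IsPureOSeq (seq4 h₁' h₂ h₃) 3 → IsPureOSeq (seq4 h₁'' h₂ h₃) 3 →
      IsPureOSeq (seq4 h₁ h₂ h₃) 3) ∧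
    (∀ h₁ h₂' h₂ h₂'' h₃ : ℕ, h₂' ≤ h₂ → h₂ ≤ h₂'' →
      IsPureOSeq (seq4 h₁ h₂' h₃) 3 → IsPureOSeq (seq4 h₁ h₂'' h₃) 3 →
      IsPureOSeq (seq4 h₁ h₂ h₃) 3) ∧
    (∀ h₁ h₂ h₃' h₃ h₃'' : ℕ, h₃' ≤ h₃ → h₃ ≤ h₃'' →
      IsPureOSeq (seq4 h₁ h₂ h₃') 3 → IsPureOSeq (seq4 h₁ h₂ h₃'') 3 →
      IsPureOSeq (seq4 h₁ h₂ h₃) 3) := by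
  refine ⟨?_, ?_, ?_⟩
  · intro a' a a'' b c h1 h2 x y
    rw [bridge] at *
    exact ⟨PP_i h1 h2 x.1 y.1, x.2⟩
  · intro a b' b b'' c h1 h2 x y
    rw [bridge] at *
    exact ⟨PP_ii h1 h2 x.1 y.1, x.2⟩
  · intro a b c' c c'' h1 h2 x y
    rw [bridge] at *
    exact ⟨PP_iii h1 h2 x.1 y.1, by omega⟩
end

section
/- Fix a positive integer e and set c_e = (∏_{i=0}^{e−2} C(C(e+1,2) − C(i+1,2) − 1, i)) / (C(e+1,2) − 1)!. For each r ≥ 1 let O^r(e), D^r(e) and P^r(e) denote, respectively, the number of O-sequences, of differentiable O-sequences, and of pure O-sequences (h_0, h_1, …, h_e) of codimension r (h_1 = r) and socle degree e. Then, as r → ∞, each of the ratios O^r(e)/r^{C(e+1,2)−1}, D^r(e)/r^{C(e+1,2)−1} and P^r(e)/r^{C(e+1,2)−1} converges to c_e. In particular, for r large almost all O-sequences of codimension r and socle degree e are pure. -/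
open Filter

/-- The number of O-sequences of codimension `r` and socle degree `e`
(normalized to vanish beyond degree `e`). -/
noncomputable def OSeqCount (r e : ℕ) : ℕ :=
  {h : ℕ → ℕ | IsOSeq h e ∧ h 1 = r ∧ ∀ i, e < i → h i = 0}.ncard

/-- The number of differentiable O-sequences of codimension `r` and socle degree `e`. -/
noncomputable def diffOSeqCount (r e : ℕ) : ℕ :=
  {h : ℕ → ℕ | IsOSeq h e ∧ IsDifferentiable h e ∧ h 1 = r ∧ ∀ i, e < i → h i = 0}.ncard

/-- The number of pure O-sequences of codimension `r` and socle degree `e`. -/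
noncomputable def pureOSeqCount (r e : ℕ) : ℕ :=
  {h : ℕ → ℕ | IsPureOSeq h e ∧ h 1 = r ∧ ∀ i, e < i → h i = 0}.ncard

/-- The constant `c_e`. -/
noncomputable def cConst (e : ℕ) : ℝ :=
  (∏ i ∈ Finset.range (e - 1),
      ((Nat.choose (e + 1) 2 - Nat.choose (i + 1) 2 - 1).choose i : ℝ)) /
    (Nat.factorial (Nat.choose (e + 1) 2 - 1) : ℝ)


/-- Lists of tails of sequences, organised by binomial blocks. -/
def Tails (c L : ℕ) : ℕ → ℕ → ℕ → Finset (List ℕ)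
  | 0, _, _ => {[]}
  | l + 1, j, k => ((Finset.range (k + c)).filter (fun m => L ≤ m)).biUnion fun m =>
      (Finset.Ico (m.choose (j + 1)) ((m + 1).choose (j + 1))).biUnion fun n =>
        (Tails c L l (j + 1) m).image (List.cons n)

/-- The exponent of growth. -/
def sExp : ℕ → ℕ → ℕ
  | 0, _ => 0
  | l + 1, j => sExp l (j + 1) + j + 1

/-- The leading coefficient. -/
noncomputable def aCoef : ℕ → ℕ → ℝ
  | 0, _ => 1
  | l + 1, j => aCoef l (j + 1) / (((Nat.factorial j : ℕ) : ℝ) * ((sExp l (j + 1) + j + 1 : ℕ) : ℝ))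

theorem aCoef_nonneg (l j : ℕ) : 0 ≤ aCoef l j := by
  induction l generalizing j with
  | zero => simp [aCoef]
  | succ l ih => rw [aCoef]; exact div_nonneg (ih _) (by positivity)

theorem mem_Tails_succ (c L l j k n : ℕ) (t : List ℕ) :
    n :: t ∈ Tails c L (l + 1) j k ↔ ∃ m, L ≤ m ∧ m < k + c ∧ m.choose (j + 1) ≤ n ∧
      n < (m + 1).choose (j + 1) ∧ t ∈ Tails c L l (j + 1) m := by
  simp only [Tails, Finset.mem_biUnion, Finset.mem_filter, Finset.mem_range, Finset.mem_Ico,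
    Finset.mem_image, List.cons.injEq]
  constructor
  · rintro ⟨m, ⟨h1, h2⟩, n', ⟨h3, h4⟩, t', h5, rfl, rfl⟩
    exact ⟨m, h2, h1, h3, h4, h5⟩
  · rintro ⟨m, h1, h2, h3, h4, h5⟩
    exact ⟨m, ⟨h2, h1⟩, n, ⟨h3, h4⟩, t, h5, rfl, rfl⟩

theorem exists_of_mem_Tails_succ (c L l j k : ℕ) (t : List ℕ) (h : t ∈ Tails c L (l + 1) j k) :
    ∃ n t', t = n :: t' := by
  simp only [Tails, Finset.mem_biUnion, Finset.mem_image] at h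
  obtain ⟨m, -, n, -, t', -, rfl⟩ := h
  exact ⟨n, t', rfl⟩

theorem choose_succ_sub (m j : ℕ) :
    (m + 1).choose (j + 1) - m.choose (j + 1) = m.choose j := by
  rw [Nat.choose_succ_succ']; omega

theorem card_Tails_le_sum (c L l j k : ℕ) :
    (Tails c L (l + 1) j k).card ≤
      ∑ m ∈ Finset.range (k + c), m.choose j * (Tails c L l (j + 1) m).card := by
  rw [Tails]
  refine Finset.card_biUnion_le.trans ?_
  refine (Finset.sum_le_sum_of_subset (Finset.filter_subset _ _)).trans ?_
  refine Finset.sum_le_sum fun m _ => ?_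
  refine Finset.card_biUnion_le.trans ?_
  refine (Finset.sum_le_card_nsmul _ _ (Tails c L l (j + 1) m).card ?_).trans ?_
  · intro n _; exact Finset.card_image_le
  · rw [Nat.card_Ico, choose_succ_sub]; simp

theorem card_Tails_eq_sum (c L l j k : ℕ) :
    (Tails c L (l + 1) j k).card =
      ∑ m ∈ (Finset.range (k + c)).filter (fun m => L ≤ m),
        m.choose j * (Tails c L l (j + 1) m).card := by
  rw [Tails, Finset.card_biUnion]
  · refine Finset.sum_congr rfl fun m _ => ?_
    rw [Finset.card_biUnion]
    · rw [Finset.sum_congr rfl (g := fun _ => (Tails c L l (j + 1) m).card)]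
      · rw [Finset.sum_const, Nat.card_Ico, choose_succ_sub]; simp
      · intro n _
        exact Finset.card_image_of_injective _ (List.cons_injective)
    · intro a _ b _ hab
      rw [Function.onFun, Finset.disjoint_left]
      intro t h1 h2
      simp only [Finset.mem_image] at h1 h2
      obtain ⟨t1, -, rfl⟩ := h1
      obtain ⟨t2, -, h⟩ := h2
      simp only [List.cons.injEq] at h
      exact hab h.1.symm
  · have key : ∀ a b n : ℕ, a < b → n < (a + 1).choose (j + 1) → b.choose (j + 1) ≤ n → False := by
      intro a b n hab h1 h2
      have := Nat.choose_le_choose (j + 1) (show a + 1 ≤ b from hab)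
      omega
    intro a _ b _ hab
    rw [Function.onFun, Finset.disjoint_left]
    intro t h1 h2
    simp only [Finset.mem_biUnion, Finset.mem_image, Finset.mem_Ico] at h1 h2
    obtain ⟨n, hn, t1, -, rfl⟩ := h1
    obtain ⟨n', hn', t2, -, h⟩ := h2
    simp only [List.cons.injEq] at h
    obtain ⟨rfl, -⟩ := h
    rcases lt_or_gt_of_ne hab with h | h
    · exact key a b _ h hn.2 hn'.1
    · exact key b a _ h hn'.2 hn.1

theorem pow_succ_step (x : ℝ) (hx : 0 ≤ x) (p : ℕ) :
    x ^ (p + 1) + (p + 1) * x ^ p ≤ (x + 1) ^ (p + 1) := by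
  induction p with
  | zero => simp
  | succ p ih =>
    have h1 : (x + 1) ^ (p + 1 + 1) = (x + 1) * (x + 1) ^ (p + 1) := by ring
    have h2 := mul_le_mul_of_nonneg_left ih (show 0 ≤ x + 1 by linarith)
    have h3 : 0 ≤ x ^ p := by positivity
    rw [h1]
    refine le_trans ?_ h2
    push_cast
    have : (x + 1) * (x ^ (p + 1) + (p + 1) * x ^ p) - (x ^ (p + 1 + 1) + ((p : ℝ) + 1 + 1) * x ^ (p + 1))
       = (p + 1) * x ^ p := by ring
    have h4 : 0 ≤ ((p : ℝ) + 1) * x ^ p := by positivity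
    linarith

theorem pow_succ_step' (x : ℝ) (hx : 0 ≤ x) (p : ℕ) :
    (x + 1) ^ (p + 1) ≤ x ^ (p + 1) + (p + 1) * (x + 1) ^ p := by
  induction p with
  | zero => simp
  | succ p ih =>
    have h1 : (x + 1) ^ (p + 1 + 1) = x * (x + 1) ^ (p + 1) + (x + 1) ^ (p + 1) := by ring
    have h2 := mul_le_mul_of_nonneg_left ih hx
    have h3 : 0 ≤ (x + 1) ^ p := by positivity
    rw [h1]
    push_cast
    have h4 : 0 ≤ ((p : ℝ) + 1) * (x + 1) ^ p := by positivity
    have : x ^ (p + 1 + 1) + ((p : ℝ) + 1 + 1) * (x + 1) ^ (p + 1) - (x * (x ^ (p + 1) + (p + 1) * (x + 1) ^ p) + (x + 1) ^ (p + 1))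
       = (p + 1) * (x + 1) ^ p := by ring
    linarith

theorem sum_pow_upper (A : ℝ) (hA : 0 ≤ A) (p n : ℕ) :
    ∑ m ∈ Finset.range n, ((m : ℝ) + A) ^ p ≤ ((n : ℝ) + A) ^ (p + 1) / (p + 1) := by
  induction n with
  | zero => simp; positivity
  | succ n ih =>
    rw [Finset.sum_range_succ]
    have h := pow_succ_step ((n : ℝ) + A) (by positivity) p
    have hp : (0 : ℝ) < p + 1 := by positivity
    rw [le_div_iff₀ hp] at *
    push_cast
    rw [show (n : ℝ) + 1 + A = n + A + 1 by ring]
    nlinarith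

theorem sum_pow_lower (A p n : ℕ) :
    (((n - A - 1 : ℕ) : ℝ)) ^ (p + 1) / (p + 1) ≤
      ∑ m ∈ Finset.range n, (((m - A : ℕ) : ℝ)) ^ p := by
  induction n with
  | zero => simp
  | succ n ih =>
    rw [Finset.sum_range_succ]
    have hp : (0 : ℝ) < p + 1 := by positivity
    by_cases hn : n ≤ A
    · rw [show n + 1 - A - 1 = 0 by omega]
      have : (0 : ℝ) ≤ ∑ m ∈ Finset.range n, (((m - A : ℕ) : ℝ)) ^ p := by positivity
      have : (0 : ℝ) ≤ (((n - A : ℕ) : ℝ)) ^ p := by positivity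
      simp; linarith
    · obtain ⟨u, rfl⟩ : ∃ u, n = A + u + 1 := ⟨n - A - 1, by omega⟩
      rw [show A + u + 1 + 1 - A - 1 = u + 1 by omega]
      rw [show A + u + 1 - A - 1 = u by omega] at ih
      rw [show A + u + 1 - A = u + 1 by omega]
      have h := pow_succ_step' (u : ℝ) (by positivity) p
      rw [div_le_iff₀ hp] at *
      push_cast
      nlinarith

theorem card_Tails_upper (c l j k : ℕ) :
    ((Tails c 0 l j k).card : ℝ) ≤ aCoef l j * ((k : ℝ) + (c * l : ℕ)) ^ sExp l j := by
  induction l generalizing j k with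
  | zero => simp [Tails, aCoef, sExp]
  | succ l ih =>
    have h1 : ((Tails c 0 (l + 1) j k).card : ℝ) ≤
        ∑ m ∈ Finset.range (k + c), (m.choose j : ℝ) * ((Tails c 0 l (j + 1) m).card : ℝ) := by
      exact_mod_cast card_Tails_le_sum c 0 l j k
    refine h1.trans ?_
    have ha := aCoef_nonneg l (j + 1)
    set a := aCoef l (j + 1) with hadef
    set s := sExp l (j + 1) with hs
    have h2 : ∀ m ∈ Finset.range (k + c), (m.choose j : ℝ) * ((Tails c 0 l (j + 1) m).card : ℝ) ≤
        a / (Nat.factorial j : ℝ) * ((m : ℝ) + (c * l : ℕ)) ^ (s + j) := by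
      intro m _
      have hc : (m.choose j : ℝ) ≤ ((m : ℝ) + (c * l : ℕ)) ^ j / (Nat.factorial j : ℝ) := by
        refine (Nat.choose_le_pow_div j m).trans ?_
        gcongr
        simp; positivity
      calc _ ≤ ((m : ℝ) + (c * l : ℕ)) ^ j / (Nat.factorial j : ℝ) * (a * ((m : ℝ) + (c * l : ℕ)) ^ s) := by
            gcongr
            exact ih (j + 1) m
        _ = _ := by ring
    refine (Finset.sum_le_sum h2).trans ?_
    rw [← Finset.mul_sum]
    have h3 := sum_pow_upper ((c * l : ℕ) : ℝ) (by positivity) (s + j) (k + c)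
    refine (mul_le_mul_of_nonneg_left h3 (by positivity)).trans (le_of_eq ?_)
    rw [aCoef, sExp, ← hs, ← hadef]
    push_cast
    rw [show (c : ℝ) * (l + 1) = c + c * l by ring, ← add_assoc, add_assoc s j 1]
    field_simp

theorem card_Tails_lower (L B l j k : ℕ) (hj : 1 ≤ j) (hjB : j + l ≤ B) (hL : L ≤ B) :
    aCoef l j * (((k - (B + l) : ℕ) : ℝ)) ^ sExp l j ≤ ((Tails 0 L l j k).card : ℝ) := by
  induction l generalizing j k with
  | zero => simp [Tails, aCoef, sExp]
  | succ l ih =>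
    rw [card_Tails_eq_sum, add_zero]
    have ha := aCoef_nonneg l (j + 1)
    set a := aCoef l (j + 1) with hadef
    set s := sExp l (j + 1) with hs
    have h2 : ∀ m ∈ Finset.range k, a / (Nat.factorial j : ℝ) * ((m - (B + l) : ℕ) : ℝ) ^ (s + j) ≤
       if L ≤ m then (m.choose j : ℝ) * ((Tails 0 L l (j + 1) m).card : ℝ) else 0 := by
      intro m _
      split_ifs with hm
      · have hc : ((m - (B + l) : ℕ) : ℝ) ^ j / (Nat.factorial j : ℝ) ≤ (m.choose j : ℝ) := by
          rw [div_le_iff₀ (by positivity)]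
          have h5 := Nat.pow_sub_le_descFactorial m j
          rw [Nat.descFactorial_eq_factorial_mul_choose] at h5
          have h6 : (m - (B + l)) ^ j ≤ (m + 1 - j) ^ j := Nat.pow_le_pow_left (by omega) j
          have : (m - (B + l)) ^ j ≤ m.choose j * Nat.factorial j := by linarith
          exact_mod_cast this
        calc _ = ((m - (B + l) : ℕ) : ℝ) ^ j / (Nat.factorial j : ℝ) * (a * ((m - (B + l) : ℕ) : ℝ) ^ s) := by ring
          _ ≤ _ := by
            gcongr
            exact ih (j + 1) m (by omega) (by omega)
      · rw [show m - (B + l) = 0 by omega]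
        rw [Nat.cast_zero, zero_pow (by omega)]; simp
    push_cast
    rw [Finset.sum_filter]
    refine le_trans ?_ (Finset.sum_le_sum h2)
    rw [← Finset.mul_sum]
    have h3 := sum_pow_lower (B + l) (s + j) k
    refine le_trans (le_of_eq ?_) (mul_le_mul_of_nonneg_left h3 (by positivity))
    rw [aCoef, sExp, ← hs, ← hadef, ← add_assoc B l 1, Nat.sub_sub]
    push_cast
    field_simp

theorem sExp_eq (l j : ℕ) : sExp l j + (j + 1).choose 2 = (j + l + 1).choose 2 := by
  induction l generalizing j with
  | zero => simp [sExp]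
  | succ l ih =>
    have := ih (j + 1)
    rw [sExp, show j + (l + 1) + 1 = j + 1 + l + 1 by ring, ← this, Nat.choose_succ_succ (j + 1) 1]
    simp; ring

theorem aCoef_eq (l j : ℕ) :
    aCoef l (j + 1) * (Nat.factorial ((j + l + 2).choose 2 - (j + 1).choose 2 - 1) : ℝ) =
      (Nat.factorial j : ℝ) * ∏ i ∈ Finset.range l,
        (((j + l + 2).choose 2 - (j + i + 1).choose 2 - 1).choose (j + i) : ℝ) := by
  induction l generalizing j with
  | zero =>
    simp only [aCoef]
    rw [show j + 0 + 2 = (j + 1) + 1 by ring, Nat.choose_succ_succ (j + 1) 1]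
    simp
  | succ l ih =>
    have h := ih (j + 1)
    have hs := sExp_eq l (j + 1 + 1)
    rw [Finset.prod_range_succ']
    have e1 : j + (l + 1) + 2 = j + 1 + l + 2 := by ring
    have e2 : ∀ i, j + (i + 1) = j + 1 + i := fun i => by ring
    rw [e1]
    rw [Finset.prod_congr rfl (g := fun i => (((j + 1 + l + 2).choose 2 -
      (j + 1 + i + 1).choose 2 - 1).choose (j + 1 + i) : ℝ)) (fun i _ => by rw [e2 i])]
    rw [add_zero]
    rw [show j + 1 + 1 + l + 1 = j + 1 + l + 2 by ring] at hs
    set N := (j + 1 + l + 2).choose 2 with hN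
    have c1 : (j + 1 + 1).choose 2 = (j + 1) + (j + 1).choose 2 := by
      rw [Nat.choose_succ_succ (j + 1) 1]; simp
    have c2 : (j + 1 + 1 + 1).choose 2 = (j + 1 + 1) + (j + 1 + 1).choose 2 := by
      rw [Nat.choose_succ_succ (j + 1 + 1) 1]; simp
    set P := ∏ i ∈ Finset.range l, ((N - (j + 1 + i + 1).choose 2 - 1).choose (j + 1 + i) : ℝ)
    set s := sExp l (j + 1 + 1)
    set T := (j + 1).choose 2
    have hA : N - T - 1 = (s + (j + 1) + 1) + j := by omega
    have hB : N - (j + 1 + 1).choose 2 - 1 = s + (j + 1) := by omega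
    rw [hB] at h
    rw [aCoef, hA]
    have hc := Nat.choose_mul_factorial_mul_factorial (show j ≤ (s + (j + 1) + 1) + j by omega)
    rw [show s + (j + 1) + 1 + j - j = (s + (j + 1)) + 1 by omega, Nat.factorial_succ (s + (j + 1))] at hc
    rw [← hc]
    have hf : (Nat.factorial (j + 1) : ℝ) ≠ 0 := by positivity
    have hf2 : ((s + (j + 1) + 1 : ℕ) : ℝ) ≠ 0 := by positivity
    push_cast at h hf2 ⊢
    field_simp
    linear_combination ((s + (j + 1) + 1 + j).choose j : ℝ) * ((s : ℝ) + j + 2) * h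

theorem aCoef_cConst (e : ℕ) (he : 0 < e) : aCoef (e - 1) 1 = cConst e := by
  obtain ⟨l, rfl⟩ : ∃ l, e = l + 1 := ⟨e - 1, by omega⟩
  have h := aCoef_eq l 0
  rw [cConst, eq_div_iff (by positivity)]
  simpa [add_comm, add_left_comm] using h

theorem sExp_final (e : ℕ) (he : 0 < e) : sExp (e - 1) 1 = (e + 1).choose 2 - 1 := by
  have h := sExp_eq (e - 1) 1
  rw [show 1 + (e - 1) + 1 = e + 1 by omega] at h
  simp at h
  omega

theorem tendsto_of_bounds (f : ℕ → ℕ) (a : ℝ) (A s : ℕ)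
    (h1 : ∀ᶠ r in atTop, (f r : ℝ) ≤ a * ((r : ℝ) + A) ^ s)
    (h2 : ∀ᶠ r in atTop, a * (((r - A : ℕ) : ℝ)) ^ s ≤ f r) :
    Tendsto (fun r : ℕ => (f r : ℝ) / (r : ℝ) ^ s) atTop (nhds a) := by
  have hA : Tendsto (fun r : ℕ => (A : ℝ) / (r : ℝ)) atTop (nhds 0) :=
    tendsto_const_div_atTop_nhds_zero_nat _
  have t1 : Tendsto (fun r : ℕ => a * (1 + (A : ℝ) / (r : ℝ)) ^ s) atTop (nhds a) := by
    have := ((hA.const_add 1).pow s).const_mul a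
    simpa using this
  have t2 : Tendsto (fun r : ℕ => a * (1 - (A : ℝ) / (r : ℝ)) ^ s) atTop (nhds a) := by
    have := ((hA.const_sub 1).pow s).const_mul a
    simpa using this
  refine tendsto_of_tendsto_of_tendsto_of_le_of_le' t2 t1 ?_ ?_
  · filter_upwards [h2, eventually_ge_atTop (A + 1)] with r hr hrA
    have : (0 : ℝ) < r := by exact_mod_cast (by omega : 0 < r)
    rw [le_div_iff₀ (by positivity), mul_assoc, ← mul_pow]
    refine le_trans (le_of_eq ?_) hr
    rw [Nat.cast_sub (by omega)]
    congr 2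
    field_simp
  · filter_upwards [h1, eventually_ge_atTop (A + 1)] with r hr hrA
    have : (0 : ℝ) < r := by exact_mod_cast (by omega : 0 < r)
    rw [div_le_iff₀ (by positivity), mul_assoc, ← mul_pow]
    refine le_trans hr (le_of_eq ?_)
    congr 2
    field_simp

/-- The abstract upper class of sequences. -/
def UpperRel (c : ℕ) (h : ℕ → ℕ) (e : ℕ) : Prop :=
  ∀ i, 1 ≤ i → i + 1 ≤ e → ∀ m, h i < (m + 1).choose i → h (i + 1) < (m + c).choose (i + 1)

theorem map_mem_Tails (c e : ℕ) (h : ℕ → ℕ) (H : UpperRel c h e) (l j k : ℕ) (hj : 1 ≤ j)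
    (hle : j + l ≤ e) (hk : h j < (k + 1).choose j) :
    (List.range' (j + 1) l).map h ∈ Tails c 0 l j k := by
  induction l generalizing j k with
  | zero => simp [Tails]
  | succ l ih =>
    rw [List.range'_succ, List.map_cons, mem_Tails_succ]
    have h1 := H j hj (by omega) k hk
    have hex : ∃ m : ℕ, h (j + 1) < m.choose (j + 1) := ⟨_, h1⟩
    have hs := Nat.find_spec hex
    have hle' : Nat.find hex ≤ k + c := Nat.find_min' hex h1
    have h0 : Nat.find hex ≠ 0 := by
      intro h0
      rw [h0] at hs
      simp at hs
    have hmin := Nat.find_min hex (m := Nat.find hex - 1) (by omega)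
    refine ⟨Nat.find hex - 1, by omega, by omega, by omega, ?_, ?_⟩
    · rwa [Nat.sub_add_cancel (by omega)]
    · apply ih (j + 1) _ (by omega) (by omega)
      rwa [Nat.sub_add_cancel (by omega)]

theorem upper_count (c e r : ℕ) (he : 0 < e) (S : Set (ℕ → ℕ))
    (hS : ∀ h ∈ S, h 0 = 1 ∧ h 1 = r ∧ (∀ i, e < i → h i = 0) ∧ UpperRel c h e) :
    S.Finite ∧ S.ncard ≤ (Tails c 0 (e - 1) 1 r).card := by
  have hm : Set.MapsTo (fun h : ℕ → ℕ => (List.range' 2 (e - 1)).map h) S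
      (↑(Tails c 0 (e - 1) 1 r) : Set (List ℕ)) := by
    intro h hh
    obtain ⟨h0, h1, h2, h3⟩ := hS h hh
    exact map_mem_Tails c e h h3 (e - 1) 1 r le_rfl (by omega) (by simp [h1])
  have hi : Set.InjOn (fun h : ℕ → ℕ => (List.range' 2 (e - 1)).map h) S := by
    intro h hh g hg heq
    obtain ⟨h0, h1, h2, h3⟩ := hS h hh
    obtain ⟨g0, g1, g2, g3⟩ := hS g hg
    have heq' := List.map_inj_left.mp heq
    funext i
    by_cases hi0 : i = 0
    · rw [hi0, h0, g0]
    by_cases hi1 : i = 1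
    · rw [hi1, h1, g1]
    by_cases hie : e < i
    · rw [h2 i hie, g2 i hie]
    · exact heq' i (by rw [List.mem_range'_1]; omega)
  refine ⟨Set.Finite.of_injOn hm hi (Finset.finite_toSet _), ?_⟩
  have := Set.ncard_le_ncard_of_injOn _ hm hi (Finset.finite_toSet _)
  rwa [Set.ncard_coe_finset] at this

theorem choose_ge (n d : ℕ) : n + 1 ≤ (n + (d + 1)).choose (d + 1) := by
  induction d with
  | zero => simp
  | succ d ih =>
    rw [show n + (d + 1 + 1) = (n + (d + 1)) + 1 by ring, Nat.choose_succ_succ']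
    omega

theorem macaulayBound_upper (n d m : ℕ) (h : n < m.choose d) :
    macaulayBound n d ≤ (m + 1).choose (d + 1) := by
  induction n using Nat.strong_induction_on generalizing d m with
  | _ n ih =>
    rcases n with _ | n
    · simp [macaulayBound]
    · rw [macaulayBound]
      rcases d with _ | d
      · simp at h
      set P : ℕ → Prop := fun k => k.choose (d + 1) ≤ n + 1 with hP
      have hspec : P (Nat.findGreatest P (n + 1 + (d + 1))) :=
        Nat.findGreatest_spec (m := 0) (by omega) (by simp [hP])
      have hmax : ¬ P (Nat.findGreatest P (n + 1 + (d + 1)) + 1) := by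
        by_cases hle : Nat.findGreatest P (n + 1 + (d + 1)) + 1 ≤ n + 1 + (d + 1)
        · exact Nat.findGreatest_is_greatest (Nat.lt_succ_self _) hle
        · have : Nat.findGreatest P (n + 1 + (d + 1)) = n + 1 + (d + 1) :=
            le_antisymm (Nat.findGreatest_le _) (by omega)
          rw [this] at hspec ⊢
          simp only [hP] at hspec ⊢
          have h3 := choose_ge (n + 1) d
          have h4 := Nat.choose_le_choose (d + 1)
            (show n + 1 + (d + 1) ≤ n + 1 + (d + 1) + 1 by omega)
          omega
      set k := Nat.findGreatest P (n + 1 + (d + 1)) with hk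
      simp only [hP] at hspec hmax
      rw [Nat.choose_succ_succ'] at hmax
      have hkm : k + 1 ≤ m := by
        by_contra hcon
        have := Nat.choose_le_choose (d + 1) (show m ≤ k by omega)
        omega
      have hdk : d + 1 ≤ k := Nat.le_findGreatest (by omega) (by simp [hP, Nat.choose_self])
      have hpos := Nat.choose_pos hdk
      have := ih (n + 1 - k.choose (d + 1)) (by omega) d k (by omega)
      refine le_trans ?_ (Nat.choose_le_choose _ (show k + 1 + 1 ≤ m + 1 by omega))
      rw [Nat.choose_succ_succ' (k + 1)]
      simp only [Nat.add_sub_cancel]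
      omega

theorem IsOSeq.upperRel {h : ℕ → ℕ} {e c : ℕ} (hh : IsOSeq h e) (hc : 3 ≤ c) : UpperRel c h e := by
  intro i hi hie m hm
  have h1 := hh.2.2 i hi hie
  have h2 := macaulayBound_upper _ _ _ hm
  have him : i ≤ m + 1 := by
    by_contra hcon
    rw [Nat.choose_eq_zero_of_lt (by omega)] at hm
    omega
  have h3 := Nat.choose_le_choose (i + 1) (show m + 1 + 1 + 1 ≤ m + c by omega)
  have h4 := Nat.choose_succ_succ' (m + 1 + 1) i
  have h5 : 0 < (m + 1 + 1).choose i := Nat.choose_pos (by omega)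
  omega

theorem choose_add_mul_le (n i t : ℕ) : n.choose (i + 1) + t * n.choose i ≤ (n + t).choose (i + 1) := by
  induction t with
  | zero => simp
  | succ t ih =>
    rw [← add_assoc, Nat.choose_succ_succ']
    have := Nat.choose_le_choose i (show n ≤ n + t by omega)
    rw [Nat.succ_mul]
    omega

/-- The squarefree monomial of a set. -/
def sqf {r : ℕ} (S : Finset (Fin r)) : Fin r → ℕ := fun j => if j ∈ S then 1 else 0

theorem monDeg_sqf {r : ℕ} (S : Finset (Fin r)) : monDeg (sqf S) = S.card := by
  simp [monDeg, sqf]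

theorem sqf_injective {r : ℕ} : Function.Injective (sqf (r := r)) := by
  intro S T h
  ext j
  have := congrFun h j
  simp only [sqf] at this
  split_ifs at this <;> simp_all

open FinsetFamily in
theorem sqf_bound {r i m : ℕ} (𝒜 : Finset (Finset (Fin r)))
    (hs : (𝒜 : Set (Finset (Fin r))).Sized (i + 1))
    (hb : (∂ 𝒜).card < m.choose i) : 𝒜.card ≤ m.choose (i + 1) := by
  by_contra hcon
  push Not at hcon
  have him : i ≤ m := by
    by_contra h
    rw [Nat.choose_eq_zero_of_lt (by omega)] at hb
    omega
  have hcard := hs.card_le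
  rw [Fintype.card_fin] at hcard
  rcases Nat.lt_or_ge m (i + 1) with h | h
  · have hmi : m = i := by omega
    subst hmi
    rw [Nat.choose_self] at hb
    have h0 : ∂ 𝒜 = ∅ := Finset.card_eq_zero.mp (by omega)
    obtain ⟨S, hS⟩ : 𝒜.Nonempty := Finset.card_pos.mp (by omega)
    have hc : S.card = m + 1 := hs hS
    obtain ⟨a, ha⟩ : S.Nonempty := Finset.card_pos.mp (by omega)
    have := Finset.erase_mem_shadow hS ha
    rw [h0] at this
    simp at this
  · have hmr : m ≤ r := by
      by_contra hc
      have := Nat.choose_le_choose (i + 1) (show r ≤ m by omega)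
      omega
    have := Finset.kruskal_katona_lovasz_form (i := 1) (by omega) h hmr hs hcon.le
    simp at this
    omega

open FinsetFamily in
theorem orderIdeal_growth {r i m : ℕ} (X : Finset (Fin r → ℕ)) (hX : IsOrderIdeal X)
    (hb : (X.filter fun M => monDeg M = i).card < m.choose i) :
    (X.filter fun M => monDeg M = i + 1).card ≤ (m + i).choose (i + 1) := by
  classical
  set Xi := X.filter fun M => monDeg M = i with hXi
  set 𝒜 : Finset (Finset (Fin r)) :=
    Finset.univ.filter fun S => S.card = i + 1 ∧ sqf S ∈ X with h𝒜
  have hs : (𝒜 : Set (Finset (Fin r))).Sized (i + 1) := by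
    intro S hS
    simp [h𝒜] at hS
    exact hS.1
  have hsh : (∂ 𝒜).card ≤ Xi.card := by
    refine Finset.card_le_card_of_injOn sqf ?_ sqf_injective.injOn
    intro T hT
    rw [Finset.mem_coe, Finset.mem_shadow_iff] at hT
    obtain ⟨S, hS, a, ha, rfl⟩ := hT
    have hc : S.card = i + 1 := hs hS
    simp only [h𝒜, Finset.mem_filter, Finset.mem_univ, true_and] at hS
    simp only [hXi, Finset.coe_filter, Set.mem_ofPred_eq]
    refine ⟨hX.2 _ hS.2 _ ?_, ?_⟩
    · intro j
      simp only [sqf, Finset.mem_erase]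
      split_ifs <;> simp_all
    · rw [monDeg_sqf, Finset.card_erase_of_mem ha, hc]; rfl
  have h𝒜c := sqf_bound 𝒜 hs (lt_of_le_of_lt hsh hb)
  have hcov : (X.filter fun M => monDeg M = i + 1) ⊆ 𝒜.image sqf ∪
      Xi.biUnion fun M => (Finset.univ.filter fun j => M j ≠ 0).image
        fun j => M + Pi.single j 1 := by
    intro M hM
    simp only [Finset.mem_filter] at hM
    rw [Finset.mem_union]
    by_cases hsq : ∀ j, M j ≤ 1
    · left
      have hMS : sqf (Finset.univ.filter fun j => M j ≠ 0) = M := by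
        funext j
        have := hsq j
        simp only [sqf, Finset.mem_filter, Finset.mem_univ, true_and]
        split_ifs <;> omega
      refine Finset.mem_image.mpr ⟨_, ?_, hMS⟩
      simp only [h𝒜, Finset.mem_filter, Finset.mem_univ, true_and]
      rw [hMS, ← monDeg_sqf, hMS]
      exact ⟨hM.2, hM.1⟩
    · right
      push Not at hsq
      obtain ⟨j, hj⟩ := hsq
      have hle : Pi.single j 1 ≤ M := by
        intro j'
        by_cases h : j' = j
        · subst h; simp; omega
        · simp [h]
      have heq : M - Pi.single j 1 + Pi.single j 1 = M := tsub_add_cancel_of_le hle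
      refine Finset.mem_biUnion.mpr ⟨M - Pi.single j 1, ?_, Finset.mem_image.mpr ⟨j, ?_, heq⟩⟩
      · simp only [hXi, Finset.mem_filter]
        refine ⟨hX.2 M hM.1 _ (fun j' => by simp), ?_⟩
        have : monDeg (M - Pi.single j 1 + Pi.single j 1) = i + 1 := by rw [heq]; exact hM.2
        simp only [monDeg, Pi.add_apply, Finset.sum_add_distrib] at this ⊢
        simp at this ⊢
        exact this
      · simp; omega
  refine (Finset.card_le_card hcov).trans ((Finset.card_union_le _ _).trans ?_)
  have h1 : (𝒜.image sqf).card ≤ m.choose (i + 1) := Finset.card_image_le.trans h𝒜c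
  have h2 : (Xi.biUnion fun M => (Finset.univ.filter fun j => M j ≠ 0).image
        fun j => M + Pi.single j 1).card ≤ Xi.card * i := by
    refine Finset.card_biUnion_le_card_mul _ _ _ ?_
    intro M hM
    refine Finset.card_image_le.trans ?_
    simp only [hXi, Finset.mem_filter] at hM
    rw [← hM.2, monDeg, Finset.card_eq_sum_ones, Finset.sum_filter]
    refine Finset.sum_le_sum fun j _ => ?_
    split_ifs <;> omega
  have h3 := choose_add_mul_le m i i
  have h4 : Xi.card * i ≤ i * m.choose i := by rw [mul_comm]; gcongr
  omega

theorem IsPureOSeq.upper {h : ℕ → ℕ} {e c : ℕ} (hh : IsPureOSeq h e) (hc : e + 2 ≤ c) :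
    h 0 = 1 ∧ UpperRel c h e := by
  obtain ⟨r, X, hX, hH⟩ := hh
  refine ⟨?_, ?_⟩
  · rw [hH 0 (by omega), Finset.card_eq_one]
    refine ⟨0, ?_⟩
    ext M
    simp only [Finset.mem_filter, Finset.mem_singleton]
    constructor
    · rintro ⟨-, hM⟩
      funext j
      simp only [monDeg, Finset.sum_eq_zero_iff, Finset.mem_univ, true_imp_iff] at hM
      exact hM j
    · rintro rfl
      obtain ⟨M, hM⟩ := hX.1.1
      exact ⟨hX.1.2 M hM _ (by simp), by simp [monDeg]⟩
  · intro i hi hie m hm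
    rw [hH i (by omega)] at hm
    rw [hH (i + 1) hie]
    have h1 := orderIdeal_growth X hX.1 hm
    have him : i ≤ m + 1 := by
      by_contra hcon
      rw [Nat.choose_eq_zero_of_lt (by omega)] at hm
      omega
    have h3 := Nat.choose_le_choose (i + 1) (show m + 1 + i + 1 ≤ m + c by omega)
    have h4 := Nat.choose_succ_succ' (m + 1 + i) i
    have h5 : 0 < (m + 1 + i).choose i := Nat.choose_pos (by omega)
    omega

theorem macaulayBound_lower (n d m : ℕ) (h : m.choose (d + 1) ≤ n) (hm : d + 1 ≤ m) :
    (m + 1).choose (d + 2) ≤ macaulayBound n (d + 1) := by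
  have hpos := Nat.choose_pos hm
  rcases n with _ | n
  · omega
  rw [macaulayBound]
  have hk : m ≤ Nat.findGreatest (fun k => Nat.choose k (d + 1) ≤ n + 1) (n + 1 + (d + 1)) := by
    refine Nat.le_findGreatest ?_ h
    have := choose_ge (m - (d + 1)) d
    rw [Nat.sub_add_cancel hm] at this
    omega
  have := Nat.choose_le_choose (d + 2) (Nat.succ_le_succ hk)
  simp only [Nat.succ_eq_add_one] at this
  rw [show d + 1 + 1 = d + 2 by ring]
  omega

theorem exists_block (n d : ℕ) : ∃ k : ℕ, k.choose (d + 1) ≤ n ∧ n < (k + 1).choose (d + 1) := by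
  have hex : ∃ m : ℕ, n < m.choose (d + 1) := ⟨n + (d + 1), choose_ge n d⟩
  have hs := Nat.find_spec hex
  have h0 : Nat.find hex ≠ 0 := by
    intro h0
    rw [h0] at hs
    simp at hs
  have hmin := Nat.find_min hex (m := Nat.find hex - 1) (by omega)
  refine ⟨Nat.find hex - 1, by omega, ?_⟩
  rwa [Nat.sub_add_cancel (by omega)]

theorem two_choose_le (q i : ℕ) (h : 3 * (i + 1) ≤ q) : 2 * q.choose i ≤ q.choose (i + 1) := by
  have h1 := Nat.choose_succ_right_eq q i
  have h2 : q.choose i * (2 * (i + 1)) ≤ q.choose i * (q - i) :=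
    Nat.mul_le_mul_left _ (by omega)
  have h3 : (2 * q.choose i) * (i + 1) ≤ q.choose (i + 1) * (i + 1) := by
    rw [h1]; linarith
  exact Nat.le_of_mul_le_mul_right h3 (by omega)

theorem choose_succ_le (q i : ℕ) (h : 3 * (i + 1) ≤ q) : (q + 1).choose i ≤ q.choose (i + 1) := by
  rcases i with _ | i
  · simp; omega
  · rw [Nat.choose_succ_succ']
    have h1 := two_choose_le q i (by omega)
    have h2 := two_choose_le q (i + 1) h
    omega

/-- Data for the lower bound family. -/
structure LowData (g m : ℕ → ℕ) (ρ e L : ℕ) : Prop where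
  g0 : g 0 = 1
  g1 : g 1 = ρ
  m0 : m 0 = ρ
  hL : ∀ i ≤ e, L ≤ m i
  hg : ∀ i ≤ e, (m i).choose i ≤ g i
  hm : ∀ i, i + 1 ≤ e → m (i + 1) ≤ m i
  hu : ∀ i, i + 1 ≤ e → g (i + 1) ≤ (m i).choose (i + 1)

/-- Partial sums cut off at `e`. -/
def psum (g : ℕ → ℕ) (e : ℕ) : ℕ → ℕ := fun i => if i ≤ e then ∑ j ∈ Finset.range (i + 1), g j else 0

theorem psum_zero {g : ℕ → ℕ} {e : ℕ} : psum g e 0 = g 0 := by simp [psum]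

theorem psum_succ {g : ℕ → ℕ} {e i : ℕ} (hi : i + 1 ≤ e) :
    psum g e (i + 1) = psum g e i + g (i + 1) := by
  simp only [psum]
  rw [if_pos hi, if_pos (by omega), Finset.sum_range_succ]

theorem LowData.isDiff {g m : ℕ → ℕ} {ρ e L : ℕ} (D : LowData g m ρ e L) (hLe : e ≤ L) :
    IsDifferentiable (psum g e) e := by
  refine ⟨by rw [psum_zero, D.g0], ?_, ?_⟩
  · intro i h1 h2
    obtain ⟨i, rfl⟩ : ∃ i', i = i' + 1 := ⟨i - 1, by omega⟩
    rw [psum_succ h2]; simp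
  · intro i h1 h2
    obtain ⟨i, rfl⟩ : ∃ i', i = i' + 1 := ⟨i - 1, by omega⟩
    simp only [Nat.add_sub_cancel, Nat.add_eq_zero_iff, one_ne_zero, and_false, if_false]
    rw [psum_succ h2, psum_succ (show i + 1 ≤ e by omega), Nat.add_sub_cancel_left,
      Nat.add_sub_cancel_left]
    have hL := D.hL (i + 1) (by omega)
    have h3 := macaulayBound_lower _ i _ (D.hg (i + 1) (by omega)) (by omega)
    have h4 := D.hu (i + 1) h2
    have h5 := Nat.choose_le_choose (i + 2) (show m (i + 1) ≤ m (i + 1) + 1 by omega)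
    exact h4.trans (h5.trans h3)

theorem LowData.isOSeq {g m : ℕ → ℕ} {ρ e L : ℕ} (D : LowData g m ρ e L) (hLe : 3 * e ≤ L) :
    IsOSeq (psum g e) e := by
  refine ⟨by rw [psum_zero, D.g0], ?_, ?_⟩
  · intro i hi
    induction i with
    | zero => rw [psum_zero, D.g0]; omega
    | succ i ih => rw [psum_succ hi]; have := ih (by omega); omega
  · intro i h1 h2
    obtain ⟨i, rfl⟩ : ∃ i', i = i' + 1 := ⟨i - 1, by omega⟩
    have hL := D.hL (i + 1) (by omega)
    obtain ⟨k, hk1, hk2⟩ := exists_block (psum g e (i + 1)) i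
    have hgi : g i ≤ psum g e i := by
      rcases i with _ | i
      · rw [psum_zero]
      · rw [psum_succ (by omega)]; omega
    have hbig : (m (i + 1) + 1).choose (i + 1) ≤ psum g e (i + 1) := by
      rw [psum_succ (by omega), Nat.choose_succ_succ']
      have a1 := D.hg i (by omega)
      have a2 := D.hg (i + 1) (by omega)
      have a3 := Nat.choose_le_choose i (D.hm i (by omega))
      omega
    have hkm : m (i + 1) + 1 ≤ k := by
      by_contra hcon
      have := Nat.choose_le_choose (i + 1) (show k + 1 ≤ m (i + 1) + 1 by omega)
      omega
    obtain ⟨q, rfl⟩ : ∃ q, k = q + 1 := ⟨k - 1, by omega⟩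
    refine le_trans ?_ (macaulayBound_lower _ i _ hk1 (by omega))
    have h4 := D.hu (i + 1) h2
    have h5 := Nat.choose_le_choose (i + 1 + 1) (show m (i + 1) ≤ q by omega)
    have h6 := choose_succ_le q i (by omega)
    rw [psum_succ h2]
    have e1 := Nat.choose_succ_succ' (q + 1) (i + 1)
    have e2 := Nat.choose_succ_succ' q (i + 1)
    have e3 := Nat.choose_succ_succ' (q + 1) i
    rw [show i + 2 = i + 1 + 1 by ring]
    omega

theorem cone_pure {ρ e : ℕ} (𝒴 : Finset (Finset (Fin ρ))) (h0 : ∅ ∈ 𝒴)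
    (hlow : ∀ S ∈ 𝒴, ∀ T ⊆ S, T ∈ 𝒴) (h : ℕ → ℕ)
    (hh : ∀ i ≤ e, h i = (𝒴.filter fun S => S.card ≤ i).card) : IsPureOSeq h e := by
  classical
  have hdeg : ∀ (a : ℕ) (S : Finset (Fin ρ)),
      monDeg (Fin.cons a (sqf S) : Fin (ρ + 1) → ℕ) = a + S.card := by
    intro a S
    rw [← monDeg_sqf S, monDeg, Fin.sum_univ_succ]
    simp [monDeg]
  set X : Finset (Fin (ρ + 1) → ℕ) :=
    ((𝒴 ×ˢ Finset.range (e + 1)).filter fun p => p.2 + p.1.card ≤ e).image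
      fun p => (Fin.cons p.2 (sqf p.1) : Fin (ρ + 1) → ℕ) with hX
  have hmem : ∀ M, M ∈ X ↔ ∃ S ∈ 𝒴, ∃ a, a + S.card ≤ e ∧
      (Fin.cons a (sqf S) : Fin (ρ + 1) → ℕ) = M := by
    intro M
    simp only [hX, Finset.mem_image, Finset.mem_filter, Finset.mem_product, Finset.mem_range,
      Prod.exists]
    constructor
    · rintro ⟨S, a, ⟨⟨h1, h2⟩, h3⟩, h4⟩
      exact ⟨S, h1, a, h3, h4⟩
    · rintro ⟨S, h1, a, h3, h4⟩
      exact ⟨S, a, ⟨⟨h1, by omega⟩, h3⟩, h4⟩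
  refine ⟨ρ + 1, X, ⟨⟨?_, ?_⟩, ?_, ?_, ?_⟩, ?_⟩
  · exact ⟨_, (hmem _).mpr ⟨∅, h0, 0, by simp, rfl⟩⟩
  · intro M hM N hN
    obtain ⟨S, hS, a, ha, rfl⟩ := (hmem M).mp hM
    have hsub : (Finset.univ.filter fun j : Fin ρ => N j.succ ≠ 0) ⊆ S := by
      intro j hj
      simp only [Finset.mem_filter, Finset.mem_univ, true_and] at hj
      by_contra hjS
      have := hN j.succ
      simp [sqf, hjS] at this
      exact hj this
    refine (hmem N).mpr ⟨_, hlow S hS _ hsub, N 0, ?_, ?_⟩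
    · have h1 := Finset.card_le_card hsub
      have h2 := hN 0
      simp only [Fin.cons_zero] at h2
      omega
    · funext j
      refine Fin.cases ?_ (fun j => ?_) j
      · simp
      · have := hN j.succ
        simp only [Fin.cons_succ, sqf, Finset.mem_filter, Finset.mem_univ, true_and] at this ⊢
        split_ifs at this ⊢ <;> omega
  · intro M hM
    obtain ⟨S, hS, a, ha, rfl⟩ := (hmem M).mp hM
    rw [hdeg]; exact ha
  · exact ⟨_, (hmem _).mpr ⟨∅, h0, e, by simp, rfl⟩, by rw [hdeg]; simp⟩
  · rintro M ⟨hM, hmax⟩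
    obtain ⟨S, hS, a, ha, rfl⟩ := (hmem M).mp hM
    rw [hdeg]
    by_contra hne
    have := hmax (Fin.cons (a + 1) (sqf S)) ((hmem _).mpr ⟨S, hS, a + 1, by omega, rfl⟩) (by
      intro j
      refine Fin.cases ?_ (fun j => ?_) j <;> simp)
    have := congrFun this 0
    simp at this
  · intro i hi
    rw [hh i hi]
    refine Finset.card_bij (fun S _ => (Fin.cons (i - S.card) (sqf S) : Fin (ρ + 1) → ℕ)) ?_ ?_ ?_
    · intro S hS
      simp only [Finset.mem_filter] at hS ⊢
      refine ⟨(hmem _).mpr ⟨S, hS.1, _, by omega, rfl⟩, ?_⟩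
      rw [hdeg]; omega
    · intro S _ T _ hST
      have := (Fin.cons_injective2 hST).2
      exact sqf_injective this
    · intro M hM
      simp only [Finset.mem_filter] at hM
      obtain ⟨S, hS, a, ha, rfl⟩ := (hmem M).mp hM.1
      rw [hdeg] at hM
      refine ⟨S, ?_, ?_⟩
      · simp only [Finset.mem_filter]; exact ⟨hS, by omega⟩
      · rw [show i - S.card = a by omega]

theorem LowData.isPure {g m : ℕ → ℕ} {ρ e L : ℕ} (D : LowData g m ρ e L) :
    IsPureOSeq (psum g e) e := by
  classical
  have hanti : ∀ a b, a ≤ b → b ≤ e → m b ≤ m a := by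
    intro a b hab
    induction b, hab using Nat.le_induction with
    | base => intro _; exact le_rfl
    | succ b _ ih => intro hb; exact (D.hm b hb).trans (ih (by omega))
  set I : ℕ → Finset (Fin ρ) := fun k => Finset.univ.filter fun j => (j : ℕ) < k with hI
  have hIc : ∀ k ≤ ρ, (I k).card = k := by
    intro k hk
    simp only [hI]
    rw [Fin.card_filter_val_lt]
    omega
  have hImono : ∀ a b, a ≤ b → I a ⊆ I b := by
    intro a b hab j hj
    simp only [hI, Finset.mem_filter, Finset.mem_univ, true_and] at hj ⊢
    omega
  have hmρ : ∀ i ≤ e, m i ≤ ρ := fun i hi => (hanti 0 i (by omega) hi).trans D.m0.le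
  have hY : ∀ i, ∃ Y : Finset (Finset (Fin ρ)), i ≤ e →
      (Finset.powersetCard i (I (m i)) ⊆ Y ∧ Y ⊆ Finset.powersetCard i (I (m (i - 1)))) ∧
        Y.card = g i := by
    intro i
    by_cases hi : i ≤ e
    · have hsub : Finset.powersetCard i (I (m i)) ⊆ Finset.powersetCard i (I (m (i - 1))) :=
        Finset.powersetCard_mono (hImono _ _ (hanti _ _ (by omega) hi))
      obtain ⟨Y, h1, h2, h3⟩ := Finset.exists_subsuperset_card_eq (n := g i) hsub
        (by rw [Finset.card_powersetCard, hIc _ (hmρ i hi)]; exact D.hg i hi)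
        (by
          rw [Finset.card_powersetCard, hIc _ (hmρ (i - 1) (by omega))]
          rcases i with _ | i
          · simp [D.g0]
          · exact D.hu i hi)
      exact ⟨Y, fun _ => ⟨⟨h1, h2⟩, h3⟩⟩
    · exact ⟨∅, fun h => absurd h hi⟩
  choose Y hY using hY
  have hcard : ∀ i ≤ e, ∀ S ∈ Y i, S.card = i ∧ S ⊆ I (m (i - 1)) := by
    intro i hi S hS
    have := (hY i hi).1.2 hS
    rw [Finset.mem_powersetCard] at this
    exact ⟨this.2, this.1⟩
  have hin : ∀ i ≤ e, ∀ S : Finset (Fin ρ), S.card = i → S ⊆ I (m i) → S ∈ Y i := by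
    intro i hi S h1 h2
    exact (hY i hi).1.1 (Finset.mem_powersetCard.mpr ⟨h2, h1⟩)
  refine cone_pure ((Finset.range (e + 1)).biUnion Y) ?_ ?_ _ ?_
  · exact Finset.mem_biUnion.mpr ⟨0, by simp, hin 0 (by omega) ∅ (by simp) (by simp)⟩
  · intro S hS T hT
    obtain ⟨i, hi, hS⟩ := Finset.mem_biUnion.mp hS
    rw [Finset.mem_range] at hi
    obtain ⟨h1, h2⟩ := hcard i (by omega) S hS
    rcases eq_or_ne T S with rfl | hne
    · exact Finset.mem_biUnion.mpr ⟨i, by simpa using hi, hS⟩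
    · have hlt := Finset.card_lt_card (hT.ssubset_of_ne hne)
      refine Finset.mem_biUnion.mpr ⟨T.card, by rw [Finset.mem_range]; omega, ?_⟩
      refine hin _ (by omega) _ rfl (hT.trans (h2.trans (hImono _ _ (hanti _ _ ?_ ?_)))) <;> omega
  · intro i hi
    have : ((Finset.range (e + 1)).biUnion Y).filter (fun S => S.card ≤ i) =
        (Finset.range (i + 1)).biUnion Y := by
      ext S
      simp only [Finset.mem_filter, Finset.mem_biUnion, Finset.mem_range]
      constructor
      · rintro ⟨⟨a, ha, hS⟩, h2⟩
        have := (hcard a (by omega) S hS).1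
        exact ⟨a, by omega, hS⟩
      · rintro ⟨a, ha, hS⟩
        have := (hcard a (by omega) S hS).1
        exact ⟨⟨a, by omega, hS⟩, by omega⟩
    rw [this, Finset.card_biUnion]
    · rw [psum, if_pos hi]
      refine Finset.sum_congr rfl fun j hj => ?_
      rw [Finset.mem_range] at hj
      exact ((hY j (by omega)).2).symm
    · intro a ha b hb hab
      rw [Finset.mem_coe, Finset.mem_range] at ha hb
      rw [Function.onFun, Finset.disjoint_left]
      intro S hS hS'
      have h1 := (hcard a (by omega) S hS).1
      have h2 := (hcard b (by omega) S hS').1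
      omega

theorem length_of_mem_Tails (c L l j k : ℕ) (t : List ℕ) (ht : t ∈ Tails c L l j k) :
    t.length = l := by
  induction l generalizing j k t with
  | zero => simp [Tails] at ht; simp [ht]
  | succ l ih =>
    obtain ⟨n, t', rfl⟩ := exists_of_mem_Tails_succ _ _ _ _ _ _ ht
    rw [mem_Tails_succ] at ht
    obtain ⟨m, -, -, -, -, h⟩ := ht
    simp [ih _ _ _ h]

theorem tails_spec (L l j k : ℕ) (g : ℕ → ℕ)
    (ht : (List.range' (j + 1) l).map g ∈ Tails 0 L l j k) :
    ∃ m : ℕ → ℕ, m j = k ∧ ∀ i, j ≤ i → i + 1 ≤ j + l → L ≤ m (i + 1) ∧ m (i + 1) < m i ∧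
      (m (i + 1)).choose (i + 1) ≤ g (i + 1) ∧ g (i + 1) < (m (i + 1) + 1).choose (i + 1) := by
  induction l generalizing j k with
  | zero => exact ⟨fun _ => k, rfl, fun i h1 h2 => by omega⟩
  | succ l ih =>
    rw [List.range'_succ, List.map_cons, mem_Tails_succ] at ht
    obtain ⟨n, h1, h2, h3, h4, h5⟩ := ht
    obtain ⟨m, hm, H⟩ := ih (j + 1) n h5
    refine ⟨fun i => if i = j then k else m i, by simp, ?_⟩
    intro i hi hi2
    simp only [show i + 1 ≠ j by omega, if_false]
    by_cases hij : i = j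
    · subst hij
      simp only [if_true]
      rw [hm]
      exact ⟨h1, by omega, h3, h4⟩
    · simp only [hij, if_false]
      exact H i (by omega) (by omega)

theorem lower_count (e L ρ : ℕ) (he : 0 < e) (hL : L ≤ ρ) (S : Set (ℕ → ℕ)) (hfin : S.Finite)
    (hS : ∀ g m, LowData g m ρ e L → psum g e ∈ S) :
    (Tails 0 L (e - 1) 1 ρ).card ≤ S.ncard := by
  have hsub : (↑(Tails 0 L (e - 1) 1 ρ) : Set (List ℕ)) ⊆
      (fun h : ℕ → ℕ => (List.range' 2 (e - 1)).map fun i => h i - h (i - 1)) '' S := by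
    intro t ht
    rw [Finset.mem_coe] at ht
    have hlen := length_of_mem_Tails _ _ _ _ _ _ ht
    set g : ℕ → ℕ := fun i => if i = 0 then 1 else if i = 1 then ρ else t.getD (i - 2) 0 with hg
    have hgt : (List.range' 2 (e - 1)).map g = t := by
      refine List.ext_getElem (by simp [hlen]) ?_
      intro i h1 h2
      simp [hg]
      rw [if_neg (by omega), List.getElem?_eq_getElem h2]
      simp
    rw [← hgt] at ht
    obtain ⟨m, hm, H⟩ := tails_spec L (e - 1) 1 ρ g ht
    have D : LowData g (fun i => if i = 0 then ρ else m i) ρ e L := by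
      refine ⟨by simp [hg], by simp [hg], by simp, ?_, ?_, ?_, ?_⟩
      · intro i hi
        rcases i with _ | _ | i
        · simpa using hL
        · simpa [hm] using hL
        · simpa using (H (i + 1) (by omega) (by omega)).1
      · intro i hi
        rcases i with _ | _ | i
        · simp [hg]
        · simp [hg, hm]
        · have := (H (i + 1) (by omega) (by omega)).2.2.1
          simpa using this
      · intro i hi
        rcases i with _ | i
        · simp [hm]
        · have := (H (i + 1) (by omega) (by omega)).2.1
          simpa using this.le
      · intro i hi
        rcases i with _ | i
        · simp [hg]
        · have h1 := H (i + 1) (by omega) (by omega)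
          have h2 := Nat.choose_le_choose (i + 1 + 1) (show m (i + 1 + 1) + 1 ≤ m (i + 1) from h1.2.1)
          simp only [Nat.add_eq_zero_iff, one_ne_zero, and_false, if_false]
          exact (h1.2.2.2.le).trans h2
    refine ⟨psum g e, hS _ _ D, ?_⟩
    conv_rhs => rw [← hgt]
    refine List.map_congr_left ?_
    intro i hi
    rw [List.mem_range'_1] at hi
    obtain ⟨i, rfl⟩ : ∃ i', i = i' + 1 := ⟨i - 1, by omega⟩
    rw [psum_succ (by omega)]
    simp
  have h1 := Set.ncard_le_ncard hsub (hfin.image _)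
  rw [Set.ncard_coe_finset] at h1
  exact h1.trans (Set.ncard_image_le hfin)

/-- For fixed `e > 0`, as `r → ∞`, the numbers of O-sequences, of
differentiable O-sequences, and of pure O-sequences of codimension `r` and socle degree
`e` are all asymptotic to `c_e · r^(C(e+1,2) − 1)`; in particular almost all O-sequences
are pure. -/
theorem count_asymptotics (e : ℕ) (he : 0 < e) :
    Tendsto (fun r : ℕ => (OSeqCount r e : ℝ) / (r : ℝ) ^ (Nat.choose (e + 1) 2 - 1))
      atTop (nhds (cConst e)) ∧
    Tendsto (fun r : ℕ => (diffOSeqCount r e : ℝ) / (r : ℝ) ^ (Nat.choose (e + 1) 2 - 1))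
      atTop (nhds (cConst e)) ∧
    Tendsto (fun r : ℕ => (pureOSeqCount r e : ℝ) / (r : ℝ) ^ (Nat.choose (e + 1) 2 - 1))
      atTop (nhds (cConst e)) := by
  obtain ⟨U, hU⟩ : ∃ U, U = (e + 3) * (e - 1) := ⟨_, rfl⟩
  obtain ⟨A, hA⟩ : ∃ A, A = U + 5 * e + 1 := ⟨_, rfl⟩
  -- upper bounds
  have upO : ∀ r, _ := fun r => upper_count (e + 3) e r he
    {h : ℕ → ℕ | IsOSeq h e ∧ h 1 = r ∧ ∀ i, e < i → h i = 0} (by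
      rintro h ⟨h1, h2, h3⟩
      exact ⟨h1.1, h2, h3, h1.upperRel (by omega)⟩)
  have upP : ∀ r, _ := fun r => upper_count (e + 3) e r he
    {h : ℕ → ℕ | IsPureOSeq h e ∧ h 1 = r ∧ ∀ i, e < i → h i = 0} (by
      rintro h ⟨h1, h2, h3⟩
      obtain ⟨h4, h5⟩ := h1.upper (c := e + 3) (by omega)
      exact ⟨h4, h2, h3, h5⟩)
  have subDO : ∀ r, {h : ℕ → ℕ | IsOSeq h e ∧ IsDifferentiable h e ∧ h 1 = r ∧
      ∀ i, e < i → h i = 0} ⊆ {h : ℕ → ℕ | IsOSeq h e ∧ h 1 = r ∧ ∀ i, e < i → h i = 0} := by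
    rintro r h ⟨h1, -, h2, h3⟩
    exact ⟨h1, h2, h3⟩
  have leDO : ∀ r, diffOSeqCount r e ≤ OSeqCount r e := fun r =>
    Set.ncard_le_ncard (subDO r) (upO r).1
  -- lower bounds
  have hp1 : ∀ r, 1 ≤ r → ∀ g m, LowData g m (r - 1) e (3 * e) →
      psum g e 1 = r ∧ ∀ i, e < i → psum g e i = 0 := by
    intro r hr g m D
    refine ⟨?_, fun i hi => by rw [psum, if_neg (by omega)]⟩
    have := psum_succ (g := g) (e := e) (i := 0) (by omega)
    rw [zero_add] at this
    rw [this, psum_zero, D.g0, D.g1]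
    omega
  have loD : ∀ r, 3 * e + 1 ≤ r → (Tails 0 (3 * e) (e - 1) 1 (r - 1)).card ≤ diffOSeqCount r e := by
    intro r hr
    refine lower_count e (3 * e) (r - 1) he (by omega) _ ((upO r).1.subset (subDO r)) ?_
    intro g m D
    obtain ⟨h1, h2⟩ := hp1 r (by omega) g m D
    exact ⟨D.isOSeq le_rfl, D.isDiff (by omega), h1, h2⟩
  have loP : ∀ r, 3 * e + 1 ≤ r → (Tails 0 (3 * e) (e - 1) 1 (r - 1)).card ≤ pureOSeqCount r e := by
    intro r hr
    refine lower_count e (3 * e) (r - 1) he (by omega) _ (upP r).1 ?_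
    intro g m D
    obtain ⟨h1, h2⟩ := hp1 r (by omega) g m D
    exact ⟨D.isPure, h1, h2⟩
  rw [← aCoef_cConst e he, ← sExp_final e he]
  have ha := aCoef_nonneg (e - 1) 1
  have upper : ∀ r : ℕ, ((Tails (e + 3) 0 (e - 1) 1 r).card : ℝ) ≤
      aCoef (e - 1) 1 * ((r : ℝ) + A) ^ sExp (e - 1) 1 := by
    intro r
    refine (card_Tails_upper (e + 3) (e - 1) 1 r).trans ?_
    have : (((e + 3) * (e - 1) : ℕ) : ℝ) ≤ (A : ℝ) := by
      rw [← hU]; exact_mod_cast (by omega)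
    gcongr
  have lower : ∀ r : ℕ, aCoef (e - 1) 1 * (((r - A : ℕ) : ℝ)) ^ sExp (e - 1) 1 ≤
      ((Tails 0 (3 * e) (e - 1) 1 (r - 1)).card : ℝ) := by
    intro r
    refine le_trans ?_ (card_Tails_lower (3 * e) (3 * e) (e - 1) 1 (r - 1) le_rfl (by omega) le_rfl)
    have : r - A ≤ r - 1 - (3 * e + (e - 1)) := by omega
    gcongr
  have ev : ∀ᶠ r in atTop, 3 * e + 1 ≤ r := eventually_ge_atTop _
  refine ⟨?_, ?_, ?_⟩
  · refine tendsto_of_bounds _ _ A _ (Eventually.of_forall fun r => ?_) ?_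
    · exact le_trans (by exact_mod_cast (upO r).2) (upper r)
    · filter_upwards [ev] with r hr
      exact (lower r).trans (by exact_mod_cast (loD r hr).trans (leDO r))
  · refine tendsto_of_bounds _ _ A _ (Eventually.of_forall fun r => ?_) ?_
    · exact le_trans (by exact_mod_cast (leDO r).trans (upO r).2) (upper r)
    · filter_upwards [ev] with r hr
      exact (lower r).trans (by exact_mod_cast (loD r hr))
  · refine tendsto_of_bounds _ _ A _ (Eventually.of_forall fun r => ?_) ?_
    · exact le_trans (by exact_mod_cast (upP r).2) (upper r)
    · filter_upwards [ev] with r hr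
      exact (lower r).trans (by exact_mod_cast (loP r hr))
end
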